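/- Let k ≥ 3 and let G be a 2-connected graph on n vertices with minimum degree at least k. If G contains a cycle of length 4, then G contains k admissible cycles, unless G is isomorphic to K_{k+1} or to K_{k,n-k}. -/

import Mathlib

open SimpleGraph

/-- `G` has a cycle of length `n`. -/
def HasCycleLen {V : Type*} (G : SimpleGraph V) (n : ℕ) : Prop :=
  ∃ (v : V) (c : G.Walk v v), c.IsCycle ∧ c.length = n

/-- `G` contains `k` admissible cycles: `k` cycles whose lengths form an arithmetic
progression with common difference 1 or 2. -/
def HasAdmissibleCycles {V : Type*} (G : SimpleGraph V) (k : ℕ) : Prop :=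
  ∃ a d : ℕ, (d = 1 ∨ d = 2) ∧ ∀ i < k, HasCycleLen G (a + i * d)

/-- `G` is `t`-connected: it has at least `t+1` vertices and the deletion of any set
of at most `t-1` vertices leaves a connected graph. -/
def KConnected {V : Type*} [Fintype V] (G : SimpleGraph V) (t : ℕ) : Prop :=
  t + 1 ≤ Fintype.card V ∧
    ∀ S : Finset V, S.card ≤ t - 1 → (G.induce ((↑S : Set V)ᶜ)).Connected

section Paths

variable {V : Type*} [DecidableEq V]

/-- `PathIn G n W u v`: there is a path of length `n` from `u` to `v` with all vertices in `W`. -/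
def PathIn (G : SimpleGraph V) : ℕ → Finset V → V → V → Prop
  | 0, W, u, v => u = v ∧ u ∈ W
  | n + 1, W, u, v => u ∈ W ∧ ∃ w, G.Adj u w ∧ PathIn G n (W.erase u) w v

variable {G H : SimpleGraph V} {n m : ℕ} {W W₁ W₂ : Finset V} {u v w : V}

theorem PathIn.left_mem (h : PathIn G n W u v) : u ∈ W := by
  cases n with
  | zero => exact h.2
  | succ n => exact h.1

theorem PathIn.right_mem (h : PathIn G n W u v) : v ∈ W := by
  induction n generalizing W u with
  | zero => exact h.1 ▸ h.2
  | succ n ih =>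
    obtain ⟨_, w, _, hw⟩ := h
    exact Finset.mem_of_mem_erase (ih hw)

theorem PathIn.mono (h : PathIn G n W₁ u v) (hW : W₁ ⊆ W₂) : PathIn G n W₂ u v := by
  induction n generalizing W₁ W₂ u with
  | zero => exact ⟨h.1, hW h.2⟩
  | succ n ih =>
    obtain ⟨hu, w, hw, hp⟩ := h
    exact ⟨hW hu, w, hw, ih hp (Finset.erase_subset_erase _ hW)⟩

theorem PathIn.mono_graph (h : PathIn G n W u v)
    (hG : ∀ a ∈ W, ∀ b ∈ W, G.Adj a b → H.Adj a b) : PathIn H n W u v := by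
  induction n generalizing W u with
  | zero => exact h
  | succ n ih =>
    obtain ⟨hu, w, hw, hp⟩ := h
    refine ⟨hu, w, hG u hu w (Finset.mem_of_mem_erase hp.left_mem) hw, ih hp fun a ha b hb => ?_⟩
    exact hG a (Finset.mem_of_mem_erase ha) b (Finset.mem_of_mem_erase hb)

theorem PathIn.cons (h : PathIn G n W v w) (ha : G.Adj u v) (hu : u ∉ W) :
    PathIn G (n + 1) (insert u W) u w :=
  ⟨Finset.mem_insert_self _ _, v, ha, by rwa [Finset.erase_insert hu]⟩

theorem PathIn.cons' (h : PathIn G n W₁ v w) (ha : G.Adj u v) (hu : u ∉ W₁) (hu' : u ∈ W₂)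
    (hW : W₁ ⊆ W₂) : PathIn G (n + 1) W₂ u w :=
  (h.cons ha hu).mono (Finset.insert_subset hu' hW)

theorem PathIn.append (h₁ : PathIn G n W₁ u v) (h₂ : PathIn G m W₂ v w)
    (hd : ∀ x ∈ W₁, x ∈ W₂ → x = v) : PathIn G (n + m) (W₁ ∪ W₂) u w := by
  induction n generalizing W₁ u with
  | zero =>
    obtain ⟨rfl, _⟩ := h₁
    rw [Nat.zero_add]
    exact h₂.mono Finset.subset_union_right
  | succ n ih =>
    obtain ⟨hu, x, hx, hp⟩ := h₁
    have hv := hp.right_mem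
    have := ih hp (fun y hy => hd y (Finset.mem_of_mem_erase hy))
    have huW : u ∉ W₂ := fun hu2 => by
      have := hd u hu hu2
      subst this
      exact absurd hv (Finset.notMem_erase _ _)
    rw [Nat.add_right_comm]
    refine ⟨Finset.mem_union_left _ hu, x, hx, this.mono ?_⟩
    intro y hy
    grind

theorem PathIn.append' (h₁ : PathIn G n W₁ u v) (h₂ : PathIn G m W₂ v w)
    (hd : ∀ x ∈ W₁, x ∈ W₂ → x = v) (hW₁ : W₁ ⊆ W) (hW₂ : W₂ ⊆ W) : PathIn G (n + m) W u w :=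
  (h₁.append h₂ hd).mono (Finset.union_subset hW₁ hW₂)

theorem pathIn_zero (hu : u ∈ W) : PathIn G 0 W u u := ⟨rfl, hu⟩

theorem pathIn_one (hu : u ∈ W) (hv : v ∈ W) (h : G.Adj u v) : PathIn G 1 W u v :=
  ⟨hu, v, h, rfl, Finset.mem_erase.2 ⟨h.ne', hv⟩⟩

theorem PathIn.symm (h : PathIn G n W u v) : PathIn G n W v u := by
  induction n generalizing W u with
  | zero => obtain ⟨rfl, h⟩ := h; exact ⟨rfl, h⟩
  | succ n ih =>
    obtain ⟨hu, w, hw, hp⟩ := h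
    have h1 : PathIn G 1 {w, u} w u := pathIn_one (by simp) (by simp) hw.symm
    refine (ih hp).append' h1 ?_ (Finset.erase_subset _ _) ?_
    · intro x hx hx'
      grind
    · have := hp.left_mem
      intro x hx
      grind

theorem PathIn.eq_of_self (h : PathIn G n W u u) : n = 0 := by
  cases n with
  | zero => rfl
  | succ n =>
    obtain ⟨_, w, _, hp⟩ := h
    exact absurd hp.right_mem (Finset.notMem_erase _ _)

/-- A path ending in `v` either avoids `a`, or its initial segment up to `a` avoids `v`. -/
theorem PathIn.split (h : PathIn G n W u v) (a : V) :
    PathIn G n (W.erase a) u v ∨ a = v ∨ ∃ m, PathIn G m (W.erase v) u a := by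
  induction n generalizing W u with
  | zero =>
    obtain ⟨rfl, hu⟩ := h
    by_cases ha : a = u
    · exact Or.inr (Or.inl ha)
    · exact Or.inl ⟨rfl, Finset.mem_erase.2 ⟨Ne.symm ha, hu⟩⟩
  | succ n ih =>
    obtain ⟨hu, w, hw, hp⟩ := h
    by_cases hav : a = v
    · exact Or.inr (Or.inl hav)
    have huv : u ≠ v := fun h => by
      subst h; exact absurd hp.right_mem (Finset.notMem_erase _ _)
    by_cases hau : a = u
    · subst hau
      exact Or.inr (Or.inr ⟨0, rfl, Finset.mem_erase.2 ⟨huv, hu⟩⟩)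
    rcases ih hp with h1 | h1 | ⟨m, h1⟩
    · refine Or.inl ⟨Finset.mem_erase.2 ⟨Ne.symm hau, hu⟩, w, hw, ?_⟩
      rwa [Finset.erase_right_comm]
    · exact absurd h1 hav
    · refine Or.inr (Or.inr ⟨m + 1, Finset.mem_erase.2 ⟨huv, hu⟩, w, hw, ?_⟩)
      rwa [Finset.erase_right_comm]

theorem PathIn.exists_walk (h : PathIn G n W u v) :
    ∃ p : G.Walk u v, p.IsPath ∧ p.length = n ∧ ∀ x ∈ p.support, x ∈ W := by
  induction n generalizing W u with
  | zero =>
    obtain ⟨rfl, hu⟩ := h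
    exact ⟨Walk.nil, by simp, rfl, by simpa using hu⟩
  | succ n ih =>
    obtain ⟨hu, w, hw, hp⟩ := h
    obtain ⟨p, h1, h2, h3⟩ := ih hp
    refine ⟨Walk.cons hw p, ?_, by simp [h2], ?_⟩
    · rw [Walk.cons_isPath_iff]
      exact ⟨h1, fun hx => absurd (h3 _ hx) (Finset.notMem_erase _ _)⟩
    · intro x hx
      rw [Walk.support_cons, List.mem_cons] at hx
      rcases hx with rfl | hx
      · exact hu
      · exact Finset.mem_of_mem_erase (h3 _ hx)

theorem PathIn.hasCycleLen_of_adj (h : PathIn G n W u v) (hn : 2 ≤ n) (ha : G.Adj u v) :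
    HasCycleLen G (n + 1) := by
  obtain ⟨n, rfl⟩ : ∃ m, n = m + 1 := ⟨n - 1, by omega⟩
  obtain ⟨_, w, hw, hp⟩ := h
  obtain ⟨p, h1, h2, h3⟩ := hp.exists_walk
  have hup : u ∉ p.support := fun hx => absurd (h3 _ hx) (Finset.notMem_erase _ _)
  refine ⟨v, Walk.cons ha.symm (Walk.cons hw p), ?_, by simp [h2]⟩
  rw [Walk.cons_isCycle_iff]
  refine ⟨by rw [Walk.cons_isPath_iff]; exact ⟨h1, hup⟩, ?_⟩
  rw [Walk.edges_cons, List.mem_cons]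
  rintro (h | h)
  · have : v = w := by
      rw [Sym2.eq_iff] at h
      rcases h with ⟨h, _⟩ | ⟨h, _⟩
      · exact absurd h.symm ha.ne
      · exact h
    subst this
    have := hp.eq_of_self
    omega
  · exact hup (Walk.snd_mem_support_of_mem_edges _ h)

theorem PathIn.hasCycleLen (h₁ : PathIn G n W₁ u v) (h₂ : PathIn G m W₂ v u)
    (hd : ∀ x ∈ W₁, x ∈ W₂ → x = u ∨ x = v) (hn : 1 ≤ n) (hm : 2 ≤ m) :
    HasCycleLen G (n + m) := by
  obtain ⟨n, rfl⟩ : ∃ m, n = m + 1 := ⟨n - 1, by omega⟩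
  obtain ⟨_, w, hw, hp⟩ := h₁
  have := hp.append h₂ (fun x hx hx' => (hd x (Finset.mem_of_mem_erase hx) hx').resolve_left
    (Finset.ne_of_mem_erase hx))
  have := this.hasCycleLen_of_adj (by omega) hw.symm
  rwa [Nat.add_right_comm] at this

end Paths

section NeighboursAndProgressions

variable {V : Type*} [DecidableEq V]

open Classical in
/-- The neighbours of `v` inside `U`. -/
noncomputable def nbrs (G : SimpleGraph V) (U : Finset V) (v : V) : Finset V :=
  U.filter (G.Adj v)

/-- `(U; x, y)` is rooted 2-connected: no vertex `q` separates a nonempty set of inner vertices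
from the rest of `U`. -/
def RootedConn (G : SimpleGraph V) (U : Finset V) (x y : V) : Prop :=
  ∀ X ⊆ U, X.Nonempty → x ∉ X → y ∉ X → ∀ q, ∃ u ∈ X, ∃ v ∈ U, v ∉ X ∧ v ≠ q ∧ G.Adj u v

/-- `f` holds on an arithmetic progression of `k` terms with common difference 1 or 2. -/
def HoldsOnAP (k : ℕ) (f : ℕ → Prop) : Prop :=
  ∃ a d : ℕ, (d = 1 ∨ d = 2) ∧ ∀ i < k, f (a + i * d)

/-- `R` induces a connected subgraph of `G`, phrased through edge cuts. -/
def ConnOn (G : SimpleGraph V) (R : Finset V) : Prop :=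
  ∀ X ⊆ R, X.Nonempty → (∃ z ∈ R, z ∉ X) → ∃ u ∈ X, ∃ v ∈ R, v ∉ X ∧ G.Adj u v

variable {G : SimpleGraph V} {U W R : Finset V} {u v w x y z : V}

@[simp] theorem mem_nbrs {V : Type*} {G : SimpleGraph V} {U : Finset V} {u v : V} :
    u ∈ nbrs G U v ↔ u ∈ U ∧ G.Adj v u := by
  simp [nbrs]

theorem nbrs_subset : nbrs G U v ⊆ U := fun _ h => (mem_nbrs.1 h).1

theorem nbrs_mono (h : W ⊆ U) : nbrs G W v ⊆ nbrs G U v := fun _ hx =>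
  mem_nbrs.2 ⟨h (mem_nbrs.1 hx).1, (mem_nbrs.1 hx).2⟩

theorem card_nbrs_mono (h : W ⊆ U) : (nbrs G W v).card ≤ (nbrs G U v).card :=
  Finset.card_le_card (nbrs_mono h)

theorem nbrs_union_subset : nbrs G (U ∪ W) v ⊆ nbrs G U v ∪ nbrs G W v := fun x hx => by
  simp only [mem_nbrs, Finset.mem_union] at hx ⊢
  tauto

theorem card_nbrs_union_le : (nbrs G (U ∪ W) v).card ≤ (nbrs G U v).card + (nbrs G W v).card :=
  (Finset.card_le_card nbrs_union_subset).trans (Finset.card_union_le _ _)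

theorem HoldsOnAP.mono {k k' : ℕ} {f g : ℕ → Prop} (h : HoldsOnAP k f) (hk : k' ≤ k)
    (hfg : ∀ ℓ, f ℓ → g ℓ) : HoldsOnAP k' g := by
  obtain ⟨a, d, hd, h⟩ := h
  exact ⟨a, d, hd, fun i hi => hfg _ (h i (by omega))⟩

theorem HoldsOnAP.sum {m p k c d₀ : ℕ} {f g : ℕ → Prop} (hf : HoldsOnAP m f) (hm : 1 ≤ m)
    (hp : 1 ≤ p) (hd₀ : d₀ = 1 ∨ d₀ = 2)
    (h : ∀ ℓ, f ℓ → ∀ j < p, g (ℓ + c + j * d₀)) (hk : k ≤ m + p - 1) : HoldsOnAP k g := by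
  obtain ⟨a, d, hd, hf⟩ := hf
  have key : ∀ i < m, ∀ j < p, g (a + c + i * d + j * d₀) := fun i hi j hj => by
    have := h _ (hf i hi) j hj
    rwa [show a + c + i * d + j * d₀ = a + i * d + c + j * d₀ by ring]
  have eqd : d = d₀ → HoldsOnAP k g := by
    rintro rfl
    refine ⟨a + c, d, hd, fun t ht => ?_⟩
    have := key (min t (m - 1)) (by omega) (t - min t (m - 1)) (by omega)
    rwa [add_assoc, ← add_mul, show min t (m - 1) + (t - min t (m - 1)) = t by omega] at this
  by_cases hdd : d = d₀
  · exact eqd hdd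
  by_cases hm1 : m = 1
  · subst hm1
    refine ⟨a + c, d₀, hd₀, fun t ht => ?_⟩
    have := key 0 (by omega) t (by omega)
    simpa using this
  by_cases hp1 : p = 1
  · subst hp1
    refine ⟨a + c, d, hd, fun t ht => ?_⟩
    have := key t (by omega) 0 (by omega)
    simpa using this
  refine ⟨a + c, 1, Or.inl rfl, fun t ht => ?_⟩
  rcases hd with rfl | rfl
  · obtain rfl : d₀ = 2 := by omega
    have := key (t - 2 * min (t / 2) (p - 1)) (by omega) (min (t / 2) (p - 1)) (by omega)
    rwa [show a + c + (t - 2 * min (t / 2) (p - 1)) * 1 + min (t / 2) (p - 1) * 2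
      = a + c + t * 1 by omega] at this
  · obtain rfl : d₀ = 1 := by omega
    have := key (min (t / 2) (m - 1)) (by omega) (t - 2 * min (t / 2) (m - 1)) (by omega)
    rwa [show a + c + min (t / 2) (m - 1) * 2 + (t - 2 * min (t / 2) (m - 1)) * 1
      = a + c + t * 1 by omega] at this

theorem HoldsOnAP.combine {m p k c : ℕ} {f h g : ℕ → Prop} (hf : HoldsOnAP m f) (hh : HoldsOnAP p h)
    (hm : 1 ≤ m) (hp : 1 ≤ p) (H : ∀ ℓ ℓ', f ℓ → h ℓ' → g (ℓ + ℓ' + c)) (hk : k ≤ m + p - 1) :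
    HoldsOnAP k g := by
  obtain ⟨a, d, hd, hh⟩ := hh
  refine hf.sum (c := a + c) (d₀ := d) hm hp hd (fun ℓ hℓ j hj => ?_) hk
  have := H ℓ _ hℓ (hh j hj)
  rwa [show ℓ + (a + c) + j * d = ℓ + (a + j * d) + c by ring]

theorem holdsOnAP_one {f : ℕ → Prop} {ℓ : ℕ} (h : f ℓ) : HoldsOnAP 1 f :=
  ⟨ℓ, 1, Or.inl rfl, fun i hi => by
    obtain rfl : i = 0 := by omega
    simpa using h⟩

theorem holdsOnAP_two {f : ℕ → Prop} {ℓ d : ℕ} (hd : d = 1 ∨ d = 2) (h : f ℓ) (h' : f (ℓ + d)) :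
    HoldsOnAP 2 f :=
  ⟨ℓ, d, hd, fun i hi => by
    interval_cases i
    · simpa using h
    · simpa using h'⟩

/-- The component of `r` in `W`. -/
theorem exists_component (G : SimpleGraph V) (hr : x ∈ W) :
    ∃ R ⊆ W, x ∈ R ∧ (∀ u ∈ R, ∀ v ∈ W, G.Adj u v → v ∈ R) ∧ ConnOn G R := by
  classical
  let S := W.powerset.filter fun R => x ∈ R ∧ ∀ u ∈ R, ∀ v ∈ W, G.Adj u v → v ∈ R
  have hS : S.Nonempty := ⟨W, by simp [S, hr]; tauto⟩
  obtain ⟨R, hR, hmin⟩ := S.exists_min_image Finset.card hS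
  simp only [S, Finset.mem_filter, Finset.mem_powerset] at hR hmin
  obtain ⟨hRW, hxR, hcl⟩ := hR
  have key : ∀ X ⊆ R, X.Nonempty → x ∉ X → ∃ u ∈ X, ∃ v ∈ R, v ∉ X ∧ G.Adj u v := by
    intro X hX hne hx
    by_contra! hcon
    have := hmin (R \ X) ⟨Finset.sdiff_subset.trans hRW, by simp [hxR, hx], ?_⟩
    · have h1 := Finset.card_sdiff_add_card_eq_card hX
      have := hne.card_pos
      omega
    · intro u hu v hv huv
      rw [Finset.mem_sdiff] at hu ⊢
      have := hcl u hu.1 v hv huv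
      exact ⟨this, fun hvX => hcon v hvX u hu.1 hu.2 huv.symm⟩
  refine ⟨R, hRW, hxR, hcl, fun X hX hne ⟨z, hz, hzX⟩ => ?_⟩
  by_cases hx : x ∈ X
  · obtain ⟨u, hu, v, hv, hvX, huv⟩ := key (R \ X) Finset.sdiff_subset
      ⟨z, by simp [hz, hzX]⟩ (by simp [hx])
    rw [Finset.mem_sdiff] at hu
    refine ⟨v, ?_, u, hu.1, hu.2, huv.symm⟩
    by_contra hvn
    exact hvX (Finset.mem_sdiff.2 ⟨hv, hvn⟩)
  · exact key X hX hne hx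

theorem ConnOn.exists_pathIn (h : ConnOn G R) (hu : u ∈ R) (hv : v ∈ R) :
    ∃ n, PathIn G n R u v := by
  classical
  by_contra hcon
  obtain ⟨z, hz, w, hw, hwX, hzw⟩ := h (R.filter fun z => ∃ n, PathIn G n R u z)
    (Finset.filter_subset _ _) ⟨u, by simpa [hu] using ⟨0, pathIn_zero hu⟩⟩
    ⟨v, hv, by simpa [hv] using hcon⟩
  simp only [Finset.mem_filter, not_and] at hz hwX
  obtain ⟨hz, n, hn⟩ := hz
  refine hwX hw ?_
  rcases hn.split w with h1 | h1 | ⟨m, h1⟩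
  · exact ⟨n + 1, (h1.symm.cons' hzw.symm (Finset.notMem_erase _ _) hw
      (Finset.erase_subset _ _)).symm⟩
  · exact absurd h1 hzw.ne'
  · exact ⟨m, h1.mono (Finset.erase_subset _ _)⟩

end NeighboursAndProgressions

section Contraction

variable {V : Type*} [DecidableEq V]

/-- Hypotheses of the rooted path theorem: `(U; x, y)` is rooted 2-connected, has an inner vertex
other than the exceptional vertex `z`, and (if `k ≥ 2`) every such vertex has degree at least
`k + 1`; an exceptional vertex is only allowed for `k ≤ 2`. -/
structure RootedHyp (G : SimpleGraph V) (U : Finset V) (x y z : V) (k : ℕ) : Prop where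
  ne : x ≠ y
  left_mem : x ∈ U
  right_mem : y ∈ U
  conn : RootedConn G U x y
  exists_inner : ∃ v ∈ U, v ≠ x ∧ v ≠ y ∧ v ≠ z
  pos : 1 ≤ k
  deg : 2 ≤ k → ∀ v ∈ U, v ≠ x → v ≠ y → v ≠ z → k + 1 ≤ (nbrs G U v).card
  exc : 3 ≤ k → z = x

/-- There are `k` admissible paths of length at least 2 from `x` to `y` in `U`. -/
def AdmPaths (G : SimpleGraph V) (U : Finset V) (x y : V) (k : ℕ) : Prop :=
  HoldsOnAP k fun ℓ => 2 ≤ ℓ ∧ PathIn G ℓ U x y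

/-- The rooted path theorem for vertex sets with fewer than `N` elements. -/
def RootedBelow (V : Type*) [DecidableEq V] (N : ℕ) : Prop :=
  ∀ (G : SimpleGraph V) (U : Finset V) (x y z : V) (k : ℕ), U.card < N →
    RootedHyp G U x y z k → AdmPaths G U x y k

variable {G : SimpleGraph V}

theorem RootedConn.symm {V : Type*} {G : SimpleGraph V} {U : Finset V} {x y : V}
    (h : RootedConn G U x y) : RootedConn G U y x :=
  fun X hX hne hy hx q => h X hX hne hx hy q

theorem AdmPaths.symm {U : Finset V} {x y : V} {k : ℕ} (h : AdmPaths G U x y k) :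
    AdmPaths G U y x k :=
  HoldsOnAP.mono h le_rfl fun _ h => ⟨h.1, h.2.symm⟩

/-- Contracting `S` and `Y` to single roots: admissible paths from `S` to `Y` with all inner
vertices in `C`. -/
theorem exists_paths_of_contraction {N k : ℕ} (hT : RootedBelow V N) {C S Y : Finset V} {z : V}
    (hCS : Disjoint C S) (hCY : Disjoint C Y) (hSY : Disjoint S Y)
    (hSne : S.Nonempty) (hYne : Y.Nonempty) (hcard : C.card + 2 < N)
    (hin : ∃ v ∈ C, v ≠ z) (hk : 1 ≤ k) (hz : 3 ≤ k → z ∉ C)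
    (hA : ∀ X ⊆ C, X.Nonempty → ∃ u ∈ X, ∃ v ∈ C ∪ Y, v ∉ X ∧ G.Adj u v)
    (hB : ∀ X ⊆ C, X.Nonempty → ∃ u ∈ X, ∃ v ∈ C ∪ S, v ∉ X ∧ G.Adj u v)
    (hC : ∀ X ⊆ C, X.Nonempty → ∀ q ∈ C, ∃ u ∈ X, ∃ v ∈ C ∪ S ∪ Y, v ∉ X ∧ v ≠ q ∧ G.Adj u v)
    (hdeg : 2 ≤ k → ∀ w ∈ C, w ≠ z →
      k + 1 ≤ (nbrs G C w).card + min 1 (nbrs G S w).card + min 1 (nbrs G Y w).card) :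
    HoldsOnAP k fun ℓ => 2 ≤ ℓ ∧ ∃ s ∈ S, ∃ t ∈ Y, PathIn G ℓ (insert s (insert t C)) s t := by
  classical
  obtain ⟨s₁, hs₁⟩ := hSne
  obtain ⟨y₁, hy₁⟩ := hYne
  have hsC : s₁ ∉ C := fun h => Finset.disjoint_left.1 hCS h hs₁
  have hyC : y₁ ∉ C := fun h => Finset.disjoint_left.1 hCY h hy₁
  have hsy : s₁ ≠ y₁ := fun h => Finset.disjoint_left.1 hSY hs₁ (h ▸ hy₁)
  let r : V → V → Prop := fun a b => (a ∈ C ∧ b ∈ C ∧ G.Adj a b) ∨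
    (a = s₁ ∧ b ∈ C ∧ ∃ s ∈ S, G.Adj s b) ∨ (a = y₁ ∧ b ∈ C ∧ ∃ t ∈ Y, G.Adj t b)
  let G' := SimpleGraph.fromRel r
  let U' := insert s₁ (insert y₁ C)
  have adjC : ∀ a ∈ C, ∀ b ∈ C, G'.Adj a b ↔ G.Adj a b := by
    intro a ha b hb
    have := @SimpleGraph.Adj.ne V G a b
    have := G.adj_comm a b
    simp only [G', SimpleGraph.fromRel_adj, r]
    grind
  have adjS : ∀ b, G'.Adj s₁ b ↔ b ∈ C ∧ ∃ s ∈ S, G.Adj s b := by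
    intro b
    simp only [G', SimpleGraph.fromRel_adj, r]
    grind
  have adjY : ∀ b, G'.Adj y₁ b ↔ b ∈ C ∧ ∃ t ∈ Y, G.Adj t b := by
    intro b
    simp only [G', SimpleGraph.fromRel_adj, r]
    grind
  have hU' : ∀ a, a ∈ U' ↔ a = s₁ ∨ a = y₁ ∨ a ∈ C := by simp [U']
  have lift : ∀ X ⊆ C, ∀ u ∈ X, ∀ v ∈ C ∪ S ∪ Y, v ∉ X → G.Adj u v →
      (v ∈ C ∧ G'.Adj u v) ∨ (v ∈ S ∧ G'.Adj u s₁) ∨ (v ∈ Y ∧ G'.Adj u y₁) := by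
    intro X hX u hu v hv hvX huv
    simp only [Finset.mem_union] at hv
    rcases hv with (hv | hv) | hv
    · exact Or.inl ⟨hv, (adjC u (hX hu) v hv).2 huv⟩
    · exact Or.inr (Or.inl ⟨hv, ((adjS u).2 ⟨hX hu, v, hv, huv.symm⟩).symm⟩)
    · exact Or.inr (Or.inr ⟨hv, ((adjY u).2 ⟨hX hu, v, hv, huv.symm⟩).symm⟩)
  have hyp : RootedHyp G' U' s₁ y₁ (if z ∈ C then z else s₁) k := by
    refine ⟨hsy, by simp [U'], by simp [U'], ?_, ?_, hk, ?_, ?_⟩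
    · intro X hX hne hx hy q
      have hXC : X ⊆ C := fun a ha => by
        have := (hU' a).1 (hX ha)
        rcases this with rfl | rfl | h
        · exact absurd ha hx
        · exact absurd ha hy
        · exact h
      by_cases hqC : q ∈ C
      · obtain ⟨u, hu, v, hv, hvX, hvq, huv⟩ := hC X hXC hne q hqC
        rcases lift X hXC u hu v hv hvX huv with ⟨h1, h2⟩ | ⟨h1, h2⟩ | ⟨h1, h2⟩
        · exact ⟨u, hu, v, by simp [hU', h1], hvX, hvq, h2⟩
        · exact ⟨u, hu, s₁, by simp [hU'], hx, fun h => hsC (h ▸ hqC), h2⟩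
        · exact ⟨u, hu, y₁, by simp [hU'], hy, fun h => hyC (h ▸ hqC), h2⟩
      by_cases hqy : q = y₁
      · obtain ⟨u, hu, v, hv, hvX, huv⟩ := hB X hXC hne
        rcases lift X hXC u hu v (Finset.mem_union_left _ hv) hvX huv with
          ⟨h1, h2⟩ | ⟨h1, h2⟩ | ⟨h1, h2⟩
        · exact ⟨u, hu, v, by simp [hU', h1], hvX, fun h => hqC (h ▸ h1), h2⟩
        · exact ⟨u, hu, s₁, by simp [hU'], hx, hqy ▸ hsy, h2⟩
        · exfalso
          rcases Finset.mem_union.1 hv with h | h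
          · exact Finset.disjoint_left.1 hCY h h1
          · exact Finset.disjoint_left.1 hSY h h1
      · obtain ⟨u, hu, v, hv, hvX, huv⟩ := hA X hXC hne
        have hv' : v ∈ C ∪ S ∪ Y := by
          simp only [Finset.mem_union] at hv ⊢
          tauto
        rcases lift X hXC u hu v hv' hvX huv with ⟨h1, h2⟩ | ⟨h1, h2⟩ | ⟨h1, h2⟩
        · exact ⟨u, hu, v, by simp [hU', h1], hvX, fun h => hqC (h ▸ h1), h2⟩
        · exfalso
          rcases Finset.mem_union.1 hv with h | h
          · exact Finset.disjoint_left.1 hCS h h1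
          · exact Finset.disjoint_left.1 hSY h1 h
        · exact ⟨u, hu, y₁, by simp [hU'], hy, Ne.symm hqy, h2⟩
    · obtain ⟨v, hv, hvz⟩ := hin
      refine ⟨v, by simp [hU', hv], fun h => hsC (h ▸ hv), fun h => hyC (h ▸ hv), ?_⟩
      split_ifs
      · exact hvz
      · exact fun h => hsC (h ▸ hv)
    · intro h2 w hw hws hwy hwz
      have hwC : w ∈ C := by
        have := (hU' w).1 hw
        tauto
      have hwz' : w ≠ z := by
        rintro rfl
        simp [hwC] at hwz
      refine (hdeg h2 w hwC hwz').trans ?_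
      have e1 : min 1 (nbrs G S w).card ≤ (if G'.Adj w s₁ then {s₁} else (∅ : Finset V)).card := by
        by_cases h0 : (nbrs G S w) = ∅
        · simp [h0]
        · obtain ⟨s, hs⟩ := Finset.nonempty_iff_ne_empty.2 h0
          rw [mem_nbrs] at hs
          rw [if_pos ((adjS w).2 ⟨hwC, s, hs.1, hs.2.symm⟩).symm]
          simp
      have e2 : min 1 (nbrs G Y w).card ≤ (if G'.Adj w y₁ then {y₁} else (∅ : Finset V)).card := by
        by_cases h0 : (nbrs G Y w) = ∅
        · simp [h0]
        · obtain ⟨s, hs⟩ := Finset.nonempty_iff_ne_empty.2 h0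
          rw [mem_nbrs] at hs
          rw [if_pos ((adjY w).2 ⟨hwC, s, hs.1, hs.2.symm⟩).symm]
          simp
      refine (add_le_add (add_le_add_right e1 _) e2).trans ?_
      rw [← Finset.card_union_of_disjoint, ← Finset.card_union_of_disjoint]
      · refine Finset.card_le_card fun a ha => ?_
        rw [mem_nbrs]
        simp only [Finset.mem_union, mem_nbrs] at ha
        rcases ha with (⟨h, h'⟩ | h) | h
        · exact ⟨by simp [hU', h], (adjC w hwC a h).2 h'⟩
        · split_ifs at h with h'
          · simp only [Finset.mem_singleton] at h
            subst h
            exact ⟨by simp [hU'], h'⟩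
          · simp at h
        · split_ifs at h with h'
          · simp only [Finset.mem_singleton] at h
            subst h
            exact ⟨by simp [hU'], h'⟩
          · simp at h
      · rw [Finset.disjoint_left]
        intro a ha ha'
        have : a = y₁ := by
          split_ifs at ha' <;> simp_all
        subst this
        simp only [Finset.mem_union, mem_nbrs] at ha
        rcases ha with h | h
        · exact hyC h.1
        · split_ifs at h <;> simp_all
      · rw [Finset.disjoint_left]
        intro a ha ha'
        have : a = s₁ := by
          split_ifs at ha' <;> simp_all
        subst this
        exact hsC (mem_nbrs.1 ha).1
    · intro h3
      rw [if_neg (hz h3)]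
  have hc : U'.card < N := by
    have h1 := Finset.card_insert_le s₁ (insert y₁ C)
    have h2 := Finset.card_insert_le y₁ C
    simp only [U']
    omega
  refine (hT G' U' s₁ y₁ _ k hc hyp).mono le_rfl ?_
  rintro ℓ ⟨hℓ, hp⟩
  refine ⟨hℓ, ?_⟩
  obtain ⟨ℓ, rfl⟩ : ∃ m, ℓ = m + 2 := ⟨ℓ - 2, by omega⟩
  obtain ⟨_, w, hw, hp⟩ := hp
  obtain ⟨_, w', hw', hp⟩ := hp.symm
  obtain ⟨hwC, s, hs, hsw⟩ := (adjS w).1 hw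
  obtain ⟨hwC', t, ht, htw⟩ := (adjY w').1 hw'
  have hp' : PathIn G ℓ C w' w := by
    have hsub : (U'.erase s₁).erase y₁ ⊆ C := fun a ha => by
      simp only [Finset.mem_erase, hU'] at ha
      tauto
    exact (hp.mono hsub).mono_graph fun a ha b hb => (adjC a ha b hb).1
  have htC : t ∉ C := fun h => Finset.disjoint_left.1 hCY h ht
  have hsC' : s ∉ C := fun h => Finset.disjoint_left.1 hCS h hs
  have hst : s ≠ t := fun h => Finset.disjoint_left.1 hSY hs (h ▸ ht)
  exact ⟨s, hs, t, ht, (hp'.cons htw htC).symm.cons hsw (by simp [hst, hsC'])⟩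

end Contraction

section RootedPaths

variable {V : Type*} [DecidableEq V] {G : SimpleGraph V} {U : Finset V} {x y z : V} {k : ℕ}

/-- If `y` and `X` lie in a connected set `C` and `X` is attached to the rest of `C` only through
`q`, then `q` is linked to `y` outside `X`. -/
theorem ConnOn.exists_pathIn_sdiff {C X : Finset V} {q : V} (hC : ConnOn G C) (hX : X ⊆ C)
    (hq : q ∈ C) (hqX : q ∉ X) (hy : y ∈ C) (hyX : y ∉ X)
    (hN : ∀ u ∈ X, ∀ v ∈ C, G.Adj u v → v ∈ X ∨ v = q) : ∃ n, PathIn G n (C \ X) q y := by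
  obtain ⟨R, hR, hqR, hcl, hconn⟩ := exists_component G (W := C \ X) (x := q) (by simp [hq, hqX])
  by_cases hyR : y ∈ R
  · obtain ⟨n, hn⟩ := hconn.exists_pathIn hqR hyR
    exact ⟨n, hn.mono hR⟩
  · exfalso
    obtain ⟨u, hu, v, hv, hvX, huv⟩ := hC (R ∪ X)
      (Finset.union_subset (hR.trans Finset.sdiff_subset) hX) ⟨q, by simp [hqR]⟩
      ⟨y, hy, by simp [hyR, hyX]⟩
    simp only [Finset.mem_union, not_or] at hu hvX
    rcases hu with hu | hu
    · exact hvX.1 (hcl u hu v (by simp [hv, hvX.2]) huv)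
    · rcases hN u hu v hv huv with h | h
      · exact hvX.2 h
      · exact hvX.1 (h ▸ hqR)

theorem RootedConn.exists_pathIn (h : RootedConn G U x y) {u : V}
    (hu : u ∈ U) (hux : u ≠ x) : ∃ n, PathIn G n (U.erase x) u y := by
  obtain ⟨R, hR, huR, hcl, hconn⟩ :=
    exists_component G (W := U.erase x) (x := u) (by simp [hu, hux])
  by_cases hyR : y ∈ R
  · obtain ⟨n, hn⟩ := hconn.exists_pathIn huR hyR
    exact ⟨n, hn.mono hR⟩
  · exfalso
    obtain ⟨a, ha, v, hv, hvR, hvx, hav⟩ := h R (hR.trans (Finset.erase_subset _ _)) ⟨u, huR⟩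
      (fun hx => by simpa using hR hx) hyR x
    exact hvR (hcl a ha v (by simp [hv, hvx]) hav)

/-- From one of two vertices there is a path to `y` avoiding `x` and the other vertex. -/
theorem PathIn.exists_avoiding {n : ℕ} {W : Finset V} {u w : V} (h : PathIn G n W u y)
    (huw : u ≠ w) :
    (∃ m, PathIn G m (W.erase w) u y) ∨ ∃ m, PathIn G m (W.erase u) w y := by
  rcases h.symm.split w with h1 | h1 | ⟨m, h1⟩
  · exact Or.inl ⟨n, h1.symm⟩
  · exact absurd h1.symm huw
  · exact Or.inr ⟨m, h1.symm⟩

theorem PathIn.pos {n : ℕ} {W : Finset V} {u w : V} (h : PathIn G n W u w) (huw : u ≠ w) :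
    1 ≤ n := by
  rcases n with _ | n
  · exact absurd h.1 huw
  · omega

theorem RootedConn.exists_left_adj (h : RootedConn G U x y)
    (hin : ∃ v ∈ U, v ≠ x ∧ v ≠ y) : ∃ u ∈ U, u ≠ x ∧ u ≠ y ∧ G.Adj x u := by
  obtain ⟨v, hv, hvx, hvy⟩ := hin
  obtain ⟨u, hu, v, hv, hvX, hvy, huv⟩ := h ((U.erase x).erase y)
    ((Finset.erase_subset _ _).trans (Finset.erase_subset _ _)) ⟨v, by simp [hv, hvx, hvy]⟩
    (by simp) (by simp) y
  simp only [Finset.mem_erase] at hu hvX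
  have : v = x := by tauto
  exact ⟨u, hu.2.2, hu.2.1, hu.1, this ▸ huv.symm⟩

/-- The rooted path theorem for `k = 1`. -/
theorem RootedHyp.admPaths_one (h : RootedHyp G U x y z 1) : AdmPaths G U x y 1 := by
  obtain ⟨v, hv, hvx, hvy, -⟩ := h.exists_inner
  obtain ⟨u, hu, hux, huy, hxu⟩ := h.conn.exists_left_adj ⟨v, hv, hvx, hvy⟩
  obtain ⟨n, hn⟩ := h.conn.exists_pathIn hu hux
  have := hn.pos huy
  refine holdsOnAP_one (ℓ := n + 1) ⟨by omega, ?_⟩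
  exact hn.cons' hxu (by simp) h.left_mem (Finset.erase_subset _ _)

theorem AdmPaths.append {W₁ W₂ : Finset V} {q : V} {n : ℕ} (h : AdmPaths G W₁ x q k)
    (hp : PathIn G n W₂ q y) (hd : ∀ v ∈ W₁, v ∈ W₂ → v = q) (h₁ : W₁ ⊆ U) (h₂ : W₂ ⊆ U) :
    AdmPaths G U x y k := by
  obtain ⟨a, d, hd', h⟩ := h
  refine ⟨a + n, d, hd', fun i hi => ?_⟩
  obtain ⟨h3, h4⟩ := h i hi
  rw [add_right_comm]
  exact ⟨by omega, h4.append' hp hd h₁ h₂⟩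

/-- Recursion on a piece of `U` that is attached to the rest only through `x` and `q`. -/
theorem RootedHyp.of_piece (h : RootedHyp G U x y z k) (hT : RootedBelow V U.card)
    {X : Finset V} {q : V} (hX : X ⊆ U) (hxX : x ∉ X) (hyX : y ∉ X) (hqX : q ∉ X)
    (hN : ∀ u ∈ X, ∀ v ∈ U, G.Adj u v → v ∈ X ∨ v = x ∨ v = q) (hin : ∃ v ∈ X, v ≠ z)
    (hout : ∃ w ∈ U, w ∉ X ∧ w ≠ x ∧ w ≠ q) : AdmPaths G U x y k := by
  obtain ⟨v₀, hv₀, hv₀z⟩ := hin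
  obtain ⟨u, hu, v, hv, hvX, hvx, huv⟩ := h.conn X hX ⟨v₀, hv₀⟩ hxX hyX x
  have hvq : v = q := by
    rcases hN u hu v hv huv with h1 | h1 | h1
    · exact absurd h1 hvX
    · exact absurd h1 hvx
    · exact h1
  subst hvq
  have hsub : insert x (insert v X) ⊆ U := by
    intro a ha
    simp only [Finset.mem_insert] at ha
    rcases ha with rfl | rfl | ha
    exacts [h.left_mem, hv, hX ha]
  have hpaths : AdmPaths G (insert x (insert v X)) x v k := by
    refine hT G _ x v z k ?_ ⟨hvx.symm, by simp, by simp, ?_, ?_, h.pos, ?_, h.exc⟩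
    · refine Finset.card_lt_card ⟨hsub, fun hcon => ?_⟩
      obtain ⟨w, hw, hwX, hwx, hwq⟩ := hout
      have := hcon hw
      simp only [Finset.mem_insert] at this
      tauto
    · intro X' hX' hne hx' hq' q₀
      have hX'X : X' ⊆ X := fun a ha => by
        have := hX' ha
        simp only [Finset.mem_insert] at this
        rcases this with rfl | rfl | h
        exacts [absurd ha hx', absurd ha hq', h]
      obtain ⟨a, ha, b, hb, hbX, hbq, hab⟩ := h.conn X' (hX'X.trans hX) hne hx'
        (fun h => hyX (hX'X h)) q₀
      refine ⟨a, ha, b, ?_, hbX, hbq, hab⟩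
      have := hN a (hX'X ha) b hb hab
      simp only [Finset.mem_insert]
      tauto
    · exact ⟨v₀, by simp [hv₀], fun h => hxX (h ▸ hv₀), fun h => hqX (h ▸ hv₀), hv₀z⟩
    · intro h2 w hw hwx hwv hwz
      have hwX : w ∈ X := by
        simp only [Finset.mem_insert] at hw
        tauto
      refine (h.deg h2 w (hX hwX) hwx (fun h => hyX (h ▸ hwX)) hwz).trans ?_
      refine Finset.card_le_card fun a ha => ?_
      rw [mem_nbrs] at ha ⊢
      have := hN w hwX a ha.1 ha.2
      simp only [Finset.mem_insert]
      tauto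
  by_cases hvy : v = y
  · subst hvy
    exact hpaths.mono le_rfl fun ℓ hℓ => ⟨hℓ.1, hℓ.2.mono hsub⟩
  have hlink : ∃ n, PathIn G n ((U.erase x) \ X) v y := by
    obtain ⟨R, hR, hvR, hcl, hconn⟩ := exists_component G (W := (U.erase x) \ X) (x := v)
      (by simp [hv, hvx, hvX])
    by_cases hyR : y ∈ R
    · obtain ⟨n, hn⟩ := hconn.exists_pathIn hvR hyR
      exact ⟨n, hn.mono hR⟩
    · exfalso
      have hRU : R ⊆ U := fun a ha => by
        have := hR ha
        simp only [Finset.mem_sdiff, Finset.mem_erase] at this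
        exact this.1.2
      have hxR : x ∉ R := fun hx => by simpa using hR hx
      obtain ⟨a, ha, b, hb, hbR, hbx, hab⟩ := h.conn (R ∪ X) (Finset.union_subset hRU hX)
        ⟨v, by simp [hvR]⟩ (by simp [hxX, hxR]) (by simp [hyX, hyR]) x
      simp only [Finset.mem_union, not_or] at ha hbR
      rcases ha with ha | ha
      · exact hbR.1 (hcl a ha b (by simp [hb, hbx, hbR.2]) hab)
      · rcases hN a ha b hb hab with h1 | h1 | h1
        · exact hbR.2 h1
        · exact hbx h1
        · exact hbR.1 (h1 ▸ hvR)
  obtain ⟨n, hn⟩ := hlink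
  refine hpaths.append hn ?_ hsub (Finset.sdiff_subset.trans (Finset.erase_subset _ _))
  intro a ha ha'
  simp only [Finset.mem_insert, Finset.mem_sdiff, Finset.mem_erase] at ha ha'
  tauto

/-- One contraction step: either there are admissible paths from `S` to `q` through `X`, or a part
of `X` is attached to the rest only through `D` and one further vertex. -/
theorem exists_paths_or_separation {N p : ℕ} (hT : RootedBelow V N) {X S D : Finset V} {q : V}
    (hN : X.card + 2 < N) (hXS : Disjoint X S) (hqX : q ∉ X) (hqS : q ∉ S) (hS : S.Nonempty)
    (hin : ∃ v ∈ X, v ≠ z) (hk : 1 ≤ k) (hz : 3 ≤ k → z ∉ X)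
    (hcl : ∀ u ∈ X, ∀ v ∈ U, G.Adj u v → v ∈ X ∨ v ∈ S ∨ v ∈ D ∨ v = q)
    (hqU : q ∈ U)
    (hA : ∀ X' ⊆ X, X'.Nonempty → ∃ u ∈ X', ∃ v ∈ insert q X, v ∉ X' ∧ G.Adj u v)
    (hdeg : 2 ≤ k → ∀ w ∈ X, w ≠ z → k + 1 ≤ (nbrs G U w).card)
    (hp : 1 ≤ p)
    (hloss : ∀ w ∈ X, (nbrs G D w).card + (nbrs G S w).card + 1 ≤ p + min 1 (nbrs G S w).card) :
    HoldsOnAP (max 1 (k + 1 - p))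
      (fun ℓ => 2 ≤ ℓ ∧ ∃ s ∈ S, PathIn G ℓ (insert s (insert q X)) s q) ∨
    ∃ X' ⊆ X, X'.Nonempty ∧ ∃ q' ∈ insert q X, q' ∉ X' ∧
      ∀ u ∈ X', ∀ v ∈ U, G.Adj u v → v ∈ X' ∨ v ∈ D ∨ v = q' := by
  by_contra! hcon
  obtain ⟨hcon1, hcon2⟩ := hcon
  refine hcon1 ?_
  have := exists_paths_of_contraction (G := G) (k := max 1 (k + 1 - p)) hT (C := X) (S := S)
    (Y := {q}) (z := z) hXS (by simpa using hqX) (by simpa using hqS) hS (by simp) hN hin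
    (by omega) (fun h => hz (by omega)) ?_ ?_ ?_ ?_
  · exact this.mono le_rfl fun ℓ ⟨h1, s, hs, t, ht, hp⟩ => by
      rw [Finset.mem_singleton] at ht
      subst ht
      exact ⟨h1, s, hs, hp⟩
  · intro X' hX' hne
    obtain ⟨u, hu, v, hv, h1, h2⟩ := hA X' hX' hne
    refine ⟨u, hu, v, ?_, h1, h2⟩
    simp only [Finset.mem_insert, Finset.mem_union, Finset.mem_singleton] at hv ⊢
    tauto
  · intro X' hX' hne
    obtain ⟨u, hu, v, hv, huv, h1, h2, h3⟩ := hcon2 X' hX' hne q (by simp) (fun h => hqX (hX' h))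
    refine ⟨u, hu, v, ?_, h1, huv⟩
    have := hcl u (hX' hu) v hv huv
    simp only [Finset.mem_union]
    tauto
  · intro X' hX' hne q' hq'
    by_cases hqX' : q' ∈ X'
    · obtain ⟨u, hu, v, hv, h1, h2⟩ := hA X' hX' hne
      refine ⟨u, hu, v, ?_, h1, fun h => h1 (h ▸ hqX'), h2⟩
      simp only [Finset.mem_insert, Finset.mem_union, Finset.mem_singleton] at hv ⊢
      tauto
    · obtain ⟨u, hu, v, hv, huv, h1, h2, h3⟩ := hcon2 X' hX' hne q' (by simp [hq']) hqX'
      refine ⟨u, hu, v, ?_, h1, h3, huv⟩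
      have := hcl u (hX' hu) v hv huv
      simp only [Finset.mem_union, Finset.mem_singleton]
      tauto
  · intro h2 w hw hwz
    have h1 := hdeg (by omega) w hw hwz
    have h3 : nbrs G U w ⊆ (nbrs G X w ∪ nbrs G S w) ∪ (nbrs G D w ∪ nbrs G {q} w) := by
      intro a ha
      rw [mem_nbrs] at ha
      have := hcl w hw a ha.1 ha.2
      simp only [Finset.mem_union, mem_nbrs, Finset.mem_singleton]
      tauto
    have h4 := Finset.card_le_card h3
    have h5 := Finset.card_union_le (nbrs G X w ∪ nbrs G S w) (nbrs G D w ∪ nbrs G {q} w)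
    have h6 := Finset.card_union_le (nbrs G X w) (nbrs G S w)
    have h7 := Finset.card_union_le (nbrs G D w) (nbrs G {q} w)
    have h8 := hloss w hw
    have h9 : (nbrs G {q} w).card ≤ 1 := by
      have := Finset.card_le_card (nbrs_subset (G := G) (U := {q}) (v := w))
      simpa using this
    omega

/-- Prepending paths in `H` and appending a link to the paths of a contraction step. -/
theorem admPaths_of_paths {k' p c d n : ℕ} {X S H L : Finset V} {q : V}
    (h : HoldsOnAP k' (fun ℓ => 2 ≤ ℓ ∧ ∃ s ∈ S, PathIn G ℓ (insert s (insert q X)) s q))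
    (hk' : 1 ≤ k') (hp : 1 ≤ p) (hd : d = 1 ∨ d = 2) (hk : k ≤ k' + p - 1)
    (hH : ∀ s ∈ S, ∀ j < p, PathIn G (c + j * d) H x s) (hL : PathIn G n L q y)
    (hHX : Disjoint H X) (hqH : q ∉ H) (hLX : Disjoint L X) (hLH : Disjoint L H)
    (hHU : H ⊆ U) (hXU : X ⊆ U) (hLU : L ⊆ U) : AdmPaths G U x y k := by
  refine HoldsOnAP.sum h hk' hp hd (c := c + n) ?_ hk
  rintro ℓ ⟨hℓ, s, hs, hp⟩ j hj
  refine ⟨by omega, ?_⟩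
  have hsH := (hH s hs j hj).right_mem
  have hqL := hL.left_mem
  rw [Finset.disjoint_left] at hHX hLX hLH
  have h1 := (hH s hs j hj).append hp (fun a ha ha' => by
    simp only [Finset.mem_insert] at ha'
    rcases ha' with rfl | rfl | ha'
    · rfl
    · exact absurd ha hqH
    · exact absurd ha' (hHX ha))
  have h2 := h1.append' (W := U) hL (fun a ha ha' => by
    simp only [Finset.mem_insert, Finset.mem_union] at ha
    rcases ha with ha | rfl | rfl | ha
    · exact absurd ha (hLH ha')
    · exact absurd hsH (hLH ha')
    · rfl
    · exact absurd ha (hLX ha')) (by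
      intro a ha
      simp only [Finset.mem_insert, Finset.mem_union] at ha
      rcases ha with ha | rfl | rfl | ha
      exacts [hHU ha, hHU hsH, hLU hqL, hXU ha]) hLU
  rwa [show ℓ + (c + n) + j * d = c + j * d + ℓ + n by ring]

end RootedPaths

section TwoPaths

variable {V : Type*} [DecidableEq V] {G : SimpleGraph V} {U : Finset V} {x y z : V} {k : ℕ}

theorem RootedHyp.symm (h : RootedHyp G U x y z k) (hk : k ≤ 2) : RootedHyp G U y x z k := by
  refine ⟨h.ne.symm, h.right_mem, h.left_mem, h.conn.symm, ?_, h.pos, ?_, fun h => by omega⟩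
  · obtain ⟨v, hv, h1, h2, h3⟩ := h.exists_inner
    exact ⟨v, hv, h2, h1, h3⟩
  · intro h2 v hv h3 h4 h5
    exact h.deg h2 v hv h4 h3 h5

/-- A contraction step towards the root `y` inside a connected set `C`. -/
theorem RootedHyp.step {p c d : ℕ} (h : RootedHyp G U x y z k) (hT : RootedBelow V U.card)
    {C H S D : Finset V} (hCU : C ⊆ U) (hC : ConnOn G C) (hyC : y ∈ C) (hHU : H ⊆ U)
    (hHC : Disjoint H C) (hxH : x ∈ H) (hSH : S ⊆ H) (hS : S.Nonempty) (hxS : x ∉ S)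
    (hcl : ∀ u ∈ C, ∀ v ∈ U, G.Adj u v → v ∈ C ∨ v ∈ S ∨ v ∈ D)
    (hin : ∃ v ∈ C, v ≠ y ∧ v ≠ z) (hp : 1 ≤ p) (hd : d = 1 ∨ d = 2)
    (hloss : ∀ w ∈ C, w ≠ y →
      (nbrs G D w).card + (nbrs G S w).card + 1 ≤ p + min 1 (nbrs G S w).card)
    (hH : ∀ s ∈ S, ∀ j < p, PathIn G (c + j * d) H x s) :
    AdmPaths G U x y k ∨ ∃ X ⊆ C, X.Nonempty ∧ y ∉ X ∧ ∃ q ∈ C, q ∉ X ∧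
      ∀ u ∈ X, ∀ v ∈ U, G.Adj u v → v ∈ X ∨ v ∈ D ∨ v = q := by
  have hHC' := Finset.disjoint_left.1 hHC
  have hxC : x ∉ C := hHC' hxH
  have hins : insert y (C.erase y) = C := Finset.insert_erase hyC
  have hXU : C.erase y ⊆ U := (Finset.erase_subset _ _).trans hCU
  have hcard : (C.erase y).card + 2 < U.card := by
    obtain ⟨s, hs⟩ := hS
    have h1 : ({x, s} : Finset V).card = 2 := Finset.card_pair fun h => hxS (h ▸ hs)
    have h2 : ({x, s} : Finset V) ⊆ H := by
      intro a ha
      simp only [Finset.mem_insert, Finset.mem_singleton] at ha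
      rcases ha with rfl | rfl
      exacts [hxH, hSH hs]
    have h3 := Finset.card_le_card h2
    have h4 := Finset.card_le_card (Finset.union_subset hHU hCU)
    rw [Finset.card_union_of_disjoint hHC] at h4
    have h5 := Finset.card_erase_add_one hyC
    omega
  have hXS : Disjoint (C.erase y) S :=
    (hHC.mono_left hSH).symm.mono_left (Finset.erase_subset _ _)
  have hin' : ∃ v ∈ C.erase y, v ≠ z := by
    obtain ⟨v, hv, hvy, hvz⟩ := hin
    exact ⟨v, by simp [hv, hvy], hvz⟩
  have hz : 3 ≤ k → z ∉ C.erase y := by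
    intro h3
    rw [h.exc h3]
    simp [hxC]
  have hcl' : ∀ u ∈ C.erase y, ∀ v ∈ U, G.Adj u v → v ∈ C.erase y ∨ v ∈ S ∨ v ∈ D ∨ v = y := by
    intro u hu v hv huv
    have := hcl u (Finset.mem_of_mem_erase hu) v hv huv
    simp only [Finset.mem_erase]
    tauto
  have hA : ∀ X ⊆ C.erase y, X.Nonempty →
      ∃ u ∈ X, ∃ v ∈ insert y (C.erase y), v ∉ X ∧ G.Adj u v := by
    intro X hX hne
    rw [hins]
    exact hC X (hX.trans (Finset.erase_subset _ _)) hne ⟨y, hyC, fun h => by simpa using hX h⟩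
  have hdeg : 2 ≤ k → ∀ w ∈ C.erase y, w ≠ z → k + 1 ≤ (nbrs G U w).card := by
    intro h2 w hw hwz
    simp only [Finset.mem_erase] at hw
    exact h.deg h2 w (hCU hw.2) (fun h => hxC (h ▸ hw.2)) hw.1 hwz
  rcases exists_paths_or_separation hT hcard hXS (by simp) (fun h => hHC' (hSH h) hyC) hS hin'
    h.pos hz hcl' h.right_mem hA hdeg hp (fun w hw => by
      simp only [Finset.mem_erase] at hw
      exact hloss w hw.2 hw.1) with h1 | ⟨X, hX, hne, q, hq, hqX, hN⟩
  · left
    exact admPaths_of_paths h1 (by omega) hp hd (by omega) hH (L := {y}) (n := 0)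
      (pathIn_zero (by simp)) (hHC.mono_right (Finset.erase_subset _ _)) (fun h => hHC' h hyC)
      (by simp) (by simpa using fun h => hHC' h hyC) hHU hXU (by simpa using h.right_mem)
  · rw [hins] at hq
    exact Or.inr ⟨X, hX.trans (Finset.erase_subset _ _), hne, fun h => by simpa using hX h, q, hq,
      hqX, hN⟩

theorem RootedHyp.two_of_triangle (h : RootedHyp G U x y z 2) {u w : V} (hu : u ∈ U) (hw : w ∈ U)
    (huy : u ≠ y) (hwy : w ≠ y) (hxu : G.Adj x u) (hxw : G.Adj x w) (huw : G.Adj u w) :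
    AdmPaths G U x y 2 := by
  have key : ∀ u w : V, u ∈ U → w ∈ U → u ≠ y → G.Adj x u → G.Adj x w → G.Adj u w →
      (∃ m, PathIn G m ((U.erase x).erase w) u y) → AdmPaths G U x y 2 := by
    intro u w hu hw huy hxu hxw huw ⟨m, hm⟩
    have := hm.pos huy
    refine holdsOnAP_two (ℓ := m + 1) (d := 1) (Or.inl rfl) ⟨by omega, ?_⟩ ⟨by omega, ?_⟩
    · exact hm.cons' hxu (by simp) h.left_mem (by grind)
    · refine (hm.cons' (W₂ := U.erase x) huw.symm (by simp) ?_ (by grind)).cons' hxw (by simp)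
        h.left_mem (by grind)
      simp [hw, hxw.ne']
  obtain ⟨n, hn⟩ := h.conn.exists_pathIn hu hxu.ne'
  rcases hn.exists_avoiding huw.ne with h1 | h1
  · exact key u w hu hw huy hxu hxw huw h1
  · exact key w u hw hu hwy hxw hxu huw.symm h1

theorem RootedHyp.two_of_square (h : RootedHyp G U x y z 2) (hT : RootedBelow V U.card)
    {u v w : V} (hu : u ∈ U) (hv : v ∈ U) (hw : w ∈ U)
    (huy : u ≠ y) (hwy : w ≠ y) (hvy : v ≠ y) (hvx : v ≠ x) (huw : u ≠ w)
    (hxu : G.Adj x u) (huv : G.Adj u v) (hvw : G.Adj v w) (hxw : G.Adj x w) :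
    AdmPaths G U x y 2 := by
  have key : ∀ u w : V, u ∈ U → w ∈ U → u ≠ y → u ≠ w → G.Adj x u → G.Adj x w → G.Adj u v →
      G.Adj v w → (∃ m, PathIn G m (((U.erase x).erase v).erase w) u y) → AdmPaths G U x y 2 := by
    intro u w hu hw huy hne hxu hxw huv hvw ⟨m, hm⟩
    have := hm.pos huy
    refine holdsOnAP_two (ℓ := m + 1) (d := 2) (Or.inr rfl) ⟨by omega, ?_⟩ ⟨by omega, ?_⟩
    · exact hm.cons' hxu (by simp) h.left_mem (by grind)
    · have h1 := hm.cons' (W₂ := (U.erase x).erase w) huv.symm (by simp) (by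
        simp [hv, hvx, hvw.ne]) (by grind)
      have h2 := h1.cons' (W₂ := U.erase x) hvw.symm (by simp) (by simp [hw, hxw.ne']) (by grind)
      exact h2.cons' hxw (by simp) h.left_mem (by grind)
  have key2 : ∀ u w : V, u ∈ U → w ∈ U → u ≠ y → w ≠ y → u ≠ w → G.Adj x u → G.Adj x w →
      G.Adj u v → G.Adj v w → u ≠ z → AdmPaths G U x y 2 := by
    intro u w hu hw huy hwy hne hxu hxw huv hvw huz
    obtain ⟨R, hR, huR, hcl, hconn⟩ := exists_component G (W := (U.erase x).erase v) (x := u)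
      (by simp [hu, hxu.ne', huv.ne])
    by_cases hyR : y ∈ R
    · obtain ⟨n, hn⟩ := hconn.exists_pathIn huR hyR
      rcases (hn.mono hR).exists_avoiding hne with h1 | h1
      · exact key u w hu hw huy hne hxu hxw huv hvw h1
      · exact key w u hw hu hwy hne.symm hxw hxu hvw.symm huv.symm h1
    · refine h.of_piece hT (X := R) (q := v) ?_ (fun hx => ?_) hyR (fun hx => ?_) ?_ ⟨u, huR, huz⟩
        ⟨y, h.right_mem, hyR, h.ne.symm, hvy.symm⟩
      · exact hR.trans ((Finset.erase_subset _ _).trans (Finset.erase_subset _ _))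
      · simpa using hR hx
      · simpa using hR hx
      · intro a ha b hb hab
        by_contra! hcon
        exact hcon.1 (hcl a ha b (by simp [hb, hcon.2]) hab)
  by_cases huz : u = z
  · exact key2 w u hw hu hwy huy huw.symm hxw hxu hvw.symm huv.symm
      (fun h => huw (huz.trans h.symm))
  · exact key2 u w hu hw huy hwy huw hxu hxw huv hvw huz

end TwoPaths

section TwoPathsExistence

variable {V : Type*} [DecidableEq V] {G : SimpleGraph V} {U : Finset V} {x y z : V} {k : ℕ}

theorem RootedHyp.two_of_exists_adj (h : RootedHyp G U x y z 2) (hT : RootedBelow V U.card)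
    (hna : ¬ G.Adj x y)
    (hsq : ∀ w ∈ U, w ≠ x → w ≠ y → (nbrs G (nbrs G U x) w).card ≤ 1)
    (hy : ∃ v ∈ U, G.Adj y v ∧ ¬ G.Adj x v) : AdmPaths G U x y 2 := by
  obtain ⟨v, hv, hyv, hxv⟩ := hy
  have hvx : v ≠ x := fun h => hna (h ▸ hyv.symm)
  set S := nbrs G U x with hS
  have hmS : ∀ a, a ∈ S ↔ a ∈ U ∧ G.Adj x a := fun a => mem_nbrs
  have hxS : x ∉ S := by simp [hmS]
  have hW : ∀ a, a ∈ U \ insert x S ↔ a ∈ U ∧ a ≠ x ∧ ¬ G.Adj x a := by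
    intro a
    simp only [Finset.mem_sdiff, Finset.mem_insert, hmS]
    tauto
  obtain ⟨C, hCW, hyC, hcl, hconn⟩ := exists_component G (W := U \ insert x S) (x := y)
    ((hW y).2 ⟨h.right_mem, h.ne.symm, hna⟩)
  have hCU : C ⊆ U := hCW.trans Finset.sdiff_subset
  have hvC : v ∈ C := hcl y hyC v ((hW v).2 ⟨hv, hvx, hxv⟩) hyv
  have hclU : ∀ u ∈ C, ∀ v ∈ U, G.Adj u v → v ∈ C ∨ v ∈ S := by
    intro a ha b hb hab
    by_contra! hcon
    have hax := (hW a).1 (hCW ha)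
    refine hcon.1 (hcl a ha b ((hW b).2 ⟨hb, ?_, ?_⟩) hab)
    · rintro rfl
      exact hax.2.2 hab.symm
    · intro hxb
      exact hcon.2 ((hmS b).2 ⟨hb, hxb⟩)
  have hin : ∃ u ∈ U, u ≠ x ∧ u ≠ y := by
    obtain ⟨u, hu, h1, h2, _⟩ := h.exists_inner
    exact ⟨u, hu, h1, h2⟩
  obtain ⟨s, hs, -, -, hxs⟩ := h.conn.exists_left_adj hin
  by_cases hnorm : ∃ v ∈ C, v ≠ y ∧ v ≠ z
  · rcases h.step hT (C := C) (H := insert x S) (S := S) (D := ∅) (p := 1) (c := 1) (d := 1) hCU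
      hconn hyC (Finset.insert_subset h.left_mem nbrs_subset)
      (Finset.disjoint_left.2 fun a ha ha' => (Finset.mem_sdiff.1 (hCW ha')).2 ha) (by simp)
      (Finset.subset_insert _ _) ⟨s, (hmS s).2 ⟨hs, hxs⟩⟩ hxS
      (fun a ha b hb hab => by have := hclU a ha b hb hab; tauto) hnorm le_rfl (Or.inl rfl)
      (fun w hw hwy => by
        have h1 := hsq w (hCU hw) (fun h => by simpa [h] using hCW hw) hwy
        have h2 : nbrs G ∅ w = ∅ := Finset.subset_empty.1 nbrs_subset
        rw [h2]
        simp only [Finset.card_empty]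
        omega) (fun s hs j hj => by
        obtain rfl : j = 0 := by omega
        exact pathIn_one (by simp) (by simp [hs]) ((hmS s).1 hs).2)
    with h1 | ⟨X, hX, hne, hyX, q, hq, hqX, hN⟩
    · exact h1
    · exfalso
      obtain ⟨u, hu, v, hv, hvX, hvq, huv⟩ := h.conn X (hX.trans hCU) hne
        (fun hx => ((hW x).1 (hCW (hX hx))).2.1 rfl) hyX q
      have := hN u hu v hv huv
      simp [hvX, hvq] at this
  · push Not at hnorm
    have hvz : v = z := hnorm v hvC hyv.ne'
    subst hvz
    obtain ⟨u, hu, a, ha, hav, hay, hva⟩ := h.conn {v} (by simpa using hv) (by simp)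
      (by simpa using hvx.symm) (by simpa using hyv.ne) y
    simp only [Finset.mem_singleton] at hu hav
    subst hu
    have haS : a ∈ S := by
      rcases hclU u hvC a ha hva with h1 | h1
      · exact absurd (hnorm a h1 hay) hav
      · exact h1
    have hxa := ((hmS a).1 haS).2
    by_cases hyS : ∃ b ∈ S, G.Adj y b
    · obtain ⟨b, hb, hyb⟩ := hyS
      obtain ⟨hbU, hxb⟩ := (hmS b).1 hb
      have hne := h.ne
      refine holdsOnAP_two (ℓ := 2) (d := 1) (Or.inl rfl) ⟨le_rfl, ?_⟩ ⟨by omega, ?_⟩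
      · refine (pathIn_one (W := {b, y}) (by simp) (by simp) hyb.symm).cons' hxb ?_ h.left_mem ?_
        · simp [hxb.ne, h.ne]
        · intro c hc
          simp only [Finset.mem_insert, Finset.mem_singleton] at hc
          rcases hc with rfl | rfl
          exacts [hbU, h.right_mem]
      · have h1 : PathIn G 2 {a, u, y} a y :=
          (pathIn_one (W := {u, y}) (by simp) (by simp) hyv.symm).cons' hva.symm
            (by simp [hay, hav]) (by simp) (by simp)
        refine h1.cons' hxa ?_ h.left_mem ?_
        · simp [hxa.ne, hvx.symm, h.ne]
        · intro c hc
          simp only [Finset.mem_insert, Finset.mem_singleton] at hc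
          rcases hc with rfl | rfl | rfl
          exacts [ha, hv, h.right_mem]
    · push Not at hyS
      have hyu : ∀ b ∈ U, G.Adj y b → b = u := by
        intro b hb hyb
        rcases hclU y hyC b hb hyb with h1 | h1
        · exact hnorm b h1 hyb.ne'
        · exact absurd hyb (hyS b h1)
      have hrec : AdmPaths G (U.erase y) x u 2 := by
        refine hT G _ x u u 2 (Finset.card_erase_lt_of_mem h.right_mem) ⟨hvx.symm, ?_, ?_, ?_, ?_,
          by omega, ?_, by omega⟩
        · simp [h.ne, h.left_mem]
        · simp [hv, hyv.ne']
        · intro X hX hne hxX huX q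
          obtain ⟨b, hb, c, hc, hcX, hcq, hbc⟩ := h.conn X (hX.trans (Finset.erase_subset _ _)) hne
            hxX (fun h => by simpa using hX h) q
          refine ⟨b, hb, c, ?_, hcX, hcq, hbc⟩
          refine Finset.mem_erase.2 ⟨?_, hc⟩
          rintro rfl
          exact huX (hyu b (Finset.mem_of_mem_erase (hX hb)) hbc.symm ▸ hb)
        · obtain ⟨b, hb, h1, h2, h3⟩ := h.exists_inner
          exact ⟨b, by simp [hb, h2], h1, h3, h3⟩
        · intro _ w hw hwx hwu _
          simp only [Finset.mem_erase] at hw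
          refine (h.deg le_rfl w hw.2 hwx hw.1 hwu).trans (Finset.card_le_card ?_)
          intro b hb
          rw [mem_nbrs] at hb ⊢
          refine ⟨Finset.mem_erase.2 ⟨?_, hb.1⟩, hb.2⟩
          rintro rfl
          exact hwu (hyu w hw.2 hb.2.symm)
      refine hrec.append (W₂ := {u, y}) (n := 1) (pathIn_one (by simp) (by simp) hyv.symm) ?_
        (Finset.erase_subset _ _) ?_
      · intro b hb hb'
        simp only [Finset.mem_insert, Finset.mem_singleton, Finset.mem_erase] at hb hb'
        tauto
      · intro c hc
        simp only [Finset.mem_insert, Finset.mem_singleton] at hc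
        rcases hc with rfl | rfl
        exacts [hv, h.right_mem]

/-- The rooted path theorem for `k = 2`, by induction. -/
theorem RootedHyp.admPaths_two (h : RootedHyp G U x y z 2) (hT : RootedBelow V U.card)
    (hna : ¬ G.Adj x y) : AdmPaths G U x y 2 := by
  by_cases htx : ∃ u ∈ U, ∃ w ∈ U, G.Adj x u ∧ G.Adj x w ∧ G.Adj u w
  · obtain ⟨u, hu, w, hw, hxu, hxw, huw⟩ := htx
    exact h.two_of_triangle hu hw (fun h => hna (h ▸ hxu)) (fun h => hna (h ▸ hxw)) hxu hxw huw
  have sq : ∀ {x y : V}, RootedHyp G U x y z 2 → ¬ G.Adj x y →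
      AdmPaths G U x y 2 ∨ ∀ w ∈ U, w ≠ x → w ≠ y → (nbrs G (nbrs G U x) w).card ≤ 1 := by
    intro x y h hna
    by_contra! hcon
    obtain ⟨h1, w, hw, hwx, hwy, hcard⟩ := hcon
    obtain ⟨a, ha, b, hb, hab⟩ := Finset.one_lt_card.1 hcard
    simp only [mem_nbrs] at ha hb
    exact h1 (h.two_of_square hT ha.1.1 hw hb.1.1 (fun h => hna (h ▸ ha.1.2))
      (fun h => hna (h ▸ hb.1.2)) hwy hwx hab ha.1.2 ha.2.symm hb.2 hb.1.2)
  have hna' : ¬ G.Adj y x := fun h => hna h.symm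
  rcases sq h hna with h1 | hsx
  · exact h1
  rcases sq (h.symm le_rfl) hna' with h1 | hsy
  · exact h1.symm
  by_cases hy : ∃ v ∈ U, G.Adj y v ∧ ¬ G.Adj x v
  · exact h.two_of_exists_adj hT hna hsx hy
  by_cases hx : ∃ v ∈ U, G.Adj x v ∧ ¬ G.Adj y v
  · exact ((h.symm le_rfl).two_of_exists_adj hT hna' hsy hx).symm
  push Not at hy hx htx
  set S := nbrs G U x with hS
  have hmS : ∀ a, a ∈ S ↔ a ∈ U ∧ G.Adj x a := fun a => mem_nbrs
  have hxS : x ∉ S := by simp [hmS]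
  have hyS : y ∉ S := by simp [hmS, hna]
  let F := (U \ S).filter fun a => a ≠ x ∧ a ≠ y
  have hF : ∀ a, a ∈ F ↔ a ∈ U ∧ a ∉ S ∧ a ≠ x ∧ a ≠ y := by
    intro a
    simp only [F, Finset.mem_filter, Finset.mem_sdiff]
    tauto
  have hFne : ∃ f, f ∈ F := by
    obtain ⟨v, hv, hvx, hvy, hvz⟩ := h.exists_inner
    by_cases hvS : v ∈ S
    · have h1 := h.deg le_rfl v hv hvx hvy hvz
      by_contra! hcon
      have : nbrs G U v ⊆ {x, y} := by
        intro a ha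
        rw [mem_nbrs] at ha
        have h2 := hcon a
        rw [hF] at h2
        have h3 : a ∉ S := fun h => htx v hv a ha.1 ((hmS v).1 hvS).2 ((hmS a).1 h).2 ha.2
        simp only [Finset.mem_insert, Finset.mem_singleton]
        tauto
      have h2 := Finset.card_le_card this
      have h3 := Finset.card_le_two (a := x) (b := y)
      omega
    · exact ⟨v, (hF v).2 ⟨hv, hvS, hvx, hvy⟩⟩
  obtain ⟨f, hf⟩ := hFne
  obtain ⟨C, hCF, hfC, hcl, hconn⟩ := exists_component G hf
  have hCU : C ⊆ U := fun a ha => ((hF a).1 (hCF ha)).1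
  have hxC : x ∉ C := fun hx => ((hF x).1 (hCF hx)).2.2.1 rfl
  have hyC : y ∉ C := fun hx => ((hF y).1 (hCF hx)).2.2.2 rfl
  have hSC : ∀ a ∈ C, a ∉ S := fun a ha => ((hF a).1 (hCF ha)).2.1
  have hclU : ∀ u ∈ C, ∀ v ∈ U, G.Adj u v → v ∈ C ∨ v ∈ S := by
    intro a ha b hb hab
    have haF := (hF a).1 (hCF ha)
    by_contra! hcon
    refine hcon.1 (hcl a ha b ((hF b).2 ⟨hb, hcon.2, ?_, ?_⟩) hab)
    · rintro rfl
      exact haF.2.1 ((hmS a).2 ⟨haF.1, hab.symm⟩)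
    · rintro rfl
      exact haF.2.1 ((hmS a).2 ⟨haF.1, hy a haF.1 hab.symm⟩)
  have hsmall : ∀ w ∈ C, (nbrs G S w).card ≤ 1 := fun w hw => by
    have := (hF w).1 (hCF hw)
    exact hsx w this.1 this.2.2.1 this.2.2.2
  have hnorm : ∃ v ∈ C, v ≠ z := by
    by_contra! hcon
    have hfz := hcon f hfC
    obtain ⟨a, ha, b, hb, hba, -, hab⟩ := h.conn C hCU ⟨f, hfC⟩ hxC hyC x
    obtain ⟨a', ha', c, hc, hca, hcb, hac⟩ := h.conn C hCU ⟨f, hfC⟩ hxC hyC b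
    obtain rfl : f = a := hfz.trans (hcon a ha).symm
    obtain rfl : f = a' := hfz.trans (hcon a' ha').symm
    have hbS := (hclU f ha b hb hab).resolve_left hba
    have hcS := (hclU f ha c hc hac).resolve_left hca
    have h3 : ({b, c} : Finset V) ⊆ nbrs G S f := by
      intro t ht
      simp only [Finset.mem_insert, Finset.mem_singleton] at ht
      rcases ht with rfl | rfl
      exacts [mem_nbrs.2 ⟨hbS, hab⟩, mem_nbrs.2 ⟨hcS, hac⟩]
    have h4 := Finset.card_le_card h3
    rw [Finset.card_pair hcb.symm] at h4
    have := hsmall f ha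
    omega
  obtain ⟨a₀, ha₀, q, hqU, hqC, -, haq⟩ := h.conn C hCU ⟨f, hfC⟩ hxC hyC x
  have hqS := (hclU a₀ ha₀ q hqU haq).resolve_left hqC
  obtain ⟨a₁, ha₁, s, hsU, hsC, hsq, has⟩ := h.conn C hCU ⟨f, hfC⟩ hxC hyC q
  have hsS := (hclU a₁ ha₁ s hsU has).resolve_left hsC
  have hyS' : ∀ a ∈ S, G.Adj y a := fun a ha => hx a ((hmS a).1 ha).1 ((hmS a).1 ha).2
  have hcard : C.card + 2 < U.card := by
    have h1 : insert x (insert y (insert q C)) ⊆ U := by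
      intro t ht
      simp only [Finset.mem_insert] at ht
      rcases ht with rfl | rfl | rfl | ht
      exacts [h.left_mem, h.right_mem, hqU, hCU ht]
    have h2 := Finset.card_le_card h1
    rw [Finset.card_insert_of_notMem, Finset.card_insert_of_notMem,
      Finset.card_insert_of_notMem hqC] at h2
    · omega
    · simp only [Finset.mem_insert, not_or]
      exact ⟨fun h => hyS (h ▸ hqS), hyC⟩
    · simp only [Finset.mem_insert, not_or]
      exact ⟨h.ne, fun h => hxS (h ▸ hqS), hxC⟩
  rcases exists_paths_or_separation (U := U) (z := z) (k := 2) (p := 1) hT (X := C)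
    (S := S.erase q) (D := ∅) (q := q) hcard
    (Finset.disjoint_left.2 fun a ha ha' => hSC a ha (Finset.mem_of_mem_erase ha')) hqC (by simp)
    ⟨s, by simp [hsS, hsq]⟩ hnorm (by omega) (by omega) (fun u hu v hv huv => by
      have := hclU u hu v hv huv
      simp only [Finset.mem_erase]
      tauto) hqU (fun X hX hne => by
        by_cases hXC : X = C
        · subst hXC
          exact ⟨a₀, ha₀, q, by simp, hqC, haq⟩
        · obtain ⟨t, ht, htX⟩ := Finset.exists_of_ssubset (hX.ssubset_of_ne hXC)
          obtain ⟨u, hu, v, hv, h1, h2⟩ := hconn X hX hne ⟨t, ht, htX⟩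
          exact ⟨u, hu, v, by simp [hv], h1, h2⟩) (fun _ w hw hwz => h.deg le_rfl w (hCU hw)
      (fun h => hxC (h ▸ hw)) (fun h => hyC (h ▸ hw)) hwz) le_rfl (fun w hw => by
        have h1 := hsmall w hw
        have h2 := card_nbrs_mono (G := G) (v := w) (Finset.erase_subset q S)
        have h3 : nbrs G ∅ w = ∅ := Finset.subset_empty.1 nbrs_subset
        rw [h3]
        simp only [Finset.card_empty]
        omega) with h1 | ⟨X, hX, hne, q', hq', hq'X, hN⟩
  · refine admPaths_of_paths (p := 1) (c := 1) (d := 1) (H := insert x (S.erase q)) (L := {q, y})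
      (n := 1) h1 (by omega) le_rfl (Or.inl rfl) (by omega) (fun s hs j hj => ?_)
      (pathIn_one (by simp) (by simp) (hyS' q hqS).symm) ?_ ?_ ?_ ?_ ?_ hCU ?_
    · obtain rfl : j = 0 := by omega
      exact pathIn_one (by simp) (by simp [hs]) ((hmS s).1 (Finset.mem_of_mem_erase hs)).2
    · rw [Finset.disjoint_left]
      intro a ha haC
      simp only [Finset.mem_insert, Finset.mem_erase] at ha
      rcases ha with rfl | ha
      exacts [hxC haC, hSC a haC ha.2]
    · simp only [Finset.mem_insert, Finset.mem_erase]
      rintro (rfl | h1)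
      exacts [hxS hqS, h1.1 rfl]
    · rw [Finset.disjoint_left]
      intro a ha haC
      simp only [Finset.mem_insert, Finset.mem_singleton] at ha
      rcases ha with rfl | rfl
      exacts [hqC haC, hyC haC]
    · rw [Finset.disjoint_left]
      intro a ha haH
      simp only [Finset.mem_insert, Finset.mem_singleton, Finset.mem_erase] at ha haH
      rcases ha with rfl | rfl
      · rcases haH with rfl | haH
        exacts [hxS hqS, haH.1 rfl]
      · rcases haH with haH | haH
        exacts [h.ne haH.symm, hyS haH.2]
    · exact Finset.insert_subset h.left_mem ((Finset.erase_subset _ _).trans nbrs_subset)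
    · intro t ht
      simp only [Finset.mem_insert, Finset.mem_singleton] at ht
      rcases ht with rfl | rfl
      exacts [hqU, h.right_mem]
  · exfalso
    obtain ⟨u, hu, v, hv, hvX, hvq, huv⟩ := h.conn X (hX.trans hCU) hne
      (fun hx => hxC (hX hx)) (fun hx => hyC (hX hx)) q'
    have := hN u hu v hv huv
    simp [hvX, hvq] at this

end TwoPathsExistence

section RootedCuts

variable {V : Type*} [DecidableEq V] {G : SimpleGraph V} {U : Finset V} {x y z a : V} {k : ℕ}

theorem RootedHyp.swap (h : RootedHyp G U x y x k) : RootedHyp G U y x y k := by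
  refine ⟨h.ne.symm, h.right_mem, h.left_mem, h.conn.symm, ?_, h.pos, ?_, fun _ => rfl⟩
  · obtain ⟨v, hv, h1, h2, h3⟩ := h.exists_inner
    exact ⟨v, hv, h2, h1, h2⟩
  · intro h2 v hv h3 h4 _
    exact h.deg h2 v hv h4 h3 h4

/-- `of_piece` without assumptions on the cut vertex. -/
theorem RootedHyp.of_piece' (h : RootedHyp G U x y x k) (hT : RootedBelow V U.card)
    {X : Finset V} {q : V} (hX : X ⊆ U) (hne : X.Nonempty) (hxX : x ∉ X) (hyX : y ∉ X)
    (hN : ∀ u ∈ X, ∀ v ∈ U, G.Adj u v → v ∈ X ∨ v = x ∨ v = q)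
    (hout : ∃ w ∈ U, w ∉ X ∧ w ≠ x ∧ w ≠ q) : AdmPaths G U x y k := by
  obtain ⟨v, hv⟩ := hne
  have hin : ∃ v ∈ X, v ≠ x := ⟨v, hv, fun h => hxX (h ▸ hv)⟩
  by_cases hqX : q ∈ X
  · refine h.of_piece hT (q := x) hX hxX hyX hxX (fun u hu v hv huv => ?_) hin
      ⟨y, h.right_mem, hyX, h.ne.symm, h.ne.symm⟩
    rcases hN u hu v hv huv with h1 | h1 | h1
    exacts [Or.inl h1, Or.inr (Or.inl h1), Or.inl (h1 ▸ hqX)]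
  · exact h.of_piece hT hX hxX hyX hqX hN hin hout

/-- The roots have at least two neighbours, or we can recurse. -/
theorem RootedHyp.of_unique_nbr (h : RootedHyp G U x y x k) (hT : RootedBelow V U.card) {q : V}
    (hq : ∀ b ∈ U, G.Adj y b → b = q) (hin : ∃ v ∈ U, v ≠ x ∧ v ≠ y ∧ v ≠ q)
    (hqy : q ≠ y) : AdmPaths G U x y k := by
  obtain ⟨v, hv, hvx, hvy, hvq⟩ := hin
  refine h.of_piece' hT (X := ((U.erase x).erase y).erase q) (q := q) (by grind)
    ⟨v, by grind⟩ (by simp) (by simp) (fun u hu w hw huw => ?_)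
    ⟨y, h.right_mem, by simp, h.ne.symm, hqy.symm⟩
  by_contra! hcon
  simp only [Finset.mem_erase] at hu hcon
  have : w = y := by tauto
  subst this
  exact hu.1 (hq u hu.2.2.2 huw.symm)

theorem card_nbrs_erase_ge {v : V} {W : Finset V} {d : ℕ} (hd : d + 1 ≤ (nbrs G U v).card)
    (hW : ∀ b ∈ U, G.Adj v b → b ∈ W ∨ b = a) : d ≤ (nbrs G W v).card := by
  have h1 : nbrs G U v ⊆ insert a (nbrs G W v) := by
    intro b hb
    rw [mem_nbrs] at hb
    have := hW b hb.1 hb.2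
    simp only [Finset.mem_insert, mem_nbrs]
    tauto
  have h2 := Finset.card_le_card h1
  have h3 := Finset.card_insert_le a (nbrs G W v)
  omega

/-- Recursion on a piece attached to the rest through `x`, `y` and one further vertex `a`. -/
theorem RootedHyp.of_piece_roots (h : RootedHyp G U x y x k) (hT : RootedBelow V U.card)
    (hk : 3 ≤ k) {X : Finset V} (hX : X ⊆ U) (hne : X.Nonempty) (hxX : x ∉ X) (hyX : y ∉ X)
    (haX : a ∉ X) (ha : a ∈ U) (hax : a ≠ x) (hay : a ≠ y)
    (hN : ∀ u ∈ X, ∀ v ∈ U, G.Adj u v → v ∈ X ∨ v = x ∨ v = a ∨ v = y)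
    (hout : ∃ w ∈ U, w ∉ X ∧ w ≠ x ∧ w ≠ a ∧ w ≠ y) : AdmPaths G U x y k := by
  obtain ⟨w₀, hw₀, hw₀X, hw₀x, hw₀a, hw₀y⟩ := hout
  obtain ⟨u₀, hu₀⟩ := hne
  by_contra hcon
  have h1 : AdmPaths G (insert a (insert y X)) a y (k - 1) := by
    refine hT G _ a y a (k - 1) (Finset.card_lt_card ?_) ⟨hay, by simp, by simp, ?_, ?_, by omega,
      ?_, fun _ => rfl⟩
    · refine ⟨?_, fun hsub => ?_⟩
      · exact Finset.insert_subset ha (Finset.insert_subset h.right_mem hX)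
      · have := hsub hw₀
        simp [hw₀X, hw₀a, hw₀y] at this
    · intro X' hX' hne' haX' hyX' q
      by_contra! hfail
      have hX'X : X' ⊆ X := by grind
      refine hcon (h.of_piece' hT (X := X') (q := q) (hX'X.trans hX) hne' (fun h => hxX (hX'X h))
        hyX' (fun u hu v hv huv => ?_) ?_)
      · by_contra! hv'
        have hv2 := hN u (hX'X hu) v hv huv
        refine hfail u hu v ?_ hv'.1 hv'.2.2 huv
        simp only [Finset.mem_insert]
        tauto
      · by_cases haq : a = q
        · exact ⟨y, h.right_mem, hyX', h.ne.symm, fun h => hay (haq.trans h.symm)⟩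
        · exact ⟨a, ha, haX', hax, haq⟩
    · exact ⟨u₀, by simp [hu₀], fun h => haX (h ▸ hu₀), fun h => hyX (h ▸ hu₀),
        fun h => haX (h ▸ hu₀)⟩
    · intro _ w hw hwa hwy _
      have hwX : w ∈ X := by grind
      have hdeg := h.deg (by omega) w (hX hwX) (fun h => hxX (h ▸ hwX)) hwy
        (fun h => hxX (h ▸ hwX))
      have := card_nbrs_erase_ge (a := x) (W := insert a (insert y X)) hdeg (fun b hb hwb => by
        have := hN w hwX b hb hwb
        simp only [Finset.mem_insert]
        tauto)
      omega
  have hno : ∀ u ∈ U, u ∉ X → u ≠ x → u ≠ a → u ≠ y → ∀ v ∈ X, ¬ G.Adj u v := by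
    intro u hu huX hux hua huy v hv huv
    have := hN v hv u hu huv.symm
    tauto
  have hU2 : ∀ v, v ∈ U \ insert y X ↔ v ∈ U ∧ v ≠ y ∧ v ∉ X := by
    intro v
    simp only [Finset.mem_sdiff, Finset.mem_insert]
    tauto
  have h2 : AdmPaths G (U \ insert y X) x a 2 := by
    refine hT G _ x a x 2 (Finset.card_lt_card ?_) ⟨hax.symm, ?_, ?_, ?_, ?_, by omega,
      ?_, fun _ => rfl⟩
    · refine ⟨Finset.sdiff_subset, fun hsub => ?_⟩
      simpa using hsub h.right_mem
    · simp [hU2, h.ne, h.left_mem, hxX]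
    · simp [hU2, ha, hay, haX]
    · intro X' hX' hne' hxX' haX' q
      by_contra! hfail
      refine hcon (h.swap.of_piece' hT (X := X') (q := q) (hX'.trans Finset.sdiff_subset) hne'
        (fun h => by simpa [hU2] using hX' h) hxX' (fun u hu v hv huv => ?_) ?_).symm
      · by_contra! hv'
        have hu' := (hU2 u).1 (hX' hu)
        refine hfail u hu v ((hU2 v).2 ⟨hv, hv'.2.1, fun hvX => ?_⟩) hv'.1 hv'.2.2 huv
        exact hno u hu'.1 hu'.2.2 (fun h => hxX' (h ▸ hu)) (fun h => haX' (h ▸ hu)) hu'.2.1 v hvX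
          huv
      · by_cases haq : a = q
        · exact ⟨x, h.left_mem, hxX', h.ne, fun h => hax (haq.trans h.symm)⟩
        · exact ⟨a, ha, haX', hay, haq⟩
    · exact ⟨w₀, by simp [hU2, hw₀, hw₀y, hw₀X], hw₀x, hw₀a, hw₀x⟩
    · intro _ w hw hwx hwa _
      have hw' := (hU2 w).1 hw
      have hdeg := h.deg (by omega) w hw'.1 hwx hw'.2.1 hwx
      have := card_nbrs_erase_ge (a := y) (W := U \ insert y X) hdeg (fun b hb hwb => by
        have := hno w hw'.1 hw'.2.2 hwx hwa hw'.2.1 b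
        rw [hU2]
        tauto)
      omega
  refine hcon (HoldsOnAP.combine h2 h1 (by omega) (by omega) (c := 0) ?_ (by omega))
  rintro ℓ ℓ' ⟨h3, h4⟩ ⟨h5, h6⟩
  refine ⟨by omega, ?_⟩
  refine h4.append' h6 (fun v hv hv' => ?_) Finset.sdiff_subset
    (Finset.insert_subset ha (Finset.insert_subset h.right_mem hX))
  rw [hU2] at hv
  simp only [Finset.mem_insert] at hv'
  tauto

set_option maxHeartbeats 1600000 in
/-- Recursion on a piece `X` of a connected set `C ∋ y` attached to the rest through `a`, `x` and
one further vertex `q`, where `a` can be reached from `x` outside `C`. -/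
theorem RootedHyp.of_three_cut (h : RootedHyp G U x y x k) (hT : RootedBelow V U.card)
    (hk : 3 ≤ k) (hna : ¬ G.Adj x y) {C H X : Finset V} {q : V} {n₀ : ℕ} (hCU : C ⊆ U)
    (hC : ConnOn G C) (hyC : y ∈ C) (hHU : H ⊆ U) (hHC : Disjoint H C)
    (hpath : PathIn G n₀ H x a) (hax : a ≠ x) (hX : X ⊆ C) (hne : X.Nonempty) (hyX : y ∉ X)
    (hqC : q ∈ C) (hqX : q ∉ X)
    (hN : ∀ u ∈ X, ∀ v ∈ U, G.Adj u v → v ∈ X ∨ v = x ∨ v = a ∨ v = q)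
    (hout : ∃ w ∈ U, w ∉ C ∧ w ≠ x ∧ w ≠ a) : AdmPaths G U x y k := by
  obtain ⟨w₀, hw₀, hw₀C, hw₀x, hw₀a⟩ := hout
  obtain ⟨u₀, hu₀⟩ := hne
  have hHC' := Finset.disjoint_left.1 hHC
  have hxC := hHC' hpath.left_mem
  have haC := hHC' hpath.right_mem
  have haU := hHU hpath.right_mem
  have hXU := hX.trans hCU
  have hxX : x ∉ X := fun h => hxC (hX h)
  have haX : a ∉ X := fun h => haC (hX h)
  have hay : a ≠ y := fun h => haC (h ▸ hyC)
  have hqx : q ≠ x := fun h => hxC (h ▸ hqC)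
  have hqa : q ≠ a := fun h => haC (h ▸ hqC)
  have hqU := hCU hqC
  have hw₀y : w₀ ≠ y := fun h => hw₀C (h ▸ hyC)
  have hw₀q : w₀ ≠ q := fun h => hw₀C (h ▸ hqC)
  have hw₀X : w₀ ∉ X := fun h => hw₀C (hX h)
  by_cases hqy : q = y
  · subst hqy
    exact h.of_piece_roots hT hk hXU ⟨u₀, hu₀⟩ hxX hyX haX haU hax hay hN
      ⟨w₀, hw₀, hw₀X, hw₀x, hw₀a, hw₀y⟩
  by_contra hcon
  -- paths from `x` to `q` through `X`
  have h1 : AdmPaths G (insert x (insert q X)) x q (k - 1) := by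
    refine hT G _ x q x (k - 1) (Finset.card_lt_card ?_) ⟨hqx.symm, by simp, by simp, ?_, ?_,
      by omega, ?_, fun _ => rfl⟩
    · refine ⟨?_, fun hsub => ?_⟩
      · exact Finset.insert_subset h.left_mem (Finset.insert_subset hqU hXU)
      · have := hsub haU
        simp [hax, hqa.symm, haX] at this
    · intro X' hX' hne' hxX' hqX' q₀
      by_contra! hfail
      have hX'X : X' ⊆ X := by grind
      have hN' : ∀ u ∈ X', ∀ v ∈ U, G.Adj u v → v ∈ X' ∨ v = a ∨ v = q₀ := by
        intro u hu v hv huv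
        by_contra! hv'
        have := hN u (hX'X hu) v hv huv
        refine hfail u hu v ?_ hv'.1 hv'.2.2 huv
        simp only [Finset.mem_insert]
        tauto
      obtain ⟨u, hu, q', hq'U, hq'X', hq'a, huq'⟩ := h.conn X' (hX'X.trans hXU) hne' hxX'
        (fun h => hyX (hX'X h)) a
      obtain rfl : q' = q₀ := by
        have := hN' u hu q' hq'U huq'
        tauto
      by_cases hq'x : q' = x
      · subst hq'x
        exact hcon (h.of_piece' hT (q := a) (hX'X.trans hXU) hne' hxX' (fun h => hyX (hX'X h))
          (fun u hu v hv huv => by have := hN' u hu v hv huv; tauto)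
          ⟨q, hqU, hqX', hqx, hqa⟩)
      have hq'C : q' ∈ C := by
        have := hN u (hX'X hu) q' hq'U huq'
        rcases this with h1 | h1 | h1 | h1
        exacts [hX h1, absurd h1 hq'x, absurd h1 hq'a, h1 ▸ hqC]
      have hX'C := hX'X.trans hX
      have hP : AdmPaths G (insert a (insert q' X')) a q' k := by
        refine hT G _ a q' a k (Finset.card_lt_card ?_) ⟨hq'a.symm, by simp, by simp, ?_, ?_,
          by omega, ?_, fun _ => rfl⟩
        · refine ⟨?_, fun hsub => ?_⟩
          · exact Finset.insert_subset haU (Finset.insert_subset hq'U (hX'C.trans hCU))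
          · have := hsub h.left_mem
            simp [hax.symm, Ne.symm hq'x, hxX'] at this
        · intro X₂ hX₂ hne₂ haX₂ hqX₂ q₂
          have hX₂X : X₂ ⊆ X' := by grind
          obtain ⟨b, hb, c, hc, hcX, hcq, hbc⟩ := h.conn X₂ (hX₂X.trans (hX'C.trans hCU)) hne₂
            (fun h => hxX' (hX₂X h)) (fun h => hyX (hX'X (hX₂X h))) q₂
          refine ⟨b, hb, c, ?_, hcX, hcq, hbc⟩
          have := hN' b (hX₂X hb) c hc hbc
          simp only [Finset.mem_insert]
          tauto
        · exact ⟨u, by simp [hu], fun h => haX (hX'X (h ▸ hu)), fun h => hq'X' (h ▸ hu),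
            fun h => haX (hX'X (h ▸ hu))⟩
        · intro _ w hw hwa hwq _
          have hwX : w ∈ X' := by grind
          have hwX2 := hX'X hwX
          refine (h.deg (by omega) w (hXU hwX2) (fun h => hxX (h ▸ hwX2))
            (fun h => hyX (h ▸ hwX2)) (fun h => hxX (h ▸ hwX2))).trans (Finset.card_le_card ?_)
          intro b hb
          rw [mem_nbrs] at hb ⊢
          have := hN' w hwX b hb.1 hb.2
          simp only [Finset.mem_insert]
          tauto
      obtain ⟨n, hn⟩ := hC.exists_pathIn_sdiff hX'C hq'C hq'X' hyC (fun h => hyX (hX'X h))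
        (fun u hu v hv huv => by
          rcases hN' u hu v (hCU hv) huv with h1 | h1 | h1
          exacts [Or.inl h1, absurd (h1 ▸ hv) haC, Or.inr h1])
      have hP2 : AdmPaths G (insert a C) a y k := by
        refine hP.append hn (fun v hv hv' => ?_) ?_ ?_
        · simp only [Finset.mem_insert, Finset.mem_sdiff] at hv hv'
          rcases hv with rfl | rfl | hv
          exacts [absurd hv'.1 haC, rfl, absurd hv hv'.2]
        · exact Finset.insert_subset_insert _ (Finset.insert_subset hq'C hX'C)
        · exact Finset.sdiff_subset.trans (Finset.subset_insert _ _)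
      refine hcon (hP2.symm.append hpath.symm (fun v hv hv' => ?_) ?_ hHU).symm
      · simp only [Finset.mem_insert] at hv
        rcases hv with rfl | hv
        exacts [rfl, absurd hv (hHC' hv')]
      · exact Finset.insert_subset haU hCU
    · exact ⟨u₀, by simp [hu₀], fun h => hxX (h ▸ hu₀), fun h => hqX (h ▸ hu₀),
        fun h => hxX (h ▸ hu₀)⟩
    · intro _ w hw hwx hwq _
      have hwX : w ∈ X := by grind
      have hdeg := h.deg (by omega) w (hXU hwX) hwx (fun h => hyX (h ▸ hwX)) hwx
      have := card_nbrs_erase_ge (a := a) (W := insert x (insert q X)) hdeg (fun b hb hwb => by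
        have := hN w hwX b hb hwb
        simp only [Finset.mem_insert]
        tauto)
      omega
  have hno : ∀ u ∈ U, u ∉ X → u ≠ x → u ≠ a → u ≠ q → ∀ v ∈ X, ¬ G.Adj u v := by
    intro u hu huX hux hua huy v hv huv
    have := hN v hv u hu huv.symm
    tauto
  have hmW : ∀ v, v ∈ U \ insert x X ↔ v ∈ U ∧ v ≠ x ∧ v ∉ X := by
    intro v
    simp only [Finset.mem_sdiff, Finset.mem_insert]
    tauto
  -- it suffices to find two admissible paths from `q` to `y` outside `X`
  have hfin : ¬ HoldsOnAP 2 fun ℓ => PathIn G ℓ (U \ insert x X) q y := by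
    intro h2
    refine hcon (HoldsOnAP.combine h1 h2 (by omega) (by omega) (c := 0) ?_ (by omega))
    rintro ℓ ℓ' ⟨h3, h4⟩ h6
    refine ⟨by omega, ?_⟩
    refine h4.append' h6 (fun v hv hv' => ?_)
      (Finset.insert_subset h.left_mem (Finset.insert_subset hqU hXU)) Finset.sdiff_subset
    rw [hmW] at hv'
    simp only [Finset.mem_insert] at hv
    tauto
  generalize hW : U \ insert x X = W at *
  -- a maximal set separated from the roots by a single vertex
  let bad : Finset V → Prop := fun Y => q ∉ Y ∧ y ∉ Y ∧
    ∃ c, ∀ u ∈ Y, ∀ v ∈ W, G.Adj u v → v ∈ Y ∨ v = c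
  have hbad : ∀ Y ⊆ W, bad Y → a ∉ Y → Y = ∅ := by
    rintro Y hYW ⟨hqY, hyY, c, hc⟩ haY
    by_contra hne
    refine hcon (h.of_piece' hT (X := Y) (q := c) (fun v hv => ((hmW v).1 (hYW hv)).1)
      (Finset.nonempty_iff_ne_empty.2 hne) (fun hv => ((hmW x).1 (hYW hv)).2.1 rfl) hyY
      (fun u hu v hv huv => ?_) ?_)
    · have hu' := (hmW u).1 (hYW hu)
      by_contra! hv'
      have hvW : v ∈ W := (hmW v).2 ⟨hv, hv'.2.1, fun hvX => hno u hu'.1 hu'.2.2 hu'.2.1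
        (fun h => haY (h ▸ hu)) (fun h => hqY (h ▸ hu)) v hvX huv⟩
      have := hc u hu v hvW huv
      tauto
    · by_cases haq : a = c
      · exact ⟨q, hqU, hqY, hqx, fun h => hqa (h.trans haq.symm)⟩
      · exact ⟨a, haU, haY, hax, haq⟩
  classical
  obtain ⟨Y, hY, hmax⟩ := (W.powerset.filter bad).exists_max_image Finset.card
    ⟨∅, by simp [bad]; exact ⟨x⟩⟩
  simp only [Finset.mem_filter, Finset.mem_powerset] at hY hmax
  obtain ⟨hYW, hYbad⟩ := hY
  obtain ⟨c, hc, hac⟩ : ∃ c, (∀ u ∈ Y, ∀ v ∈ W, G.Adj u v → v ∈ Y ∨ v = c) ∧ (a ∉ Y → c = a) := by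
    by_cases haY : a ∈ Y
    · obtain ⟨c, hc⟩ := hYbad.2.2
      exact ⟨c, hc, fun h => absurd haY h⟩
    · exact ⟨a, by simp [hbad Y hYW hYbad haY], fun _ => rfl⟩
  have hqW : q ∈ W := (hmW q).2 ⟨hqU, hqx, hqX⟩
  have hyW : y ∈ W := (hmW y).2 ⟨h.right_mem, h.ne.symm, hyX⟩
  have hmY : ∀ v, v ∈ W \ Y ↔ v ∈ W ∧ v ∉ Y := fun v => Finset.mem_sdiff
  have hclY : ∀ u ∈ W, u ∉ Y → u ≠ c → ∀ v ∈ Y, ¬ G.Adj u v := by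
    intro u hu huY huc v hv huv
    have := hc v hv u hu huv.symm
    tauto
  by_cases hnorm : ∃ v ∈ W \ Y, v ≠ q ∧ v ≠ y ∧ v ≠ c
  · have h2 : AdmPaths G (W \ Y) q y 2 := by
      refine hT G _ q y c 2 ?_ ⟨hqy, ?_, ?_, ?_, hnorm, by omega, ?_, by omega⟩
      · refine Finset.card_lt_card ⟨fun v hv => ((hmW v).1 ((hmY v).1 hv).1).1, fun hsub => ?_⟩
        exact ((hmW x).1 ((hmY x).1 (hsub h.left_mem)).1).2.1 rfl
      · exact (hmY q).2 ⟨hqW, hYbad.1⟩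
      · exact (hmY y).2 ⟨hyW, hYbad.2.1⟩
      · intro Z hZ hZne hqZ hyZ q₀
        by_contra! hfail
        have hZW : Z ⊆ W := hZ.trans Finset.sdiff_subset
        by_cases hZY : ∃ u ∈ Z, ∃ v ∈ Y, G.Adj u v
        · obtain ⟨u, hu, v, hv, huv⟩ := hZY
          have huc : u = c := by
            by_contra huc
            exact hclY u (hZW hu) ((hmY u).1 (hZ hu)).2 huc v hv huv
          have := hmax (Z ∪ Y) ⟨Finset.union_subset hZW hYW, by simp [hqZ, hYbad.1],
            by simp [hyZ, hYbad.2.1], q₀, ?_⟩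
          · rw [Finset.card_union_of_disjoint (Finset.disjoint_left.2 fun b hb =>
              ((hmY b).1 (hZ hb)).2)] at this
            have := hZne.card_pos
            omega
          · intro b hb d hd hbd
            simp only [Finset.mem_union] at hb ⊢
            rcases hb with hb | hb
            · by_contra! hcon2
              exact hfail b hb d ((hmY d).2 ⟨hd, hcon2.1.2⟩)
                hcon2.1.1 hcon2.2 hbd
            · rcases hc b hb d hd hbd with h3 | h3
              · exact Or.inl (Or.inr h3)
              · exact Or.inl (Or.inl (h3 ▸ huc ▸ hu))
        · push Not at hZY
          have hZbad : bad Z := ⟨hqZ, hyZ, q₀, fun b hb d hd hbd => by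
            by_contra! hcon2
            exact hfail b hb d ((hmY d).2 ⟨hd, fun h => hZY b hb d h hbd⟩) hcon2.1 hcon2.2 hbd⟩
          have haZ : a ∈ Z := by
            by_contra haZ
            exact hZne.ne_empty (hbad Z hZW hZbad haZ)
          have hYe : Y = ∅ := hbad Y hYW hYbad ((hmY a).1 (hZ haZ)).2
          have h3 := hmax Z ⟨hZW, hZbad⟩
          have h4 := hZne.card_pos
          simp only [hYe, Finset.card_empty] at h3
          omega
      · intro _ w hw hwq hwy hwc
        obtain ⟨hwW, hwY⟩ := (hmY w).1 hw
        obtain ⟨hwU, hwx, hwX⟩ := (hmW w).1 hwW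
        have hwa : w ≠ a := by
          rintro rfl
          exact hwc (hac hwY).symm
        have hdeg := h.deg (by omega) w hwU hwx hwy hwx
        have := card_nbrs_erase_ge (a := x) (W := W \ Y) hdeg (fun b hb hwb => by
          have h3 := hno w hwU hwX hwx hwa hwq b
          have h4 := hclY w hwW hwY hwc b
          rw [hmY, hmW]
          tauto)
        omega
    exact hfin (h2.mono le_rfl fun ℓ hℓ => hℓ.2.mono Finset.sdiff_subset)
  push Not at hnorm
  have haY : a ∈ Y := by
    by_contra haY
    have := hbad Y hYW hYbad haY
    subst this
    have h3 := hnorm w₀ (by simpa using (hmW w₀).2 ⟨hw₀, hw₀x, hw₀X⟩) hw₀q hw₀y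
    exact hw₀a (h3.trans (hac haY))
  -- otherwise `X ∪ {q}` is attached through `x`, `a` and `y`
  have hlast : c ≠ q → (c ≠ y → c ∈ W → c ∉ Y → ¬ G.Adj q c) → False := by
    intro hcq hqc
    refine hcon (h.of_piece_roots (a := a) hT hk (X := insert q X) (Finset.insert_subset hqU hXU)
      ⟨q, by simp⟩ (by simp [hqx.symm, hxX]) (by simp [Ne.symm hqy, hyX]) (by simp [hqa.symm, haX])
      haU hax hay (fun u hu v hv huv => ?_) ⟨w₀, hw₀, by simp [hw₀q, hw₀X], hw₀x, hw₀a, hw₀y⟩)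
    rw [Finset.mem_insert] at hu ⊢
    rcases hu with rfl | hu
    · by_contra! hv'
      have hvW : v ∈ W := (hmW v).2 ⟨hv, hv'.2.1, hv'.1.2⟩
      have hvY : v ∉ Y := fun h => hclY u hqW hYbad.1 (Ne.symm hcq) v h huv
      have hvc : v = c := hnorm v ((hmY v).2 ⟨hvW, hvY⟩) hv'.1.1 hv'.2.2.2
      subst hvc
      exact hqc hv'.2.2.2 hvW hvY huv
    · have := hN u hu v hv huv
      tauto
  have hin : ∃ v ∈ U, v ≠ x ∧ v ≠ y ∧ v ≠ q := ⟨w₀, hw₀, hw₀x, hw₀y, hw₀q⟩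
  by_cases hyc : c = y
  · exact hlast (fun h => hqy (h.symm.trans hyc)) (fun h => absurd hyc h)
  have hNy : ∀ b ∈ U, G.Adj y b → b = q ∨ (b = c ∧ c ∈ W ∧ c ∉ Y) := by
    intro b hb hyb
    have hbX : b ∉ X := fun hbX => hno y h.right_mem hyX h.ne.symm hay.symm (Ne.symm hqy) b hbX hyb
    have hbW : b ∈ W := (hmW b).2 ⟨hb, fun h => hna (h ▸ hyb.symm), hbX⟩
    have hbY : b ∉ Y := fun hbY => hclY y hyW hYbad.2.1 (Ne.symm hyc) b hbY hyb
    by_cases hbq : b = q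
    · exact Or.inl hbq
    · have := hnorm b ((hmY b).2 ⟨hbW, hbY⟩) hbq hyb.ne'
      subst this
      exact Or.inr ⟨rfl, hbW, hbY⟩
  have hyc2 : G.Adj y c ∧ c ∈ W ∧ c ∉ Y ∧ c ≠ q := by
    by_contra hcon2
    refine hcon (h.of_unique_nbr hT (q := q) (fun b hb hyb => ?_) hin hqy)
    rcases hNy b hb hyb with h3 | ⟨rfl, h4, h5⟩
    · exact h3
    · by_contra h6
      exact hcon2 ⟨hyb, h4, h5, h6⟩
  obtain ⟨hyc3, hcW, hcY, hcq⟩ := hyc2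
  have hca : c ≠ a := fun h => hcY (h ▸ haY)
  have hyq : G.Adj y q := by
    by_contra hyq
    refine hcon (h.of_unique_nbr hT (q := c) (fun b hb hyb => ?_)
      ⟨q, hqU, hqx, hqy, hcq.symm⟩ hyc)
    rcases hNy b hb hyb with rfl | h3
    · exact absurd hyb hyq
    · exact h3.1
  refine hlast hcq fun _ _ _ hqc => hfin ?_
  refine holdsOnAP_two (ℓ := 1) (d := 1) (Or.inl rfl) (pathIn_one hqW hyW hyq.symm) ?_
  refine (pathIn_one (W := {c, y}) (by simp) (by simp) hyc3.symm).cons' hqc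
    (by simp [hcq.symm, hqy]) hqW ?_
  intro b hb
  simp only [Finset.mem_insert, Finset.mem_singleton] at hb
  rcases hb with rfl | rfl
  exacts [hcW, hyW]

end RootedCuts

section CompletePaths

variable {V : Type*} [DecidableEq V] {G : SimpleGraph V}

theorem exists_mem_ne_of_card {V : Type*} {A : Finset V} (a : V) (h : 2 ≤ A.card) :
    ∃ b ∈ A, b ≠ a := by
  obtain ⟨b, hb, hba⟩ := Finset.exists_mem_ne (by omega : 1 < A.card) a
  exact ⟨b, hb, hba⟩

theorem exists_mem_ne_ne_of_card {A : Finset V} (a b : V) (h : 3 ≤ A.card) :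
    ∃ c ∈ A, c ≠ a ∧ c ≠ b := by
  obtain ⟨c, hc, hcb⟩ := exists_mem_ne_of_card (A := A.erase a) b (by
    have := Finset.pred_card_le_card_erase (s := A) (a := a)
    omega)
  exact ⟨c, Finset.mem_of_mem_erase hc, Finset.ne_of_mem_erase hc, hcb⟩

/-- Every two vertices of a clique are joined by paths of all possible lengths. -/
theorem pathIn_clique {K : Finset V} (hK : ∀ a ∈ K, ∀ b ∈ K, a ≠ b → G.Adj a b) {u v : V}
    (hu : u ∈ K) (hv : v ∈ K) (huv : u ≠ v) {n : ℕ} (hn : 1 ≤ n) (hnK : n + 1 ≤ K.card) :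
    PathIn G n K u v := by
  induction n, hn using Nat.le_induction generalizing K u with
  | base => exact pathIn_one hu hv (hK u hu v hv huv)
  | succ n hn ih =>
    obtain ⟨w, hw, hwu, hwv⟩ := exists_mem_ne_ne_of_card u v (A := K) (by omega)
    have h1 := Finset.card_erase_add_one hu
    exact (ih (K := K.erase u) (u := w) (fun a ha b hb => hK a (Finset.mem_of_mem_erase ha) b
      (Finset.mem_of_mem_erase hb)) (by simp [hw, hwu]) (by simp [hv, huv.symm]) hwv
      (by omega)).cons' (hK u hu w hw hwu.symm) (by simp) hu (Finset.erase_subset _ _)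

/-- Odd paths in a complete bipartite graph. -/
theorem pathIn_biclique_odd {A B : Finset V} (hAB : Disjoint A B)
    (hadj : ∀ a ∈ A, ∀ b ∈ B, G.Adj a b) {a b : V} (ha : a ∈ A) (hb : b ∈ B) {j : ℕ}
    (hjA : j + 1 ≤ A.card) (hjB : j + 1 ≤ B.card) : PathIn G (2 * j + 1) (A ∪ B) a b := by
  induction j generalizing A B a with
  | zero => exact pathIn_one (by simp [ha]) (by simp [hb]) (hadj a ha b hb)
  | succ j ih =>
    obtain ⟨b₁, hb₁, hbb₁⟩ := exists_mem_ne_of_card b (A := B) (by omega)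
    obtain ⟨a₁, ha₁, haa₁⟩ := exists_mem_ne_of_card a (A := A) (by omega)
    have hd := Finset.disjoint_left.1 hAB
    have h1 := Finset.card_erase_add_one ha
    have h2 := Finset.card_erase_add_one hb₁
    have h3 := ih (A := A.erase a) (B := B.erase b₁) (a := a₁)
      ((hAB.mono_left (Finset.erase_subset _ _)).mono_right (Finset.erase_subset _ _))
      (fun c hc d hd => hadj c (Finset.mem_of_mem_erase hc) d (Finset.mem_of_mem_erase hd))
      (by simp [ha₁, haa₁]) (by simp [hb, hbb₁.symm]) (by omega) (by omega)
    have haB : a ∉ B := hd ha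
    have hbA : b₁ ∉ A := fun h => hd h hb₁
    refine (h3.cons' (hadj a₁ ha₁ b₁ hb₁).symm (W₂ := A.erase a ∪ B) (by simp [hbA])
      (by simp [hb₁]) ?_).cons' (hadj a ha b₁ hb₁) (by simp [haB]) (by simp [ha]) ?_
    · exact Finset.union_subset_union le_rfl (Finset.erase_subset _ _)
    · exact Finset.union_subset_union (Finset.erase_subset _ _) le_rfl

/-- Even paths in a complete bipartite graph. -/
theorem pathIn_biclique_even {A B : Finset V} (hAB : Disjoint A B)
    (hadj : ∀ a ∈ A, ∀ b ∈ B, G.Adj a b) {b b' : V} (hb : b ∈ B) (hb' : b' ∈ B) (hbb' : b ≠ b')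
    {j : ℕ} (hj : 1 ≤ j) (hjA : j ≤ A.card) (hjB : j + 1 ≤ B.card) :
    PathIn G (2 * j) (A ∪ B) b b' := by
  obtain ⟨a, ha⟩ := Finset.card_pos.1 (by omega : 0 < A.card)
  obtain ⟨j, rfl⟩ : ∃ i, j = i + 1 := ⟨j - 1, by omega⟩
  have hd := Finset.disjoint_left.1 hAB
  have h2 := Finset.card_erase_add_one hb
  refine (pathIn_biclique_odd (B := B.erase b) (hAB.mono_right (Finset.erase_subset _ _))
    (fun c hc d hd => hadj c hc d (Finset.mem_of_mem_erase hd)) ha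
    (by simp [hb', hbb'.symm] : b' ∈ B.erase b) (by omega) (by omega) : PathIn G (2 * j + 1) _ a b'
    ).cons' (hadj a ha b hb).symm (by simpa using fun h => hd h hb) (by simp [hb]) ?_
  exact Finset.union_subset_union le_rfl (Finset.erase_subset _ _)

end CompletePaths

section RootedTriangles

variable {V : Type*} [DecidableEq V] {G : SimpleGraph V} {U : Finset V} {x y : V} {k : ℕ}

theorem exists_component_sdiff (G : SimpleGraph V) {U H : Finset V} {r : V} (hr : r ∈ U)
    (hrH : r ∉ H) : ∃ C ⊆ U, r ∈ C ∧ Disjoint H C ∧ ConnOn G C ∧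
      ∀ u ∈ C, ∀ v ∈ U, G.Adj u v → v ∈ C ∨ v ∈ H := by
  obtain ⟨C, hCW, hrC, hcl, hC⟩ := exists_component G (x := r) (W := U \ H) (by simp [hr, hrH])
  refine ⟨C, hCW.trans Finset.sdiff_subset, hrC, Finset.disjoint_left.2 fun v hv hv' =>
    (Finset.mem_sdiff.1 (hCW hv')).2 hv, hC, fun u hu v hv huv => ?_⟩
  by_cases hvH : v ∈ H
  · exact Or.inr hvH
  · exact Or.inl (hcl u hu v (Finset.mem_sdiff.2 ⟨hv, hvH⟩) huv)

/-- Contract a maximal clique through `x` that does not contain all neighbours of `y`. -/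
theorem RootedHyp.of_maximal_clique (h : RootedHyp G U x y x k) (hT : RootedBelow V U.card)
    {K : Finset V} (hKU : K ⊆ U) (hK : ∀ a ∈ K, ∀ b ∈ K, a ≠ b → G.Adj a b) (hxK : x ∈ K)
    (hyK : y ∉ K) (h3 : 3 ≤ K.card) (hmax : ∀ w ∈ U, w ∉ K → ∃ v ∈ K, ¬ G.Adj w v)
    (hy : ∃ b ∈ U, G.Adj y b ∧ b ∉ K) : AdmPaths G U x y k := by
  obtain ⟨b, hb, hyb, hbK⟩ := hy
  obtain ⟨C, hCU, hyC, hKC, hC, hcl⟩ := exists_component_sdiff G h.right_mem hyK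
  have hd := Finset.disjoint_left.1 hKC
  have hKx := Finset.card_erase_add_one hxK
  have hloss : ∀ w ∈ C, w ≠ y → (nbrs G {x} w).card + (nbrs G (K.erase x) w).card + 1 ≤
      K.card - 1 + min 1 (nbrs G (K.erase x) w).card := by
    intro w hw _
    have h1 : (nbrs G {x} w).card ≤ 1 := (Finset.card_le_card nbrs_subset).trans (by simp)
    by_cases h0 : (nbrs G (K.erase x) w).card = 0
    · omega
    obtain ⟨v, hv, hwv⟩ := hmax w (hCU hw) fun hwK => hd hwK hw
    have h4 : (nbrs G {x} w ∪ nbrs G (K.erase x) w).card ≤ (K.erase v).card := by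
      refine Finset.card_le_card fun a ha => ?_
      simp only [Finset.mem_union, mem_nbrs, Finset.mem_singleton, Finset.mem_erase] at ha ⊢
      rcases ha with ⟨rfl, ha⟩ | ⟨ha, ha'⟩
      · exact ⟨fun hav => hwv (hav ▸ ha), hxK⟩
      · exact ⟨fun hav => hwv (hav ▸ ha'), ha.2⟩
    rw [Finset.card_union_of_disjoint (by
      refine Finset.disjoint_left.2 fun a ha ha' => ?_
      simp only [mem_nbrs, Finset.mem_singleton, Finset.mem_erase] at ha ha'
      exact ha'.1.1 ha.1)] at h4
    have := Finset.card_erase_add_one hv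
    omega
  have hH : ∀ s ∈ K.erase x, ∀ j < K.card - 1, PathIn G (1 + j * 1) K x s := by
    intro s hs j hj
    rw [Finset.mem_erase] at hs
    exact pathIn_clique hK hxK hs.2 hs.1.symm (by omega) (by omega)
  rcases h.step hT hCU hC hyC hKU hKC hxK
    (Finset.erase_subset x K) (Finset.card_pos.1 (by omega)) (by simp) (D := {x})
    (fun u hu v hv huv => by
      have := hcl u hu v hv huv
      simp only [Finset.mem_erase, Finset.mem_singleton]
      tauto)
    ⟨b, (hcl y hyC b hb hyb).resolve_right hbK, hyb.ne', fun hbx => hbK (hbx ▸ hxK)⟩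
    (by omega) (Or.inl rfl) hloss hH with
    h1 | ⟨X, hXC, hne, hyX, q, hqC, hqX, hN⟩
  · exact h1
  · obtain ⟨a, ha, hax⟩ := exists_mem_ne_of_card x (A := K) (by omega)
    refine h.of_piece' hT (hXC.trans hCU) hne (fun hx => hd hxK (hXC hx)) hyX
      (fun u hu v hv huv => ?_)
      ⟨a, hKU ha, fun haX => hd ha (hXC haX), hax, fun haq => hd ha (haq ▸ hqC)⟩
    simpa using hN u hu v hv huv

/-- The roots are twins and their common neighbourhood is a clique. -/
theorem RootedHyp.of_twin_clique (h : RootedHyp G U x y x k) (hT : RootedBelow V U.card)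
    (hk : 3 ≤ k) {N : Finset V} (hNx : ∀ v, v ∈ N ↔ v ∈ U ∧ G.Adj x v)
    (hNy : ∀ v, v ∈ N ↔ v ∈ U ∧ G.Adj y v) (hN : ∀ a ∈ N, ∀ b ∈ N, a ≠ b → G.Adj a b)
    (h2 : 2 ≤ N.card) : AdmPaths G U x y k := by
  have hNU : N ⊆ U := fun v hv => ((hNx v).1 hv).1
  have hxN : x ∉ N := fun hx => ((hNx x).1 hx).2.ne rfl
  have hyN : y ∉ N := fun hy => ((hNy y).1 hy).2.ne rfl
  have hK : ∀ a ∈ insert x N, ∀ b ∈ insert x N, a ≠ b → G.Adj a b := by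
    intro a ha b hb hab
    rw [Finset.mem_insert] at ha hb
    rcases ha with rfl | ha <;> rcases hb with rfl | hb
    exacts [absurd rfl hab, ((hNx b).1 hb).2, ((hNx a).1 ha).2.symm, hN a ha b hb hab]
  obtain ⟨v, hv⟩ := Finset.card_pos.1 (by omega : 0 < N.card)
  by_cases hF : ∀ w ∈ U, w ∉ N → w = x ∨ w = y
  · have hdeg := h.deg (by omega) v (hNU hv) (fun e => hxN (e ▸ hv)) (fun e => hyN (e ▸ hv))
      (fun e => hxN (e ▸ hv))
    have h3 : nbrs G U v ⊆ insert x (insert y (N.erase v)) := by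
      intro b hb
      rw [mem_nbrs] at hb
      have := hF b hb.1
      have := hb.2.ne'
      simp only [Finset.mem_insert, Finset.mem_erase]
      tauto
    have h4 := (Finset.card_le_card h3).trans (Finset.card_insert_le _ _)
    have h5 := Finset.card_insert_le y (N.erase v)
    have h6 := Finset.card_erase_add_one hv
    refine ⟨2, 1, Or.inl rfl, fun i hi => ⟨by omega, ?_⟩⟩
    have h7 : PathIn G (1 + i) (insert x N) v x := pathIn_clique hK (by simp [hv]) (by simp)
      (fun e : v = x => hxN (e ▸ hv)) (by omega) (by rw [Finset.card_insert_of_notMem hxN]; omega)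
    refine (show 2 + i * 1 = 1 + i + 1 by omega) ▸
      (h7.cons' ((hNy v).1 hv).2 ?_ h.right_mem ?_).symm
    · simp [h.ne.symm, hyN]
    · exact Finset.insert_subset h.left_mem hNU
  push Not at hF
  obtain ⟨f, hf, hfN, hfx, hfy⟩ := hF
  obtain ⟨C, hCU, hfC, hHC, hC, hcl⟩ := exists_component_sdiff G (H := insert x (insert y N)) hf
    (by simp [hfx, hfy, hfN])
  have hd := Finset.disjoint_left.1 hHC
  have hxC : x ∉ C := hd (by simp)
  have hyC : y ∉ C := hd (by simp)
  have hNC : Disjoint N C := hHC.mono_left fun a ha => by simp [ha]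
  have hdN := Finset.disjoint_left.1 hNC
  have hcl' : ∀ u ∈ C, ∀ v ∈ U, G.Adj u v → v ∈ C ∨ v ∈ N := by
    intro u hu v hv huv
    have h1 := hcl u hu v hv huv
    have h2 : v ≠ x := fun e => hdN ((hNx u).2 ⟨hCU hu, e ▸ huv.symm⟩) hu
    have h3 : v ≠ y := fun e => hdN ((hNy u).2 ⟨hCU hu, e ▸ huv.symm⟩) hu
    simp only [Finset.mem_insert] at h1
    tauto
  have hatt : ∀ q, ∃ u ∈ C, ∃ v ∈ N, v ≠ q ∧ G.Adj u v := by
    intro q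
    obtain ⟨u, hu, v, hv, hvC, hvq, huv⟩ := h.conn C hCU ⟨f, hfC⟩ hxC hyC q
    exact ⟨u, hu, v, (hcl' u hu v hv huv).resolve_left hvC, hvq, huv⟩
  obtain ⟨uq, huq, q, hq, -, huqq⟩ := hatt x
  have hNq := Finset.card_erase_add_one hq
  have hpaths := exists_paths_of_contraction (G := G) (k := max 1 (k + 1 - (N.card - 1))) hT
    (C := C) (S := N.erase q) (Y := {q}) (z := x)
    (hNC.symm.mono_right (Finset.erase_subset _ _)) (by simpa using hdN hq) (by simp)
    (Finset.card_pos.1 (by omega)) (by simp) ?_ ⟨f, hfC, hfx⟩ (by omega) (fun _ => hxC) ?_ ?_ ?_ ?_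
  · refine admPaths_of_paths (k := k) (p := N.card - 1) (c := 1) (d := 1)
      (S := N.erase q) (H := insert x (N.erase q)) (L := {q, y}) (n := 1)
      (hpaths.mono le_rfl fun ℓ hℓ => ?_) (by omega) (by omega) (Or.inl rfl)
      (by omega) (fun s hs j hj => ?_) (pathIn_one (by simp) (by simp) ((hNy q).1 hq).2.symm)
      ?_ ?_ ?_ ?_ ?_ hCU ?_
    · simpa using hℓ
    · rw [Finset.mem_erase] at hs
      refine pathIn_clique (fun a ha b hb => hK a ?_ b ?_) (by simp) (by simp [hs])
        (fun e : x = s => hxN (e ▸ hs.2 : x ∈ N)) (by omega) ?_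
      · exact Finset.insert_subset_insert _ (Finset.erase_subset _ _) ha
      · exact Finset.insert_subset_insert _ (Finset.erase_subset _ _) hb
      · rw [Finset.card_insert_of_notMem (by simp [hxN])]
        omega
    · exact hHC.mono_left (Finset.insert_subset_insert _
        ((Finset.erase_subset _ _).trans (Finset.subset_insert _ _)))
    · simpa using fun e : q = x => hxN (e ▸ hq)
    · simpa [hyC] using hdN hq
    · have : q ≠ x := fun e => hxN (e ▸ hq)
      simp [this.symm, h.ne, hyN]
    · exact Finset.insert_subset h.left_mem ((Finset.erase_subset _ _).trans hNU)
    · intro a ha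
      simp only [Finset.mem_insert, Finset.mem_singleton] at ha
      rcases ha with rfl | rfl
      exacts [hNU hq, h.right_mem]
  · have h1 : insert x (insert y (insert q C)) ⊆ U := by
      simp [Finset.insert_subset_iff, h.left_mem, h.right_mem, hNU hq, hCU]
    have h2 := Finset.card_le_card h1
    have hqx : x ≠ q := fun e => hxN (e ▸ hq)
    have hqy : y ≠ q := fun e => hyN (e ▸ hq)
    rw [Finset.card_insert_of_notMem (by simp [h.ne, hqx, hxC]),
      Finset.card_insert_of_notMem (by simp [hqy, hyC]),
      Finset.card_insert_of_notMem (hdN hq)] at h2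
    omega
  · intro X hX hne
    by_cases hXC : ∃ z ∈ C, z ∉ X
    · obtain ⟨u, hu, v, hv, hvX, huv⟩ := hC X hX hne hXC
      exact ⟨u, hu, v, by simp [hv], hvX, huv⟩
    · push Not at hXC
      exact ⟨uq, hXC uq huq, q, by simp, fun hqX => hdN hq (hX hqX), huqq⟩
  · intro X hX hne
    by_cases hXC : ∃ z ∈ C, z ∉ X
    · obtain ⟨u, hu, v, hv, hvX, huv⟩ := hC X hX hne hXC
      exact ⟨u, hu, v, by simp [hv], hvX, huv⟩
    · push Not at hXC
      obtain ⟨u, hu, v, hv, hvq, huv⟩ := hatt q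
      exact ⟨u, hXC u hu, v, by simp [hv, hvq], fun hvX => hdN hv (hX hvX), huv⟩
  · intro X hX hne q₀ _
    obtain ⟨u, hu, v, hv, hvX, hvq, huv⟩ := h.conn X (hX.trans hCU) hne (fun e => hxC (hX e))
      (fun e => hyC (hX e)) q₀
    refine ⟨u, hu, v, ?_, hvX, hvq, huv⟩
    have := hcl' u (hX hu) v hv huv
    simp only [Finset.mem_union, Finset.mem_erase, Finset.mem_singleton]
    tauto
  · intro hk' w hw hwx
    have hdeg := h.deg (by omega) w (hCU hw) hwx (fun e => hyC (e ▸ hw)) hwx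
    have h1 : nbrs G U w ⊆ nbrs G C w ∪ (nbrs G (N.erase q) w ∪ nbrs G {q} w) := by
      intro b hb
      rw [mem_nbrs] at hb
      have := hcl' w hw b hb.1 hb.2
      simp only [Finset.mem_union, mem_nbrs, Finset.mem_erase, Finset.mem_singleton]
      tauto
    have h2 := (Finset.card_le_card h1).trans (Finset.card_union_le _ _)
    have h3 := Finset.card_union_le (nbrs G (N.erase q) w) (nbrs G {q} w)
    have h4 : (nbrs G {q} w).card ≤ 1 := (Finset.card_le_card nbrs_subset).trans (by simp)
    have h5 : (nbrs G (N.erase q) w).card ≤ (N.erase q).card := Finset.card_le_card nbrs_subset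
    omega

/-- The root `x` lies in a triangle. -/
theorem RootedHyp.of_triangle (h : RootedHyp G U x y x k) (hT : RootedBelow V U.card)
    (hk : 3 ≤ k) (hna : ¬ G.Adj x y) {a b : V} (ha : a ∈ U) (hb : b ∈ U) (hxa : G.Adj x a)
    (hxb : G.Adj x b) (hab : G.Adj a b) : AdmPaths G U x y k := by
  classical
  have hay : a ≠ y := fun e => hna (e ▸ hxa)
  have hby : b ≠ y := fun e => hna (e ▸ hxb)
  have key : ∀ r s : V, r ∈ U → ¬ G.Adj r s → ∀ a b : V, a ∈ U → b ∈ U → G.Adj r a → G.Adj r b →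
      G.Adj a b → ∃ K ⊆ U, (∀ a ∈ K, ∀ b ∈ K, a ≠ b → G.Adj a b) ∧ r ∈ K ∧ 3 ≤ K.card ∧
        ∀ w ∈ U, w ∉ K → ∃ v ∈ K, ¬ G.Adj w v := by
    intro r s hr hrs a b ha hb hra hrb hab
    obtain ⟨K, hK, hmax⟩ := (U.powerset.filter fun K =>
      (∀ a ∈ K, ∀ b ∈ K, a ≠ b → G.Adj a b) ∧ r ∈ K).exists_max_image Finset.card
      ⟨{r}, by simp [hr]⟩
    simp only [Finset.mem_filter, Finset.mem_powerset] at hK hmax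
    refine ⟨K, hK.1, hK.2.1, hK.2.2, ?_, fun w hw hwK => ?_⟩
    · have h1 := hmax {r, a, b} ⟨by simp [Finset.insert_subset_iff, hr, ha, hb], ?_, by simp⟩
      · rwa [Finset.card_eq_three.2 ⟨r, a, b, hra.ne, hrb.ne, hab.ne, rfl⟩] at h1
      · intro c hc d hd hcd
        simp only [Finset.mem_insert, Finset.mem_singleton] at hc hd
        rcases hc with rfl | rfl | rfl <;> rcases hd with rfl | rfl | rfl <;>
          first | exact absurd rfl hcd | assumption | (apply SimpleGraph.Adj.symm; assumption)
    · by_contra! hcon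
      have h1 := hmax (insert w K) ⟨Finset.insert_subset hw hK.1, ?_, by simp [hK.2.2]⟩
      · rw [Finset.card_insert_of_notMem hwK] at h1
        omega
      · intro c hc d hd hcd
        rw [Finset.mem_insert] at hc hd
        rcases hc with rfl | hc <;> rcases hd with rfl | hd
        exacts [absurd rfl hcd, hcon d hd, (hcon c hc).symm, hK.2.1 c hc d hd hcd]
  obtain ⟨K, hKU, hK, hxK, hK3, hKmax⟩ := key x y h.left_mem hna a b ha hb hxa hxb hab
  have hyK : y ∉ K := fun hyK => hna (hK x hxK y hyK h.ne)
  by_cases hy : ∃ b ∈ U, G.Adj y b ∧ b ∉ K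
  · exact h.of_maximal_clique hT hKU hK hxK hyK hK3 hKmax hy
  push Not at hy
  have hsub : ∀ v ∈ U, G.Adj y v → G.Adj x v := fun v hv hyv =>
    hK x hxK v (hy v hv hyv) fun e => hna (e ▸ hyv.symm)
  by_cases hq : ∃ q, ∀ b ∈ U, G.Adj y b → b = q
  · obtain ⟨q, hq⟩ := hq
    by_cases hqy : q = y
    · refine h.of_unique_nbr hT (q := a) (fun c hc hyc => ?_)
        ⟨b, hb, hxb.ne', hby, hab.ne'⟩ hay
      exact absurd ((hq c hc hyc).trans hqy) hyc.ne'
    · by_cases haq : a = q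
      · exact h.of_unique_nbr hT hq ⟨b, hb, hxb.ne', hby, fun e => hab.ne (haq.trans e.symm)⟩ hqy
      · exact h.of_unique_nbr hT hq ⟨a, ha, hxa.ne', hay, haq⟩ hqy
  push Not at hq
  obtain ⟨c, hc, hyc, -⟩ := hq y
  obtain ⟨d, hd, hyd, hdc⟩ := hq c
  obtain ⟨K', hK'U, hK', hyK', hK'3, hK'max⟩ := key y x h.right_mem (fun e => hna e.symm) d c hd hc
    hyd hyc (hK d (hy d hd hyd) c (hy c hc hyc) hdc)
  have hxK' : x ∉ K' := fun hxK' => hna (hK' x hxK' y hyK' h.ne)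
  by_cases hx : ∃ b ∈ U, G.Adj x b ∧ b ∉ K'
  · exact (h.swap.of_maximal_clique hT hK'U hK' hyK' hxK' hK'3 hK'max hx).symm
  push Not at hx
  refine h.of_twin_clique hT hk (N := nbrs G U x) (fun v => mem_nbrs) (fun v => ?_)
    (fun a ha b hb hab => ?_) ?_
  · rw [mem_nbrs]
    refine ⟨fun hv => ⟨hv.1, ?_⟩, fun hv => ⟨hv.1, hsub v hv.1 hv.2⟩⟩
    exact hK' y hyK' v (hx v hv.1 hv.2) fun e => hna (e ▸ hv.2)
  · rw [mem_nbrs] at ha hb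
    exact hK' a (hx a ha.1 ha.2) b (hx b hb.1 hb.2) hab
  · refine Finset.one_lt_card.2 ⟨a, ?_, b, ?_, hab.ne⟩ <;> simp [*]

end RootedTriangles

section RootedPieces

variable {V : Type*} [DecidableEq V] {G : SimpleGraph V} {U : Finset V} {x y : V} {k : ℕ}

/-- A contraction step inside a piece `X` of a connected set `C ∋ y`, towards its attachment `q`. -/
theorem RootedHyp.step_piece {p c d : ℕ} (h : RootedHyp G U x y x k) (hT : RootedBelow V U.card)
    {C H S D X : Finset V} {q : V} (hCU : C ⊆ U) (hC : ConnOn G C) (hyC : y ∈ C) (hHU : H ⊆ U)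
    (hHC : Disjoint H C) (hxH : x ∈ H) (hSH : S ⊆ H) (hDH : D ⊆ H) (hS : S.Nonempty) (hxS : x ∉ S)
    (hXC : X ⊆ C) (hne : X.Nonempty) (hyX : y ∉ X) (hqC : q ∈ C) (hqX : q ∉ X)
    (hcl : ∀ u ∈ X, ∀ v ∈ U, G.Adj u v → v ∈ X ∨ v ∈ S ∨ v ∈ D ∨ v = q)
    (hp : 1 ≤ p) (hd : d = 1 ∨ d = 2)
    (hloss : ∀ w ∈ X, (nbrs G D w).card + (nbrs G S w).card + 1 ≤ p + min 1 (nbrs G S w).card)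
    (hH : ∀ s ∈ S, ∀ j < p, PathIn G (c + j * d) H x s) :
    AdmPaths G U x y k ∨ ∃ X' ⊆ X, X'.Nonempty ∧ ∃ q' ∈ C, q' ∉ X' ∧
      ∀ u ∈ X', ∀ v ∈ U, G.Adj u v → v ∈ X' ∨ v ∈ D ∨ v = q' := by
  have hHC' := Finset.disjoint_left.1 hHC
  have hxC : x ∉ C := hHC' hxH
  have hXU := hXC.trans hCU
  obtain ⟨u₀, hu₀⟩ := hne
  obtain ⟨s₀, hs₀⟩ := hS
  have hXH : Disjoint X H := (hHC.mono_right hXC).symm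
  have hcard : X.card + 2 < U.card := by
    have h1 : insert x (insert s₀ (insert q X)) ⊆ U := by
      simp [Finset.insert_subset_iff, h.left_mem, hHU (hSH hs₀), hCU hqC, hXU]
    have h2 := Finset.card_le_card h1
    have h3 : x ≠ s₀ := fun e => hxS (e ▸ hs₀)
    have h4 : x ≠ q := fun e => hxC (e ▸ hqC)
    have h5 : s₀ ∉ C := hHC' (hSH hs₀)
    have h6 : s₀ ≠ q := fun e => h5 (e ▸ hqC)
    have h7 : x ∉ X := fun e => hxC (hXC e)
    have h8 : s₀ ∉ X := fun e => h5 (hXC e)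
    rw [Finset.card_insert_of_notMem (by simp [h3, h4, h7]),
      Finset.card_insert_of_notMem (by simp [h6, h8]),
      Finset.card_insert_of_notMem hqX] at h2
    omega
  have hclC : ∀ u ∈ X, ∀ v ∈ C, G.Adj u v → v ∈ X ∨ v = q := by
    intro u hu v hv huv
    have h1 : v ∉ H := fun hvH => hHC' hvH hv
    have h2 : v ∉ S := fun hvS => h1 (hSH hvS)
    have h3 : v ∉ D := fun hvD => h1 (hDH hvD)
    have := hcl u hu v (hCU hv) huv
    tauto
  have hA : ∀ X' ⊆ X, X'.Nonempty → ∃ u ∈ X', ∃ v ∈ insert q X, v ∉ X' ∧ G.Adj u v := by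
    intro X' hX' hne'
    obtain ⟨u, hu, v, hv, hvX, huv⟩ := hC X' (hX'.trans hXC) hne' ⟨y, hyC, fun e => hyX (hX' e)⟩
    have := hclC u (hX' hu) v hv huv
    exact ⟨u, hu, v, by rw [Finset.mem_insert]; tauto, hvX, huv⟩
  rcases exists_paths_or_separation (G := G) (U := U) (z := x) (k := k) hT hcard
    (hXH.mono_right hSH) hqX (fun e => hHC' (hSH e) hqC) ⟨s₀, hs₀⟩
    ⟨u₀, hu₀, fun e => hxC (e ▸ hXC hu₀)⟩ h.pos (fun _ e => hxC (hXC e)) hcl (hCU hqC) hA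
    (fun h2 w hw hwx => h.deg h2 w (hXU hw) hwx (fun e => hyX (e ▸ hw)) hwx) hp hloss with
    h1 | ⟨X', hX', hne', q', hq', hqX', hN⟩
  · left
    obtain ⟨n, hn⟩ := hC.exists_pathIn_sdiff hXC hqC hqX hyC hyX hclC
    exact admPaths_of_paths h1 (by omega) hp hd (by omega) hH hn hXH.symm (fun e => hHC' e hqC)
      Finset.sdiff_disjoint (hHC.symm.mono_left Finset.sdiff_subset) hHU hXU
      (Finset.sdiff_subset.trans hCU)
  · refine Or.inr ⟨X', hX', hne', q', ?_, hqX', hN⟩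
    rw [Finset.mem_insert] at hq'
    rcases hq' with rfl | hq'
    exacts [hqC, hXC hq']

/-- Both roots have the same two neighbours. -/
theorem RootedHyp.of_twin_two (h : RootedHyp G U x y x k) (hT : RootedBelow V U.card)
    {b₁ b₂ : V} (hb : b₁ ≠ b₂) (hb₁ : b₁ ∈ U) (hb₂ : b₂ ∈ U) (hxb₁ : G.Adj x b₁)
    (hyb₂ : G.Adj y b₂) (hx : ∀ v ∈ U, G.Adj x v → v = b₁ ∨ v = b₂)
    (hy : ∀ v ∈ U, G.Adj y v → v = b₁ ∨ v = b₂) (hxb₂ : b₂ ≠ x) (hyb₁ : b₁ ≠ y)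
    (hin : ∃ v ∈ U, v ≠ x ∧ v ≠ y ∧ v ≠ b₁ ∧ v ≠ b₂) : AdmPaths G U x y k := by
  have hm : ∀ v, v ∈ (U.erase x).erase y ↔ v ∈ U ∧ v ≠ x ∧ v ≠ y := by
    intro v
    simp only [Finset.mem_erase]
    tauto
  have hsub : (U.erase x).erase y ⊆ U := fun v hv => ((hm v).1 hv).1
  have h1 : AdmPaths G ((U.erase x).erase y) b₁ b₂ k := by
    refine hT G _ b₁ b₂ b₁ k (Finset.card_lt_card ⟨hsub, fun hs => ?_⟩) ⟨hb, ?_, ?_, ?_, ?_, h.pos,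
      ?_, fun _ => rfl⟩
    · exact ((hm x).1 (hs h.left_mem)).2.1 rfl
    · exact (hm _).2 ⟨hb₁, hxb₁.ne', hyb₁⟩
    · exact (hm _).2 ⟨hb₂, hxb₂, hyb₂.ne'⟩
    · intro X hX hne hb₁X hb₂X q
      obtain ⟨u, hu, v, hv, hvX, hvq, huv⟩ := h.conn X (hX.trans hsub) hne
        (fun e => ((hm x).1 (hX e)).2.1 rfl) (fun e => ((hm y).1 (hX e)).2.2 rfl) q
      refine ⟨u, hu, v, (hm v).2 ⟨hv, ?_, ?_⟩, hvX, hvq, huv⟩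
      · rintro rfl
        rcases hx u (hsub (hX hu)) huv.symm with rfl | rfl
        exacts [hb₁X hu, hb₂X hu]
      · rintro rfl
        rcases hy u (hsub (hX hu)) huv.symm with rfl | rfl
        exacts [hb₁X hu, hb₂X hu]
    · obtain ⟨v, hv, h2, h3, h4, h5⟩ := hin
      exact ⟨v, (hm v).2 ⟨hv, h2, h3⟩, h4, h5, h4⟩
    · intro h2 w hw hw₁ hw₂ _
      obtain ⟨hwU, hwx, hwy⟩ := (hm w).1 hw
      refine (h.deg h2 w hwU hwx hwy hwx).trans (Finset.card_le_card fun b hb => ?_)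
      rw [mem_nbrs, hm]
      rw [mem_nbrs] at hb
      refine ⟨⟨hb.1, ?_, ?_⟩, hb.2⟩
      · rintro rfl
        have := hx w hwU hb.2.symm
        tauto
      · rintro rfl
        have := hy w hwU hb.2.symm
        tauto
  obtain ⟨a, d, hd, hf⟩ := h1
  refine ⟨a + 2, d, hd, fun i hi => ⟨by omega, ?_⟩⟩
  have h2 := ((hf i hi).2.cons' hxb₁ (fun e => ((hm x).1 e).2.1 rfl) (W₂ := U.erase y)
    (by simp [h.ne, h.left_mem]) (fun v hv => by
      have := (hm v).1 hv
      simp [this])).symm.cons' hyb₂ (by simp) h.right_mem (Finset.erase_subset _ _)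
  exact (show a + 2 + i * d = a + i * d + 1 + 1 by omega) ▸ h2.symm

end RootedPieces

section NeighbourCounts

variable {V : Type*} [DecidableEq V] {G : SimpleGraph V} {U : Finset V} {x y : V} {k : ℕ}

theorem card_nbrs_le (G : SimpleGraph V) (W : Finset V) (v : V) : (nbrs G W v).card ≤ W.card :=
  Finset.card_le_card nbrs_subset

theorem card_nbrs_lt {W : Finset V} {v a : V} (ha : a ∈ W) (hva : ¬ G.Adj v a) :
    (nbrs G W v).card < W.card :=
  Finset.card_lt_card ⟨nbrs_subset, fun h => hva (mem_nbrs.1 (h ha)).2⟩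

theorem card_nbrs_eq_zero {W : Finset V} {v : V} (h : ∀ a ∈ W, ¬ G.Adj v a) :
    (nbrs G W v).card = 0 := by
  refine Finset.card_eq_zero.2 (Finset.eq_empty_of_forall_notMem fun a ha => ?_)
  rw [mem_nbrs] at ha
  exact h a ha.1 ha.2

theorem exists_adj_of_card_nbrs_ne_zero {W : Finset V} {v : V} (h : (nbrs G W v).card ≠ 0) :
    ∃ a ∈ W, G.Adj v a := by
  by_contra! hcon
  exact h (card_nbrs_eq_zero hcon)

theorem card_nbrs_erase_add {K : Finset V} {q v : V} (hq : q ∈ K) :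
    (nbrs G {q} v).card + (nbrs G (K.erase q) v).card = (nbrs G K v).card := by
  rw [← Finset.card_union_of_disjoint]
  · congr 1
    ext b
    simp only [Finset.mem_union, mem_nbrs, Finset.mem_singleton, Finset.mem_erase]
    by_cases hb : b = q
    · subst hb
      simp [hq]
    · simp [hb]
  · rw [Finset.disjoint_left]
    intro b hb hb'
    simp only [mem_nbrs, Finset.mem_singleton, Finset.mem_erase] at hb hb'
    exact hb'.1.1 hb.1

theorem isClique_insert {K : Finset V} {b : V} (hK : ∀ a ∈ K, ∀ b ∈ K, a ≠ b → G.Adj a b)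
    (hb : ∀ a ∈ K, G.Adj b a) : ∀ a ∈ insert b K, ∀ c ∈ insert b K, a ≠ c → G.Adj a c := by
  intro c hc d hd hcd
  rw [Finset.mem_insert] at hc hd
  rcases hc with rfl | hc <;> rcases hd with rfl | hd
  exacts [absurd rfl hcd, hb d hd, (hb c hc).symm, hK c hc d hd hcd]

/-- Either the rooted path theorem holds or `y` has two neighbours. -/
theorem RootedHyp.exists_two_nbrs (h : RootedHyp G U x y x k) (hT : RootedBelow V U.card)
    {a b : V} (ha : a ∈ U) (hb : b ∈ U) (hab : a ≠ b) (hax : a ≠ x) (hay : a ≠ y) (hbx : b ≠ x)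
    (hby : b ≠ y) :
    AdmPaths G U x y k ∨ ∃ c ∈ U, ∃ d ∈ U, c ≠ d ∧ G.Adj y c ∧ G.Adj y d := by
  by_contra! hcon
  obtain ⟨hadm, hcon⟩ := hcon
  refine hadm ?_
  by_cases hc : ∃ c ∈ U, G.Adj y c
  · obtain ⟨c, hc, hyc⟩ := hc
    have hq : ∀ d ∈ U, G.Adj y d → d = c := by
      intro d hd hyd
      by_contra hdc
      exact hcon c hc d hd (Ne.symm hdc) hyc hyd
    by_cases hac : a = c
    · exact h.of_unique_nbr hT hq ⟨b, hb, hbx, hby, fun e => hab (hac.trans e.symm)⟩ hyc.ne'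
    · exact h.of_unique_nbr hT hq ⟨a, ha, hax, hay, hac⟩ hyc.ne'
  · push Not at hc
    exact h.of_unique_nbr hT (q := a) (fun d hd hyd => absurd hyd (hc d hd))
      ⟨b, hb, hbx, hby, hab.symm⟩ hay

/-- A maximal clique `K` with exactly one common neighbour among the neighbours of `x`. -/
theorem RootedHyp.of_clique_one (h : RootedHyp G U x y x k) (hT : RootedBelow V U.card)
    (hk : 3 ≤ k) (hna : ¬ G.Adj x y)
    (htx : ∀ a ∈ U, ∀ b ∈ U, G.Adj x a → G.Adj x b → ¬ G.Adj a b)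
    (hty : ∀ a ∈ U, ∀ b ∈ U, G.Adj y a → G.Adj y b → ¬ G.Adj a b)
    {K : Finset V} {b : V} (hKU : K ⊆ U) (hK : ∀ a ∈ K, ∀ b ∈ K, a ≠ b → G.Adj a b)
    (hxK : x ∉ K) (hyK : y ∉ K) (h2 : 2 ≤ K.card) (hb : b ∈ U) (hxb : G.Adj x b)
    (hbK : ∀ a ∈ K, G.Adj b a)
    (hmax : ∀ w ∈ U, w ∉ K → w ≠ x → w ≠ y → w ≠ b → G.Adj w x ∨ G.Adj w b →
      ∃ a ∈ K, ¬ G.Adj w a) : AdmPaths G U x y k := by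
  have hbnK : b ∉ K := fun e => (hbK b e).ne rfl
  have hyb : y ≠ b := fun e => hna (e ▸ hxb)
  obtain ⟨a₀, ha₀, a₁, ha₁, ha₀₁⟩ := Finset.one_lt_card.1 (by omega : 1 < K.card)
  have hKx : ∀ a ∈ K, a ≠ x ∧ a ≠ y := fun a ha => ⟨fun e => hxK (e ▸ ha), fun e => hyK (e ▸ ha)⟩
  rcases h.exists_two_nbrs hT (hKU ha₀) (hKU ha₁) ha₀₁ (hKx a₀ ha₀).1 (hKx a₀ ha₀).2
    (hKx a₁ ha₁).1 (hKx a₁ ha₁).2 with hadm | ⟨c, hcU, d, hdU, hcd, hyc, hyd⟩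
  · exact hadm
  have hc : ∃ c ∈ U, G.Adj y c ∧ c ≠ b ∧ c ∉ K := by
    by_contra! hcon
    refine hty c hcU d hdU hyc hyd ?_
    refine isClique_insert hK hbK c ?_ d ?_ hcd
    · by_cases hcb : c = b
      · simp [hcb]
      · simp [hcon c hcU hyc hcb]
    · by_cases hdb : d = b
      · simp [hdb]
      · simp [hcon d hdU hyd hdb]
  clear hyc hyd hcd hcU hdU
  obtain ⟨e, heU, hye, heb, heK⟩ := hc
  have hex : e ≠ x := fun he => hna (he ▸ hye.symm)
  have hyH : y ∉ insert x (insert b K) := by simp [h.ne.symm, hyb, hyK]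
  obtain ⟨C, hCU, hyC, hHC, hC, hcl⟩ := exists_component_sdiff G h.right_mem hyH
  have hd := Finset.disjoint_left.1 hHC
  have hdx : x ∉ C := hd (by simp)
  have hdb : b ∉ C := hd (by simp)
  have hdK : ∀ a ∈ K, a ∉ C := fun a ha => hd (by simp [ha])
  have hHU : insert x (insert b K) ⊆ U := by simp [Finset.insert_subset_iff, h.left_mem, hb, hKU]
  have hloss : ∀ w ∈ C, w ≠ y → (nbrs G {x, b} w).card + (nbrs G K w).card + 1 ≤
      K.card + min 1 (nbrs G K w).card := by
    intro w hw hwy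
    have hwU := hCU hw
    have hwx : w ≠ x := fun e => hdx (e ▸ hw)
    have hwb : w ≠ b := fun e => hdb (e ▸ hw)
    have hwK : w ∉ K := fun e => hdK w e hw
    have h3 : ({x, b} : Finset V).card = 2 := Finset.card_pair hxb.ne
    have h4 : (nbrs G {x, b} w).card ≤ 1 := by
      by_cases hwx' : G.Adj w x
      · have := card_nbrs_lt (G := G) (W := {x, b}) (v := w) (a := b) (by simp)
          fun e => htx w hwU b hb hwx'.symm hxb e
        omega
      · have := card_nbrs_lt (G := G) (W := {x, b}) (a := x) (by simp) hwx'
        omega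
    have h5 := card_nbrs_le G K w
    by_cases h6 : G.Adj w x ∨ G.Adj w b
    · obtain ⟨a, ha, hwa⟩ := hmax w hwU hwK hwx hwy hwb h6
      have := card_nbrs_lt ha hwa
      omega
    · have : (nbrs G {x, b} w).card = 0 := card_nbrs_eq_zero (by simpa using h6)
      omega
  have hH : ∀ s ∈ K, ∀ j < K.card, PathIn G (2 + j * 1) (insert x (insert b K)) x s := by
    intro s hs j hj
    have h3 : PathIn G (1 + j) (insert b K) b s := pathIn_clique (isClique_insert hK hbK)
      (by simp) (by simp [hs]) (fun e : b = s => hbnK (e ▸ hs)) (by omega)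
      (by rw [Finset.card_insert_of_notMem hbnK]; omega)
    exact (show 2 + j * 1 = 1 + j + 1 by omega) ▸ h3.cons hxb (by simp [hxb.ne, hxK])
  rcases h.step hT hCU hC hyC hHU hHC (by simp) (S := K) (D := {x, b})
    (fun a ha => by simp [ha]) ⟨a₀, ha₀⟩ hxK
    (fun u hu v hv huv => by
      have := hcl u hu v hv huv
      simp only [Finset.mem_insert, Finset.mem_singleton] at this ⊢
      tauto)
    ⟨e, (hcl y hyC e heU hye).resolve_right (by simp [hex, heb, heK]), hye.ne', hex⟩
    (by omega) (Or.inl rfl) hloss hH with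
    h1 | ⟨X, hXC, hne, hyX, q, hqC, hqX, hN⟩
  · exact h1
  · refine h.of_three_cut hT hk hna hCU hC hyC hHU hHC (a := b) (n₀ := 1)
      (pathIn_one (by simp) (by simp) hxb) hxb.ne' hXC hne hyX hqC hqX (fun u hu v hv huv => ?_)
      ⟨a₀, hKU ha₀, hdK a₀ ha₀, fun e => hxK (e ▸ ha₀), fun e => hbnK (e ▸ ha₀)⟩
    have := hN u hu v hv huv
    simp only [Finset.mem_insert, Finset.mem_singleton] at this
    tauto

end NeighbourCounts

section CliquesInNeighbourhood

variable {V : Type*} [DecidableEq V] {G : SimpleGraph V} {U : Finset V} {x y : V} {k : ℕ}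

set_option maxHeartbeats 1600000 in
/-- A maximal clique `K` with two common neighbours `b₁`, `b₂` among the neighbours of `x`. -/
theorem RootedHyp.of_clique_two (h : RootedHyp G U x y x k) (hT : RootedBelow V U.card)
    (hna : ¬ G.Adj x y)
    (htx : ∀ a ∈ U, ∀ b ∈ U, G.Adj x a → G.Adj x b → ¬ G.Adj a b)
    {K : Finset V} {b₁ b₂ : V} (hKU : K ⊆ U) (hK : ∀ a ∈ K, ∀ b ∈ K, a ≠ b → G.Adj a b)
    (hxK : x ∉ K) (hyK : y ∉ K) (h2 : 2 ≤ K.card) (hb : b₁ ≠ b₂) (hb₁ : b₁ ∈ U) (hb₂ : b₂ ∈ U)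
    (hxb₁ : G.Adj x b₁) (hxb₂ : G.Adj x b₂)
    (hbK₁ : ∀ a ∈ K, G.Adj b₁ a) (hbK₂ : ∀ a ∈ K, G.Adj b₂ a)
    (hmax : ∀ w ∈ U, w ∉ K → w ≠ x → w ≠ y → G.Adj w b₁ ∨ G.Adj w b₂ →
      ∃ a ∈ K, ¬ G.Adj w a)
    (hy : ∃ e ∈ U, G.Adj y e ∧ e ≠ b₁ ∧ e ≠ b₂ ∧ e ∉ K) : AdmPaths G U x y k := by
  have hbnK₁ : b₁ ∉ K := fun e => (hbK₁ b₁ e).ne rfl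
  have hbnK₂ : b₂ ∉ K := fun e => (hbK₂ b₂ e).ne rfl
  have hyb₁ : y ≠ b₁ := fun e => hna (e ▸ hxb₁)
  have hyb₂ : y ≠ b₂ := fun e => hna (e ▸ hxb₂)
  obtain ⟨a₀, ha₀, a₁, ha₁, ha₀₁⟩ := Finset.one_lt_card.1 (by omega : 1 < K.card)
  obtain ⟨e, heU, hye, heb₁, heb₂, heK⟩ := hy
  have hex : e ≠ x := fun he => hna (he ▸ hye.symm)
  have hyH : y ∉ insert x (insert b₁ (insert b₂ K)) := by simp [h.ne.symm, hyb₁, hyb₂, hyK]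
  obtain ⟨C, hCU, hyC, hHC, hC, hcl⟩ := exists_component_sdiff G h.right_mem hyH
  have hd := Finset.disjoint_left.1 hHC
  have hdx : x ∉ C := hd (by simp)
  have hdb₁ : b₁ ∉ C := hd (by simp)
  have hdb₂ : b₂ ∉ C := hd (by simp)
  have hdK : ∀ a ∈ K, a ∉ C := fun a ha => hd (by simp [ha])
  have hHU : insert x (insert b₁ (insert b₂ K)) ⊆ U := by
    simp [Finset.insert_subset_iff, h.left_mem, hb₁, hb₂, hKU]
  have hloss : ∀ w ∈ C, w ≠ y → (nbrs G {x, b₁, b₂} w).card + (nbrs G K w).card + 1 ≤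
      K.card + 1 + min 1 (nbrs G K w).card := by
    intro w hw hwy
    have hwU := hCU hw
    have hwx : w ≠ x := fun e => hdx (e ▸ hw)
    have hwK : w ∉ K := fun e => hdK w e hw
    have h3 : ({x, b₁, b₂} : Finset V).card = 3 :=
      Finset.card_eq_three.2 ⟨x, b₁, b₂, hxb₁.ne, hxb₂.ne, hb, rfl⟩
    have h4 : (nbrs G {x, b₁, b₂} w).card ≤ 2 := by
      by_cases hwx' : G.Adj w x
      · have := card_nbrs_lt (G := G) (W := {x, b₁, b₂}) (v := w) (a := b₁) (by simp)
          fun e => htx w hwU b₁ hb₁ hwx'.symm hxb₁ e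
        omega
      · have := card_nbrs_lt (G := G) (W := {x, b₁, b₂}) (a := x) (by simp) hwx'
        omega
    have h5 := card_nbrs_le G K w
    by_cases h6 : G.Adj w b₁ ∨ G.Adj w b₂
    · obtain ⟨a, ha, hwa⟩ := hmax w hwU hwK hwx hwy h6
      have := card_nbrs_lt ha hwa
      omega
    · have h7 : (nbrs G {x, b₁, b₂} w).card ≤ ({x} : Finset V).card := by
        refine Finset.card_le_card fun a ha => ?_
        simp only [mem_nbrs, Finset.mem_insert, Finset.mem_singleton] at ha ⊢
        rcases ha with ⟨rfl | rfl | rfl, ha⟩ <;> tauto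
      rw [Finset.card_singleton] at h7
      omega
  have hH : ∀ s ∈ K, ∀ j < K.card + 1,
      PathIn G (2 + j * 1) (insert x (insert b₁ (insert b₂ K))) x s := by
    intro s hs j hj
    by_cases hjK : j < K.card
    · have h3 : PathIn G (1 + j) (insert b₁ K) b₁ s := pathIn_clique (isClique_insert hK hbK₁)
        (by simp) (by simp [hs]) (fun e : b₁ = s => hbnK₁ (e ▸ hs)) (by omega)
        (by rw [Finset.card_insert_of_notMem hbnK₁]; omega)
      refine (show 2 + j * 1 = 1 + j + 1 by omega) ▸ h3.cons' hxb₁ (by simp [hxb₁.ne, hxK])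
        (by simp) fun v hv => ?_
      simp only [Finset.mem_insert] at hv ⊢
      tauto
    · obtain ⟨a', ha', haa'⟩ := exists_mem_ne_of_card s (A := K) h2
      have hc := Finset.card_erase_add_one ha'
      have h3 : PathIn G (K.card - 1) (insert b₂ (K.erase a')) b₂ s :=
        pathIn_clique (isClique_insert (fun a ha b hb => hK a (Finset.mem_of_mem_erase ha) b
          (Finset.mem_of_mem_erase hb)) fun a ha => hbK₂ a (Finset.mem_of_mem_erase ha))
          (by simp) (by simp [hs, haa'.symm]) (fun e : b₂ = s => hbnK₂ (e ▸ hs)) (by omega)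
          (by rw [Finset.card_insert_of_notMem (by simp [hbnK₂])]; omega)
      have h4 : a' ≠ b₂ := fun e => hbnK₂ (e ▸ ha')
      refine (show 2 + j * 1 = K.card - 1 + 1 + 1 + 1 by omega) ▸
        (((h3.cons (hbK₂ a' ha').symm (by simp [h4])).cons (hbK₁ a' ha') ?_).cons'
          hxb₁ ?_ (by simp) fun v hv => ?_)
      · have h5 : b₁ ≠ a' := fun e => hbnK₁ (e ▸ ha')
        simp [hb, h5, hbnK₁]
      · have h5 : x ≠ a' := fun e => hxK (e ▸ ha')
        simp [hxb₁.ne, hxb₂.ne, h5, hxK]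
      · simp only [Finset.mem_insert, Finset.mem_erase] at hv ⊢
        rcases hv with rfl | rfl | rfl | hv <;> tauto
  rcases h.step hT hCU hC hyC hHU hHC (by simp) (S := K) (D := {x, b₁, b₂})
    (fun a ha => by simp [ha]) ⟨a₀, ha₀⟩ hxK
    (fun u hu v hv huv => by
      have := hcl u hu v hv huv
      simp only [Finset.mem_insert, Finset.mem_singleton] at this ⊢
      tauto)
    ⟨e, (hcl y hyC e heU hye).resolve_right (by simp [hex, heb₁, heb₂, heK]), hye.ne', hex⟩
    (by omega) (Or.inl rfl) hloss hH with
    h1 | ⟨X, hXC, hne, hyX, q, hqC, hqX, hN⟩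
  · exact h1
  have hloss' : ∀ w ∈ X, (nbrs G {x} w).card + (nbrs G {b₁, b₂} w).card + 1 ≤
      2 + min 1 (nbrs G {b₁, b₂} w).card := by
    intro w hw
    have h3 := card_nbrs_le G {b₁, b₂} w
    have h4 := card_nbrs_le G {x} w
    rw [Finset.card_pair hb] at h3
    rw [Finset.card_singleton] at h4
    by_cases h0 : (nbrs G {b₁, b₂} w).card = 0
    · omega
    obtain ⟨b, hb, hwb⟩ := exists_adj_of_card_nbrs_ne_zero h0
    have h5 : (nbrs G {x} w).card = 0 := by
      refine card_nbrs_eq_zero fun a ha hwa => ?_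
      obtain rfl := Finset.mem_singleton.1 ha
      simp only [Finset.mem_insert, Finset.mem_singleton] at hb
      rcases hb with rfl | rfl
      exacts [htx w (hCU (hXC hw)) b hb₁ hwa.symm hxb₁ hwb,
        htx w (hCU (hXC hw)) b hb₂ hwa.symm hxb₂ hwb]
    omega
  have hpath : ∀ b b' : V, b ∈ ({b₁, b₂} : Finset V) → b' ∈ ({b₁, b₂} : Finset V) → b' ≠ b →
      ∀ j < 2, PathIn G (3 + j * 1) (insert x (insert b₁ (insert b₂ K))) x b := by
    intro b b' hb hb' hbb' j hj
    have hprop : ∀ c ∈ ({b₁, b₂} : Finset V), G.Adj x c ∧ (∀ a ∈ K, G.Adj c a) ∧ c ∉ K := by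
      intro c hc
      simp only [Finset.mem_insert, Finset.mem_singleton] at hc
      rcases hc with rfl | rfl
      exacts [⟨hxb₁, hbK₁, hbnK₁⟩, ⟨hxb₂, hbK₂, hbnK₂⟩]
    obtain ⟨h3, h4, h5⟩ := hprop b hb
    obtain ⟨h6, h7, h8⟩ := hprop b' hb'
    have h9 : PathIn G (1 + j) (insert b K) a₀ b := pathIn_clique (isClique_insert hK h4)
      (by simp [ha₀]) (by simp) (fun e : a₀ = b => h5 (e ▸ ha₀)) (by omega)
      (by rw [Finset.card_insert_of_notMem h5]; omega)
    refine (show 3 + j * 1 = 1 + j + 1 + 1 by omega) ▸ (h9.cons (h7 a₀ ha₀) (by simp [hbb', h8])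
      ).cons' h6 (by simp [h6.ne, h3.ne, hxK]) (by simp) fun v hv => ?_
    simp only [Finset.mem_insert, Finset.mem_singleton] at hv hb hb' ⊢
    rcases hv with rfl | rfl | hv <;> tauto
  have hH' : ∀ s ∈ ({b₁, b₂} : Finset V), ∀ j < 2,
      PathIn G (3 + j * 1) (insert x (insert b₁ (insert b₂ K))) x s := by
    intro s hs
    by_cases hs₁ : s = b₁
    · exact hpath s b₂ hs (by simp) (fun e => hb (hs₁.symm.trans e.symm))
    · exact hpath s b₁ hs (by simp) (Ne.symm hs₁)
  rcases h.step_piece hT hCU hC hyC hHU hHC (by simp) (S := {b₁, b₂}) (D := {x})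
    (by simp [Finset.insert_subset_iff]) (by simp) (by simp)
    (by simp [hxb₁.ne, hxb₂.ne]) hXC hne hyX hqC hqX
    (fun u hu v hv huv => by
      have := hN u hu v hv huv
      simp only [Finset.mem_insert, Finset.mem_singleton] at this ⊢
      tauto) (by omega) (Or.inl rfl) hloss' hH' with h1 | ⟨X', hX', hne', q', hq', hqX', hN'⟩
  · exact h1
  · refine h.of_piece' hT ((hX'.trans hXC).trans hCU) hne' (fun e => hdx (hXC (hX' e)))
      (fun e => hyX (hX' e)) (fun u hu v hv huv => by simpa using hN' u hu v hv huv)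
      ⟨a₀, hKU ha₀, fun e => hdK a₀ ha₀ (hXC (hX' e)), fun e => hxK (e ▸ ha₀),
        fun e => hdK a₀ ha₀ (e ▸ hq')⟩

end CliquesInNeighbourhood

section TrianglesInNeighbourhood

variable {V : Type*} [DecidableEq V] {G : SimpleGraph V} {U : Finset V} {x y : V} {k : ℕ}

/-- A neighbour of `x` lies in a triangle. -/
theorem RootedHyp.of_nbr_triangle (h : RootedHyp G U x y x k) (hT : RootedBelow V U.card)
    (hk : 3 ≤ k) (hna : ¬ G.Adj x y)
    (htx : ∀ a ∈ U, ∀ b ∈ U, G.Adj x a → G.Adj x b → ¬ G.Adj a b)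
    (hty : ∀ a ∈ U, ∀ b ∈ U, G.Adj y a → G.Adj y b → ¬ G.Adj a b)
    {b c d : V} (hb : b ∈ U) (hc : c ∈ U) (hd : d ∈ U) (hxb : G.Adj x b) (hbc : G.Adj b c)
    (hbd : G.Adj b d) (hcd : G.Adj c d) : AdmPaths G U x y k := by
  classical
  obtain ⟨K, hK', hmax⟩ := (U.powerset.filter fun K =>
    (∀ a ∈ K, ∀ b ∈ K, a ≠ b → G.Adj a b) ∧ x ∉ K ∧ y ∉ K ∧
      ∃ b ∈ U, G.Adj x b ∧ ∀ a ∈ K, G.Adj b a).exists_max_image Finset.card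
    ⟨∅, by simpa using ⟨b, hb, hxb⟩⟩
  simp only [Finset.mem_filter, Finset.mem_powerset] at hK' hmax
  obtain ⟨hKU, hK, hxK, hyK, b₀, hb₀, hxb₀, hbK₀⟩ := hK'
  have h2 : 2 ≤ K.card := by
    have h1 := hmax {c, d} ⟨by simp [Finset.insert_subset_iff, hc, hd], ?_, ?_, ?_, b, hb, hxb,
      by simp [hbc, hbd]⟩
    · rwa [Finset.card_pair hcd.ne] at h1
    · intro e he f hf hef
      simp only [Finset.mem_insert, Finset.mem_singleton] at he hf
      rcases he with rfl | rfl <;> rcases hf with rfl | rfl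
      exacts [absurd rfl hef, hcd, hcd.symm, absurd rfl hef]
    · simp only [Finset.mem_insert, Finset.mem_singleton]
      rintro (rfl | rfl)
      exacts [htx b hb d hd hxb hcd hbd, htx b hb c hc hxb hcd.symm hbc]
    · simp only [Finset.mem_insert, Finset.mem_singleton]
      rintro (rfl | rfl)
      exacts [hty b hb d hd hbc.symm hcd hbd, hty b hb c hc hbd.symm hcd.symm hbc]
  have hmax' : ∀ b ∈ U, G.Adj x b → (∀ a ∈ K, G.Adj b a) → ∀ w ∈ U, w ∉ K → w ≠ x → w ≠ y →
      G.Adj w b → ∃ a ∈ K, ¬ G.Adj w a := by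
    intro b hb hxb hbK w hw hwK hwx hwy hwb
    by_contra! hcon
    have h1 := hmax (insert w K) ⟨Finset.insert_subset hw hKU, isClique_insert hK hcon,
      by simp [hwx.symm, hxK], by simp [hwy.symm, hyK], b, hb, hxb, by simpa using ⟨hwb.symm, hbK⟩⟩
    rw [Finset.card_insert_of_notMem hwK] at h1
    omega
  by_cases hone : ∀ b ∈ U, G.Adj x b → (∀ a ∈ K, G.Adj b a) → b = b₀
  · refine h.of_clique_one hT hk hna htx hty hKU hK hxK hyK h2 hb₀ hxb₀ hbK₀
      fun w hw hwK hwx hwy hwb hor => ?_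
    rcases hor with h1 | h1
    · by_contra! hcon
      exact hwb (hone w hw h1.symm hcon)
    · exact hmax' b₀ hb₀ hxb₀ hbK₀ w hw hwK hwx hwy h1
  push Not at hone
  obtain ⟨b₁, hb₁, hxb₁, hbK₁, hb₁₀⟩ := hone
  have hstep : ∀ b ∈ U, G.Adj x b → (∀ a ∈ K, G.Adj b a) → b ≠ b₀ →
      (∃ e ∈ U, G.Adj y e ∧ e ≠ b₀ ∧ e ≠ b ∧ e ∉ K) → AdmPaths G U x y k := by
    intro b hb hxb hbK hbb₀ hy
    refine h.of_clique_two hT hna htx hKU hK hxK hyK h2 hbb₀.symm hb₀ hb hxb₀ hxb hbK₀ hbK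
      (fun w hw hwK hwx hwy hor => ?_) hy
    rcases hor with h1 | h1
    exacts [hmax' b₀ hb₀ hxb₀ hbK₀ w hw hwK hwx hwy h1, hmax' b hb hxb hbK w hw hwK hwx hwy h1]
  by_contra hadm
  have hNy : ∀ e ∈ U, G.Adj y e → e = b₀ ∨ e = b₁ ∨ e ∈ K := by
    intro e he hye
    by_contra! hcon
    exact hadm (hstep b₁ hb₁ hxb₁ hbK₁ hb₁₀ ⟨e, he, hye, hcon⟩)
  obtain ⟨a₀, ha₀, a₁, ha₁, ha₀₁⟩ := Finset.one_lt_card.1 (by omega : 1 < K.card)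
  have hKx : ∀ a ∈ K, a ≠ x ∧ a ≠ y := fun a ha => ⟨fun e => hxK (e ▸ ha), fun e => hyK (e ▸ ha)⟩
  obtain ⟨e, he, f, hf, hef, hye, hyf⟩ := (h.exists_two_nbrs hT (hKU ha₀) (hKU ha₁) ha₀₁
    (hKx a₀ ha₀).1 (hKx a₀ ha₀).2 (hKx a₁ ha₁).1 (hKx a₁ ha₁).2).resolve_left hadm
  have hefn := hty e he f hf hye hyf
  have heK : ∀ e ∈ U, ∀ f ∈ U, e ≠ f → G.Adj y e → G.Adj y f → e ∉ K := by
    intro e he f hf hef hye hyf heK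
    refine hty e he f hf hye hyf ?_
    rcases hNy f hf hyf with rfl | rfl | hfK
    exacts [(hbK₀ e heK).symm, (hbK₁ e heK).symm, hK e heK f hfK hef]
  have heb := (hNy e he hye)
  have hfb := (hNy f hf hyf)
  have heK' := heK e he f hf hef hye hyf
  have hfK' := heK f hf e he hef.symm hyf hye
  obtain ⟨hyb₀, hyb₁⟩ : G.Adj y b₀ ∧ G.Adj y b₁ := by
    rcases heb with rfl | rfl | h1
    · rcases hfb with rfl | rfl | h1
      exacts [absurd rfl hef, ⟨hye, hyf⟩, absurd h1 hfK']
    · rcases hfb with rfl | rfl | h1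
      exacts [⟨hyf, hye⟩, absurd rfl hef, absurd h1 hfK']
    · exact absurd h1 heK'
  have hNy' : ∀ v ∈ U, G.Adj y v → v = b₀ ∨ v = b₁ := by
    intro v hv hyv
    rcases hNy v hv hyv with rfl | rfl | hvK
    · exact Or.inl rfl
    · exact Or.inr rfl
    · refine absurd hvK ?_
      by_cases hvb : v = b₀
      · exact hvb ▸ heK b₀ hb₀ b₁ hb₁ hb₁₀.symm hyb₀ hyb₁
      · exact heK v hv b₀ hb₀ hvb hyv hyb₀
  by_cases hx : ∃ e ∈ U, G.Adj x e ∧ e ≠ b₀ ∧ e ≠ b₁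
  · obtain ⟨g, hg, hxg, hgb₀, hgb₁⟩ := hx
    refine hadm (h.swap.of_clique_two hT (fun e => hna e.symm) hty hKU hK hyK hxK h2 hb₁₀.symm hb₀
      hb₁ hyb₀ hyb₁ hbK₀ hbK₁ (fun w hw hwK hwy hwx hor => ?_) ⟨g, hg, hxg, hgb₀, hgb₁,
        fun hgK => htx b₀ hb₀ g hg hxb₀ hxg (hbK₀ g hgK)⟩).symm
    rcases hor with h1 | h1
    exacts [hmax' b₀ hb₀ hxb₀ hbK₀ w hw hwK hwx hwy h1, hmax' b₁ hb₁ hxb₁ hbK₁ w hw hwK hwx hwy h1]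
  · push Not at hx
    refine hadm (h.of_twin_two hT hb₁₀.symm hb₀ hb₁ hxb₀ hyb₁ (fun v hv hxv => ?_) hNy' hxb₁.ne'
      hyb₀.ne' ⟨a₀, hKU ha₀, (hKx a₀ ha₀).1, (hKx a₀ ha₀).2, (hbK₀ a₀ ha₀).ne',
        (hbK₁ a₀ ha₀).ne'⟩)
    by_contra! hcon
    exact hcon.2 (hx v hv hxv hcon.1)

end TrianglesInNeighbourhood

section RootedBicliques

variable {V : Type*} [DecidableEq V] {G : SimpleGraph V} {U : Finset V} {x y : V} {k : ℕ}

/-- Recursion along a biclique `(A ∪ {x}, B)` with `B ⊆ N(x)` when `y` has a neighbour outside. -/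
theorem RootedHyp.of_biclique (h : RootedHyp G U x y x k) (hT : RootedBelow V U.card)
    (hk : 3 ≤ k) (hna : ¬ G.Adj x y)
    (htx : ∀ a ∈ U, ∀ b ∈ U, G.Adj x a → G.Adj x b → ¬ G.Adj a b)
    (hbx : ∀ b ∈ U, ∀ c ∈ U, ∀ d ∈ U, G.Adj x b → G.Adj b c → G.Adj b d → ¬ G.Adj c d)
    {A B : Finset V} (hAU : A ⊆ U) (hxA : x ∉ A) (hyA : y ∉ A)
    (hB : ∀ b, b ∈ B ↔ b ∈ U ∧ G.Adj x b ∧ ∀ a ∈ A, G.Adj b a) (hAB : A.card + 1 ≤ B.card)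
    (hmax : ∀ w ∈ U, w ≠ x → w ≠ y → w ∉ A → (nbrs G B w).card ≤ A.card + 1)
    (hy : ∃ v ∈ U, G.Adj y v ∧ v ∉ A ∧ v ∉ B) : AdmPaths G U x y k := by
  have hBU : B ⊆ U := fun b hb => ((hB b).1 hb).1
  have hxB : x ∉ B := fun e => G.irrefl ((hB x).1 e).2.1
  have hyB : y ∉ B := fun e => hna ((hB y).1 e).2.1
  obtain ⟨b₀, hb₀⟩ : B.Nonempty := Finset.card_pos.1 (by omega)
  have hdis : Disjoint (insert x A) B := by
    rw [Finset.disjoint_left]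
    intro a ha hb
    rw [Finset.mem_insert] at ha
    rcases ha with rfl | ha
    exacts [hxB hb, G.irrefl (((hB a).1 hb).2.2 a ha)]
  have hadj : ∀ a ∈ insert x A, ∀ b ∈ B, G.Adj a b := by
    intro a ha b hb
    rw [Finset.mem_insert] at ha
    rcases ha with rfl | ha
    exacts [((hB b).1 hb).2.1, (((hB b).1 hb).2.2 a ha).symm]
  have hcA : (insert x A).card = A.card + 1 := Finset.card_insert_of_notMem hxA
  obtain ⟨v, hv, hyv, hvA, hvB⟩ := hy
  have hvx : v ≠ x := fun e => hna (e ▸ hyv.symm)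
  obtain ⟨C, hCU, hyC, hHC, hC, hcl⟩ := exists_component_sdiff (U := U) (H := insert x A ∪ B) G
    h.right_mem (by simp [h.ne.symm, hyA, hyB])
  have hHC' := Finset.disjoint_left.1 hHC
  have hHU : insert x A ∪ B ⊆ U :=
    Finset.union_subset (Finset.insert_subset h.left_mem hAU) hBU
  have hvC : v ∈ C := by
    have := hcl y hyC v hv hyv
    simp only [Finset.mem_union, Finset.mem_insert] at this
    tauto
  have hxC : x ∉ C := hHC' (by simp)
  have hAC : ∀ w ∈ C, w ∉ A := fun w hw hwA => hHC' (by simp [hwA]) hw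
  have hBC : ∀ w ∈ C, w ∉ B := fun w hw hwB => hHC' (by simp [hwB]) hw
  have hxw : ∀ w ∈ C, G.Adj x w → (nbrs G A w).card + 1 ≤ A.card := by
    intro w hw hxw
    obtain ⟨a, ha, hwa⟩ : ∃ a ∈ A, ¬ G.Adj w a := by
      by_contra! hcon
      exact hBC w hw ((hB w).2 ⟨hCU hw, hxw, hcon⟩)
    exact card_nbrs_lt ha hwa
  have hnx : ∀ w, ¬ G.Adj x w → (nbrs G {x} w).card = 0 := fun w hw =>
    card_nbrs_eq_zero (by simpa using fun e => hw e.symm)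
  have hloss : ∀ w ∈ C, w ≠ y → (nbrs G (insert x A) w).card + (nbrs G B w).card + 1 ≤
      (A.card + 1) + min 1 (nbrs G B w).card := by
    intro w hw hwy
    have hwU := hCU hw
    by_cases hwB : (nbrs G B w).card = 0
    · have h1 : (nbrs G (insert x A) w).card ≤ (nbrs G {x} w).card + (nbrs G A w).card := by
        rw [Finset.insert_eq]
        exact card_nbrs_union_le
      have h2 := card_nbrs_le G A w
      by_cases h3 : G.Adj x w
      · have h4 := hxw w hw h3
        have h5 := card_nbrs_le G {x} w
        rw [Finset.card_singleton] at h5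
        omega
      · have := hnx w h3
        omega
    · obtain ⟨b, hb, hwb⟩ := exists_adj_of_card_nbrs_ne_zero hwB
      have hb' := (hB b).1 hb
      have h1 : (nbrs G (insert x A) w).card = 0 := by
        refine card_nbrs_eq_zero fun a ha hwa => ?_
        rw [Finset.mem_insert] at ha
        rcases ha with rfl | ha
        · exact htx w hwU b hb'.1 hwa.symm hb'.2.1 hwb
        · exact hbx b hb'.1 w hwU a (hAU ha) hb'.2.1 hwb.symm (hb'.2.2 a ha) hwa
      have := hmax w hwU (fun e : w = x => hxC (e ▸ hw)) hwy (hAC w hw)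
      omega
  rcases h.step hT (S := B) (D := insert x A) (p := A.card + 1) (c := 1) (d := 2) hCU hC hyC hHU
    hHC (by simp) Finset.subset_union_right ⟨b₀, hb₀⟩ hxB (fun u hu w hw huw => by
      have := hcl u hu w hw huw
      rw [Finset.mem_union] at this
      tauto) ⟨v, hvC, hyv.ne', hvx⟩ (by omega) (Or.inr rfl) hloss (fun b hb j hj => by
      have := pathIn_biclique_odd hdis hadj (Finset.mem_insert_self x A) hb (j := j) (by omega)
        (by omega)
      exact (show 2 * j + 1 = 1 + j * 2 by omega) ▸ this)
    with h1 | ⟨X, hXC, hne, hyX, q, hq, hqX, hN⟩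
  · exact h1
  have hbq : ∀ q ∈ C, b₀ ≠ q := fun q hq e => hBC q hq (e ▸ hb₀)
  have hb₀x : b₀ ≠ x := fun e => hxB (e ▸ hb₀)
  have hb₀C : b₀ ∉ C := fun e => hBC b₀ e hb₀
  have hone : ∀ X ⊆ C, X.Nonempty → y ∉ X → ∀ q ∈ C, q ∉ X →
      (∀ u ∈ X, ∀ v ∈ U, G.Adj u v → v ∈ X ∨ v = x ∨ v = q) → AdmPaths G U x y k :=
    fun X hXC hne hyX q hq hqX hN => h.of_piece' hT (hXC.trans hCU) hne (fun e => hxC (hXC e)) hyX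
      hN ⟨b₀, hBU hb₀, fun e => hb₀C (hXC e), hb₀x, hbq q hq⟩
  rcases Nat.lt_or_ge A.card 2 with h2 | h2
  · rcases Nat.lt_or_ge A.card 1 with h3 | h3
    · refine hone X hXC hne hyX q hq hqX fun u hu w hw huw => ?_
      have := hN u hu w hw huw
      rw [Finset.card_eq_zero.1 (by omega : A.card = 0)] at this
      simpa using this
    · obtain ⟨a, rfl⟩ := Finset.card_eq_one.1 (by omega : A.card = 1)
      have hax : a ≠ x := fun e => hxA (by simp [e])
      have hp := pathIn_biclique_even hdis.symm (fun b hb a ha => (hadj a ha b hb).symm)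
        (Finset.mem_insert_self x {a}) (b' := a) (by simp) hax.symm (j := 1) le_rfl (by omega)
        (by omega)
      refine h.of_three_cut hT hk hna hCU hC hyC hHU hHC (hp.mono (by
        rw [Finset.union_comm])) hax hXC hne hyX hq hqX (fun u hu w hw huw => ?_)
        ⟨b₀, hBU hb₀, hb₀C, hb₀x, fun e => hdis.forall_ne_finset (a := a) (by simp) hb₀ e.symm⟩
      have := hN u hu w hw huw
      simp only [Finset.mem_insert, Finset.mem_singleton] at this
      tauto
  · rcases h.step_piece hT (S := A) (D := {x}) (p := A.card) (c := 2) (d := 2) hCU hC hyC hHU hHC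
      (by simp) (fun a ha => by simp [ha]) (by simp) (Finset.card_pos.1 (by omega)) hxA hXC hne hyX
      hq hqX (fun u hu w hw huw => by
        have := hN u hu w hw huw
        simp only [Finset.mem_insert, Finset.mem_singleton] at this ⊢
        tauto) (by omega) (Or.inr rfl) (fun w hw => by
        have h1 := card_nbrs_le G A w
        by_cases h3 : G.Adj x w
        · have h4 := hxw w (hXC hw) h3
          have h5 := card_nbrs_le G {x} w
          rw [Finset.card_singleton] at h5
          omega
        · have := hnx w h3
          omega) (fun a ha j hj => by
        have := pathIn_biclique_even hdis.symm (fun b hb a ha => (hadj a ha b hb).symm)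
          (Finset.mem_insert_self x A) (b' := a) (by simp [ha]) (fun e => hxA (e ▸ ha)) (j := j + 1)
          (by omega) (by omega) (by omega)
        rw [Finset.union_comm]
        exact (show 2 * (j + 1) = 2 + j * 2 by omega) ▸ this) with
      h1 | ⟨X', hX', hne', q', hq', hqX', hN'⟩
    · exact h1
    · exact hone X' (hX'.trans hXC) hne' (fun e => hyX (hX' e)) q' hq' hqX' fun u hu w hw huw => by
        simpa using hN' u hu w hw huw

end RootedBicliques

section RootedTwinBicliques

variable {V : Type*} [DecidableEq V] {G : SimpleGraph V} {U : Finset V} {x y : V} {k : ℕ}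

theorem ConnOn.insert {C : Finset V} {u v : V} (hC : ConnOn G C) (hu : u ∈ C) (huv : G.Adj u v) :
    ConnOn G (insert v C) := by
  intro X hX hne hz
  by_cases hvX : v ∈ X
  · by_cases hCX : C ⊆ X
    · obtain ⟨z, hz, hzX⟩ := hz
      rw [Finset.mem_insert] at hz
      rcases hz with rfl | hz
      exacts [absurd hvX hzX, absurd (hCX hz) hzX]
    · by_cases huX : u ∈ X
      · obtain ⟨w, hw, hwX⟩ := Finset.not_subset.1 hCX
        obtain ⟨a, ha, b, hb, hbX, hab⟩ := hC (X ∩ C) Finset.inter_subset_right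
          ⟨u, Finset.mem_inter.2 ⟨huX, hu⟩⟩ ⟨w, hw, fun e => hwX (Finset.mem_inter.1 e).1⟩
        exact ⟨a, (Finset.mem_inter.1 ha).1, b, Finset.mem_insert_of_mem hb,
          fun e => hbX (Finset.mem_inter.2 ⟨e, hb⟩), hab⟩
      · exact ⟨v, hvX, u, Finset.mem_insert_of_mem hu, huX, huv.symm⟩
  · have hXC : X ⊆ C := fun a ha => (Finset.mem_insert.1 (hX ha)).resolve_left
      fun e => hvX (e ▸ ha)
    by_cases huX : u ∈ X
    · exact ⟨u, huX, v, Finset.mem_insert_self v C, hvX, huv⟩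
    · obtain ⟨a, ha, b, hb, hbX, hab⟩ := hC X hXC hne ⟨u, hu, huX⟩
      exact ⟨a, ha, b, Finset.mem_insert_of_mem hb, hbX, hab⟩

set_option maxHeartbeats 800000 in
/-- Both roots have the same neighbourhood `N`, which is complete to `A`. -/
theorem RootedHyp.of_twin_biclique (h : RootedHyp G U x y x k) (hT : RootedBelow V U.card)
    (hk : 3 ≤ k) (hna : ¬ G.Adj x y)
    (htx : ∀ a ∈ U, ∀ b ∈ U, G.Adj x a → G.Adj x b → ¬ G.Adj a b)
    (hbx : ∀ b ∈ U, ∀ c ∈ U, ∀ d ∈ U, G.Adj x b → G.Adj b c → G.Adj b d → ¬ G.Adj c d)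
    {A N : Finset V} (hAU : A ⊆ U) (hxA : x ∉ A) (hyA : y ∉ A)
    (hNx : ∀ b, b ∈ N ↔ b ∈ U ∧ G.Adj x b) (hNy : ∀ b, b ∈ N ↔ b ∈ U ∧ G.Adj y b)
    (hadj : ∀ a ∈ A, ∀ b ∈ N, G.Adj a b) (hAN : A.card + 2 ≤ N.card)
    (hmax : ∀ w ∈ U, w ≠ x → w ≠ y → w ∉ A → (nbrs G N w).card ≤ A.card + 1 ∨
      N.card = A.card + 2) : AdmPaths G U x y k := by
  have hNU : N ⊆ U := fun b hb => ((hNx b).1 hb).1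
  have hxN : x ∉ N := fun e => G.irrefl ((hNx x).1 e).2
  have hyN : y ∉ N := fun e => hna ((hNx y).1 e).2
  obtain ⟨b₀, hb₀⟩ : N.Nonempty := Finset.card_pos.1 (by omega)
  have hNN : ∀ b ∈ N, ∀ c ∈ N, ¬ G.Adj b c := fun b hb c hc =>
    htx b (hNU hb) c (hNU hc) ((hNx b).1 hb).2 ((hNx c).1 hc).2
  have hdis : Disjoint (insert x A) N := by
    rw [Finset.disjoint_left]
    intro a ha hb
    rw [Finset.mem_insert] at ha
    rcases ha with rfl | ha
    exacts [hxN hb, hNN a hb a hb (hadj a ha a hb)]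
  have hadj' : ∀ a ∈ insert x A, ∀ b ∈ N, G.Adj a b := by
    intro a ha b hb
    rw [Finset.mem_insert] at ha
    rcases ha with rfl | ha
    exacts [((hNx b).1 hb).2, hadj a ha b hb]
  have hcA : (insert x A).card = A.card + 1 := Finset.card_insert_of_notMem hxA
  have hyxA : y ∉ insert x A := by simp [h.ne.symm, hyA]
  have hAy : ∀ a ∈ A, ¬ G.Adj y a := fun a ha e =>
    Finset.disjoint_left.1 hdis (Finset.mem_insert_of_mem ha) ((hNy a).2 ⟨hAU ha, e⟩)
  by_cases hF : ∃ r ∈ U, r ∉ insert y (insert x A) ∪ N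
  · obtain ⟨r, hr, hrH⟩ := hF
    obtain ⟨C, hCU, hrC, hHC, hC, hcl⟩ := exists_component_sdiff G hr hrH
    have hHC' := Finset.disjoint_left.1 hHC
    have hxC : x ∉ C := hHC' (by simp)
    have hyC : y ∉ C := hHC' (by simp)
    have hAC : ∀ w ∈ A, w ∉ C := fun w hw => hHC' (by simp [hw])
    have hNC : ∀ w ∈ N, w ∉ C := fun w hw => hHC' (by simp [hw])
    have hcl' : ∀ u ∈ C, ∀ v ∈ U, G.Adj u v → v ∈ C ∨ v ∈ A ∨ v ∈ N := by
      intro u hu v hv huv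
      have h1 := hcl u hu v hv huv
      have h2 : v ≠ x := fun e => hNC u ((hNx u).2 ⟨hCU hu, e ▸ huv.symm⟩) hu
      have h3 : v ≠ y := fun e => hNC u ((hNy u).2 ⟨hCU hu, e ▸ huv.symm⟩) hu
      simp only [Finset.mem_union, Finset.mem_insert] at h1
      tauto
    by_cases hq : ∃ u ∈ C, ∃ q ∈ N, G.Adj u q
    · obtain ⟨u₀, hu₀, q, hq, huq⟩ := hq
      have hcN : (N.erase q).card = N.card - 1 := Finset.card_erase_of_mem hq
      obtain ⟨b₁, hb₁⟩ : (N.erase q).Nonempty := Finset.card_pos.1 (by omega)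
      have hxq : x ≠ q := fun e => hxN (e ▸ hq)
      have hyq : y ≠ q := fun e => hyN (e ▸ hq)
      have hC' : ConnOn G (insert y (insert q C)) :=
        (ConnOn.insert hC hu₀ huq).insert (Finset.mem_insert_self q C) ((hNy q).1 hq).2.symm
      have hCU' : insert y (insert q C) ⊆ U := by
        simp [Finset.insert_subset_iff, h.right_mem, hNU hq, hCU]
      have hsub : insert x A ∪ N.erase q ⊆ insert y (insert x A) ∪ N :=
        Finset.union_subset_union (Finset.subset_insert _ _) (Finset.erase_subset _ _)
      have hqA : q ∉ insert x A := fun e => Finset.disjoint_left.1 hdis e hq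
      have hHC₁ : Disjoint (insert x A ∪ N.erase q) (insert y (insert q C)) := by
        rw [Finset.disjoint_insert_right, Finset.disjoint_insert_right]
        refine ⟨?_, ?_, hHC.mono_left hsub⟩
        · simp only [Finset.mem_union, Finset.mem_erase]
          tauto
        · rw [Finset.mem_union, Finset.mem_erase]
          tauto
      have hHU : insert x A ∪ N.erase q ⊆ U :=
        Finset.union_subset (Finset.insert_subset h.left_mem hAU)
          ((Finset.erase_subset _ _).trans hNU)
      have hdis' : Disjoint (insert x A) (N.erase q) := hdis.mono_right (Finset.erase_subset _ _)
      have hadj₁ : ∀ a ∈ insert x A, ∀ b ∈ N.erase q, G.Adj a b := fun a ha b hb =>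
        hadj' a ha b (Finset.mem_of_mem_erase hb)
      have hXC : C ⊆ insert y (insert q C) :=
        (Finset.subset_insert _ _).trans (Finset.subset_insert _ _)
      rcases h.step_piece hT (S := N.erase q) (D := A) (p := A.card + 1) (c := 1) (d := 2)
        hCU' hC' (by simp) hHU hHC₁ (by simp) Finset.subset_union_right
        ((Finset.subset_insert x A).trans Finset.subset_union_left) ⟨b₁, hb₁⟩
        (fun e => hxN (Finset.mem_of_mem_erase e)) hXC ⟨r, hrC⟩ hyC (by simp) (hNC q hq)
        (fun u hu v hv huv => by
          have := hcl' u hu v hv huv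
          rw [Finset.mem_erase]
          tauto) (by omega) (Or.inr rfl) (fun w hw => by
          by_cases hwN : (nbrs G (N.erase q) w).card = 0
          · have := card_nbrs_le G A w
            omega
          · obtain ⟨b, hb, hwb⟩ := exists_adj_of_card_nbrs_ne_zero hwN
            have hb' := (hNx b).1 (Finset.mem_of_mem_erase hb)
            have h1 : (nbrs G A w).card = 0 := card_nbrs_eq_zero fun a ha hwa =>
              hbx b hb'.1 w (hCU hw) a (hAU ha) hb'.2 hwb.symm
                (hadj a ha b (Finset.mem_of_mem_erase hb)).symm hwa
            have h2 := card_nbrs_le G (N.erase q) w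
            have h3 := card_nbrs_mono (G := G) (v := w) (Finset.erase_subset q N)
            have := hmax w (hCU hw) (fun e : w = x => hxC (e ▸ hw)) (fun e : w = y => hyC (e ▸ hw))
              (fun e => hAC w e hw)
            omega) (fun b hb j hj => by
          have := pathIn_biclique_odd hdis' hadj₁ (Finset.mem_insert_self x A) hb
            (j := j) (by omega) (by omega)
          exact (show 2 * j + 1 = 1 + j * 2 by omega) ▸ this) with
        h1 | ⟨X, hX, hne, q', hq', hqX', hN⟩
      · exact h1
      have hxX : x ∉ X := fun e => hxC (hX e)
      have hyX : y ∉ X := fun e => hyC (hX e)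
      rcases Nat.eq_zero_or_pos A.card with h2 | h2
      · obtain ⟨u, hu, v, hv, hvX, hvq, huv⟩ := h.conn X (hX.trans hCU) hne hxX hyX q'
        have := hN u hu v hv huv
        rw [Finset.card_eq_zero.1 h2] at this
        simp only [Finset.notMem_empty] at this
        tauto
      rcases h.step_piece hT (S := A) (D := ∅) (p := A.card) (c := 2) (d := 2)
        hCU' hC' (by simp) hHU hHC₁ (by simp)
        ((Finset.subset_insert x A).trans Finset.subset_union_left) (by simp) (Finset.card_pos.1 h2)
        hxA (hX.trans hXC) hne hyX hq' hqX' (fun u hu v hv huv => by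
          have := hN u hu v hv huv
          tauto) h2 (Or.inr rfl) (fun w hw => by
          have h3 := card_nbrs_le G A w
          have h4 : (nbrs G ∅ w).card = 0 := card_nbrs_eq_zero (by simp)
          omega) (fun a ha j hj => by
          have := pathIn_biclique_even hdis'.symm (fun b hb a ha => (hadj₁ a ha b hb).symm)
            (Finset.mem_insert_self x A) (b' := a) (by simp [ha]) (fun e => hxA (e ▸ ha))
            (j := j + 1) (by omega) (by omega) (by omega)
          rw [Finset.union_comm]
          exact (show 2 * (j + 1) = 2 + j * 2 by omega) ▸ this) with
        h1 | ⟨X', hX', hne', q'', hq'', hqX'', hN'⟩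
      · exact h1
      obtain ⟨u, hu, v, hv, hvX, hvq, huv⟩ := h.conn X' (hX'.trans (hX.trans hCU)) hne'
        (fun e => hxX (hX' e)) (fun e => hyX (hX' e)) q''
      have := hN' u hu v hv huv
      simp only [Finset.notMem_empty] at this
      tauto
    · push Not at hq
      have hA' : ∀ q, ∃ u ∈ C, ∃ v ∈ A, v ≠ q ∧ G.Adj u v := by
        intro q
        obtain ⟨u, hu, v, hv, hvX, hvq, huv⟩ := h.conn C hCU ⟨r, hrC⟩ hxC hyC q
        have := hcl' u hu v hv huv
        have h2 : v ∉ N := fun e => hq u hu v e huv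
        exact ⟨u, hu, v, by tauto, hvq, huv⟩
      obtain ⟨u₀, hu₀, q, hqA, -, huq⟩ := hA' x
      obtain ⟨-, -, q₁, hqA₁, hqq₁, -⟩ := hA' q
      have hcA' : (A.erase q).card = A.card - 1 := Finset.card_erase_of_mem hqA
      have hpos : 0 < (A.erase q).card := Finset.card_pos.2 ⟨q₁, by simp [hqq₁, hqA₁]⟩
      have hxA' : x ∉ A.erase q := fun e => hxA (Finset.mem_of_mem_erase e)
      have hcA'' : (insert x (A.erase q)).card = A.card - 1 + 1 := by
        rw [Finset.card_insert_of_notMem hxA', hcA']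
      have hcN : (N.erase b₀).card = N.card - 1 := Finset.card_erase_of_mem hb₀
      have hqN : q ∉ N := fun e => Finset.disjoint_left.1 hdis (by simp [hqA]) e
      have hb₀A : b₀ ∉ insert x A := fun e => Finset.disjoint_left.1 hdis e hb₀
      have hyb : y ≠ b₀ := fun e => hyN (e ▸ hb₀)
      have hC' : ConnOn G (insert y (insert b₀ (insert q C))) :=
        ((ConnOn.insert hC hu₀ huq).insert (Finset.mem_insert_self q C) (hadj q hqA b₀ hb₀)).insert
          (Finset.mem_insert_self b₀ _) ((hNy b₀).1 hb₀).2.symm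
      have hCU' : insert y (insert b₀ (insert q C)) ⊆ U := by
        simp [Finset.insert_subset_iff, h.right_mem, hNU hb₀, hAU hqA, hCU]
      have hsub₁ : insert x (A.erase q) ⊆ insert x A :=
        Finset.insert_subset_insert _ (Finset.erase_subset _ _)
      have hsub : insert x (A.erase q) ∪ N.erase b₀ ⊆ insert y (insert x A) ∪ N :=
        Finset.union_subset_union (hsub₁.trans (Finset.subset_insert _ _)) (Finset.erase_subset _ _)
      have hdis' : Disjoint (insert x (A.erase q)) (N.erase b₀) :=
        (hdis.mono_left hsub₁).mono_right (Finset.erase_subset _ _)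
      have hadj₁ : ∀ a ∈ insert x (A.erase q), ∀ b ∈ N.erase b₀, G.Adj a b := fun a ha b hb =>
        hadj' a (hsub₁ ha) b (Finset.mem_of_mem_erase hb)
      have hHC₁ : Disjoint (insert x (A.erase q) ∪ N.erase b₀)
          (insert y (insert b₀ (insert q C))) := by
        rw [Finset.disjoint_insert_right, Finset.disjoint_insert_right,
          Finset.disjoint_insert_right]
        refine ⟨?_, ?_, ?_, hHC.mono_left hsub⟩
        · rw [Finset.mem_union, Finset.mem_erase]
          rintro (e | e)
          exacts [hyxA (hsub₁ e), hyN e.2]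
        · rw [Finset.mem_union, Finset.mem_erase]
          rintro (e | e)
          exacts [hb₀A (hsub₁ e), e.1 rfl]
        · simp only [Finset.mem_union, Finset.mem_erase, Finset.mem_insert]
          rintro ((e | e) | e)
          exacts [hxA (e ▸ hqA), e.1 rfl, hqN e.2]
      rcases h.step_piece hT (S := A.erase q) (D := ∅) (p := A.card - 1) (c := 2) (d := 2)
        hCU' hC' (by simp) (Finset.union_subset (hsub₁.trans (Finset.insert_subset h.left_mem hAU))
          ((Finset.erase_subset _ _).trans hNU)) hHC₁ (by simp)
        ((Finset.subset_insert x _).trans Finset.subset_union_left) (by simp)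
        (Finset.card_pos.1 hpos) hxA' (X := C) (q := q) (fun v hv => by simp [hv]) ⟨r, hrC⟩ hyC
        (by simp) (hAC q hqA) (fun u hu v hv huv => by
          have := hcl' u hu v hv huv
          have h2 : v ∉ N := fun e => hq u hu v e huv
          rw [Finset.mem_erase]
          tauto) (by omega) (Or.inr rfl) (fun w hw => by
          have h3 := card_nbrs_le G (A.erase q) w
          have h4 : (nbrs G ∅ w).card = 0 := card_nbrs_eq_zero (by simp)
          omega) (fun a ha j hj => by
          have := pathIn_biclique_even hdis'.symm (fun b hb a ha => (hadj₁ a ha b hb).symm)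
            (Finset.mem_insert_self x _) (b' := a) (by simpa using Or.inr ha)
            (fun e => hxA' (e ▸ ha))
            (j := j + 1) (by omega) (by omega) (by omega)
          rw [Finset.union_comm]
          exact (show 2 * (j + 1) = 2 + j * 2 by omega) ▸ this) with
        h1 | ⟨X', hX', hne', q'', hq'', hqX'', hN'⟩
      · exact h1
      obtain ⟨u, hu, v, hv, hvX, hvq, huv⟩ := h.conn X' (hX'.trans hCU) hne'
        (fun e => hxC (hX' e)) (fun e => hyC (hX' e)) q''
      have := hN' u hu v hv huv
      simp only [Finset.notMem_empty] at this
      tauto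
  · push Not at hF
    have hb₀x : b₀ ≠ x := fun e => hxN (e ▸ hb₀)
    have h1 := h.deg (by omega) b₀ (hNU hb₀) hb₀x (fun e => hyN (e ▸ hb₀)) hb₀x
    have hcY : (insert y (insert x A)).card = A.card + 2 := by
      rw [Finset.card_insert_of_notMem hyxA, hcA]
    have h2 : nbrs G U b₀ ⊆ insert y (insert x A) := by
      intro v hv
      rw [mem_nbrs] at hv
      have := hF v hv.1
      rw [Finset.mem_union] at this
      exact this.resolve_right fun e => hNN b₀ hb₀ v e hv.2
    have h3 := Finset.card_le_card h2
    have hadj₂ : ∀ b ∈ N, ∀ a ∈ insert y (insert x A), G.Adj b a := by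
      intro b hb a ha
      rw [Finset.mem_insert] at ha
      rcases ha with rfl | ha
      exacts [((hNy b).1 hb).2.symm, (hadj' a ha b hb).symm]
    have hdis₂ : Disjoint N (insert y (insert x A)) := by
      rw [Finset.disjoint_insert_right]
      exact ⟨hyN, hdis.symm⟩
    refine ⟨2, 2, Or.inr rfl, fun i hi => ⟨by omega, ?_⟩⟩
    have := pathIn_biclique_even hdis₂ hadj₂ (b := x) (b' := y) (by simp) (by simp) h.ne
      (j := i + 1) (by omega) (by omega) (by omega)
    refine (show 2 * (i + 1) = 2 + i * 2 by omega) ▸ this.mono (Finset.union_subset hNU ?_)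
    simp [Finset.insert_subset_iff, h.left_mem, h.right_mem, hAU]

end RootedTwinBicliques

section RootedMaximalBicliques

variable {V : Type*} [DecidableEq V] {G : SimpleGraph V} {U : Finset V} {x y : V} {k : ℕ}

theorem exists_maximal_biclique {b : V} (hb : b ∈ U) (hxb : G.Adj x b) :
    ∃ A B : Finset V, A ⊆ U ∧ x ∉ A ∧ y ∉ A ∧
      (∀ b, b ∈ B ↔ b ∈ U ∧ G.Adj x b ∧ ∀ a ∈ A, G.Adj b a) ∧ A.card + 1 ≤ B.card ∧
      ∀ w ∈ U, w ≠ x → w ≠ y → w ∉ A → (nbrs G B w).card ≤ A.card + 1 := by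
  classical
  let f : Finset V → Finset V := fun A => (nbrs G U x).filter fun b => ∀ a ∈ A, G.Adj b a
  obtain ⟨A, hA, hmax⟩ := (U.powerset.filter fun A =>
    x ∉ A ∧ y ∉ A ∧ A.card + 1 ≤ (f A).card).exists_max_image Finset.card
    ⟨∅, by
      simp only [Finset.mem_filter, Finset.mem_powerset, Finset.empty_subset, Finset.notMem_empty,
        not_false_eq_true, true_and, Finset.card_empty, zero_add]
      exact Finset.card_pos.2 ⟨b, by simp [f, mem_nbrs, hb, hxb]⟩⟩
  simp only [Finset.mem_filter, Finset.mem_powerset] at hA hmax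
  obtain ⟨hAU, hxA, hyA, hAB⟩ := hA
  refine ⟨A, f A, hAU, hxA, hyA, fun b => by simp [f, mem_nbrs, and_assoc], hAB,
    fun w hw hwx hwy hwA => ?_⟩
  by_contra! hcon
  have h1 : nbrs G (f A) w = f (insert w A) := by
    ext b
    simp only [f, mem_nbrs, Finset.mem_filter, Finset.forall_mem_insert, G.adj_comm w b]
    tauto
  have h2 := hmax (insert w A) ⟨Finset.insert_subset hw hAU, by simp [hwx.symm, hxA],
    by simp [hwy.symm, hyA], by rw [← h1, Finset.card_insert_of_notMem hwA]; omega⟩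
  rw [Finset.card_insert_of_notMem hwA] at h2
  omega

/-- A maximal biclique at `x` allows a recursion unless it contains all neighbours of `y`. -/
theorem RootedHyp.of_maximal_biclique (h : RootedHyp G U x y x k) (hT : RootedBelow V U.card)
    (hk : 3 ≤ k) (hna : ¬ G.Adj x y)
    (htx : ∀ a ∈ U, ∀ b ∈ U, G.Adj x a → G.Adj x b → ¬ G.Adj a b)
    (hty : ∀ a ∈ U, ∀ b ∈ U, G.Adj y a → G.Adj y b → ¬ G.Adj a b)
    (hbx : ∀ b ∈ U, ∀ c ∈ U, ∀ d ∈ U, G.Adj x b → G.Adj b c → G.Adj b d → ¬ G.Adj c d)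
    (hby : ∀ b ∈ U, ∀ c ∈ U, ∀ d ∈ U, G.Adj y b → G.Adj b c → G.Adj b d → ¬ G.Adj c d)
    {A B : Finset V} (hAU : A ⊆ U) (hxA : x ∉ A) (hyA : y ∉ A)
    (hB : ∀ b, b ∈ B ↔ b ∈ U ∧ G.Adj x b ∧ ∀ a ∈ A, G.Adj b a) (hAB : A.card + 1 ≤ B.card)
    (hmax : ∀ w ∈ U, w ≠ x → w ≠ y → w ∉ A → (nbrs G B w).card ≤ A.card + 1) :
    AdmPaths G U x y k ∨ ∀ v ∈ U, G.Adj y v → v ∈ B := by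
  by_cases hout : ∃ v ∈ U, G.Adj y v ∧ v ∉ A ∧ v ∉ B
  · exact Or.inl (h.of_biclique hT hk hna htx hbx hAU hxA hyA hB hAB hmax hout)
  refine or_iff_not_imp_right.2 fun hcon => ?_
  push Not at hout hcon
  obtain ⟨a₀, ha₀, hya₀, ha₀B⟩ := hcon
  have ha₀A : a₀ ∈ A := by
    by_contra e
    exact ha₀B (hout a₀ ha₀ hya₀ e)
  have hyAll : ∀ v ∈ U, G.Adj y v → v ∈ A := by
    intro v hv hyv
    by_contra e
    have h1 := hout v hv hyv e
    exact hty v hv a₀ ha₀ hyv hya₀ (((hB v).1 h1).2.2 a₀ ha₀A)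
  have hNA : nbrs G U y ⊆ A := fun v hv => hyAll v (mem_nbrs.1 hv).1 (mem_nbrs.1 hv).2
  have h1 := Finset.card_le_card hNA
  have h2 : 1 ≤ (nbrs G U y).card := Finset.card_pos.2 ⟨a₀, mem_nbrs.2 ⟨ha₀, hya₀⟩⟩
  have hBA : ∀ b ∈ B, b ∉ A := fun b hb e => G.irrefl (((hB b).1 hb).2.2 b e)
  obtain ⟨A', hA'B, hA'⟩ := Finset.exists_subset_card_eq
    (show (nbrs G U y).card - 1 ≤ B.card by omega)
  obtain ⟨b, hb, hbA'⟩ := Finset.exists_of_ssubset (Finset.ssubset_iff_subset_ne.2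
    ⟨hA'B, fun e => by rw [e] at hA'; omega⟩)
  have hb' := (hB b).1 hb
  refine (h.swap.of_biclique hT hk (fun e => hna e.symm) hty hby (A := A') (B := nbrs G U y)
    (fun v hv => ((hB v).1 (hA'B hv)).1) (fun e => hna ((hB y).1 (hA'B e)).2.1)
    (fun e => G.irrefl ((hB x).1 (hA'B e)).2.1) (fun v => ?_) (by omega) (fun w _ _ _ _ => ?_)
    ⟨b, hb'.1, hb'.2.1, hbA', fun e => hBA b hb (hNA e)⟩).symm
  · rw [mem_nbrs]
    refine ⟨fun e => ⟨e.1, e.2, fun c hc => ?_⟩, fun e => ⟨e.1, e.2.1⟩⟩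
    exact (((hB c).1 (hA'B hc)).2.2 v (hyAll v e.1 e.2)).symm
  · have := card_nbrs_le G (nbrs G U y) w
    omega

end RootedMaximalBicliques

section Rooted

variable {V : Type*} [DecidableEq V] {G : SimpleGraph V} {U : Finset V} {x y z : V} {k : ℕ}

theorem RootedHyp.admPaths_ge_three (h : RootedHyp G U x y x k) (hT : RootedBelow V U.card)
    (hk : 3 ≤ k) (hna : ¬ G.Adj x y) : AdmPaths G U x y k := by
  by_contra hadm
  have hna' : ¬ G.Adj y x := fun e => hna e.symm
  have hadm' : ¬ AdmPaths G U y x k := fun e => hadm e.symm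
  have htx : ∀ a ∈ U, ∀ b ∈ U, G.Adj x a → G.Adj x b → ¬ G.Adj a b :=
    fun a ha b hb hxa hxb hab => hadm (h.of_triangle hT hk hna ha hb hxa hxb hab)
  have hty : ∀ a ∈ U, ∀ b ∈ U, G.Adj y a → G.Adj y b → ¬ G.Adj a b :=
    fun a ha b hb hxa hxb hab => hadm' (h.swap.of_triangle hT hk hna' ha hb hxa hxb hab)
  have hbx : ∀ b ∈ U, ∀ c ∈ U, ∀ d ∈ U, G.Adj x b → G.Adj b c → G.Adj b d → ¬ G.Adj c d :=
    fun b hb c hc d hd hxb hbc hbd hcd =>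
      hadm (h.of_nbr_triangle hT hk hna htx hty hb hc hd hxb hbc hbd hcd)
  have hby : ∀ b ∈ U, ∀ c ∈ U, ∀ d ∈ U, G.Adj y b → G.Adj b c → G.Adj b d → ¬ G.Adj c d :=
    fun b hb c hc d hd hxb hbc hbd hcd =>
      hadm' (h.swap.of_nbr_triangle hT hk hna' hty htx hb hc hd hxb hbc hbd hcd)
  obtain ⟨v, hv, hvx, hvy, -⟩ := h.exists_inner
  have h1 := h.deg (by omega) v hv hvx hvy hvx
  obtain ⟨w, hw, hwx, hwy⟩ := exists_mem_ne_ne_of_card x y (show 3 ≤ (nbrs G U v).card by omega)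
  rw [mem_nbrs] at hw
  have hvw : v ≠ w := hw.2.ne
  obtain ⟨c, hc, d, hd, hcd, hyc, hyd⟩ :=
    (h.exists_two_nbrs hT hv hw.1 hvw hvx hvy hwx hwy).resolve_left hadm
  obtain ⟨e, he, -, -, -, hxe, -⟩ :=
    (h.swap.exists_two_nbrs hT hv hw.1 hvw hvy hvx hwy hwx).resolve_left hadm'
  obtain ⟨A, B, hAU, hxA, hyA, hB, hAB, hmax⟩ := exists_maximal_biclique (y := y) he hxe
  have hyB := (h.of_maximal_biclique hT hk hna htx hty hbx hby hAU hxA hyA hB hAB hmax).resolve_left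
    hadm
  obtain ⟨A', B', hAU', hxA', hyA', hB', hAB', hmax'⟩ := exists_maximal_biclique (y := x) hc hyc
  have hxB := (h.swap.of_maximal_biclique hT hk hna' hty htx hby hbx hAU' hxA' hyA' hB' hAB'
    hmax').resolve_left hadm'
  have hNx : ∀ b, b ∈ B ↔ b ∈ U ∧ G.Adj x b := fun b => by
    refine ⟨fun e => ⟨((hB b).1 e).1, ((hB b).1 e).2.1⟩, fun e => hyB b e.1 ?_⟩
    exact ((hB' b).1 (hxB b e.1 e.2)).2.1
  have hNy : ∀ b, b ∈ B ↔ b ∈ U ∧ G.Adj y b := fun b => by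
    refine ⟨fun e => ?_, fun e => hyB b e.1 e.2⟩
    have := (hB b).1 e
    exact ⟨this.1, ((hB' b).1 (hxB b this.1 this.2.1)).2.1⟩
  have hB2 : 2 ≤ B.card := by
    rw [← Finset.card_pair hcd]
    exact Finset.card_le_card (by
      simp [Finset.insert_subset_iff, hyB c hc hyc, hyB d hd hyd])
  obtain ⟨A₁, hA₁, hc₁⟩ := Finset.exists_subset_card_eq
    (show min A.card (B.card - 2) ≤ A.card by omega)
  refine hadm (h.of_twin_biclique hT hk hna htx hbx (hA₁.trans hAU) (fun e => hxA (hA₁ e))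
    (fun e => hyA (hA₁ e)) hNx hNy (fun a ha b hb => (((hB b).1 hb).2.2 a (hA₁ ha)).symm)
    (by omega) fun w hw hwx hwy hwA => ?_)
  rcases Nat.lt_or_ge A.card (B.card - 1) with h2 | h2
  · left
    have h3 : A₁ = A := Finset.eq_of_subset_of_card_le hA₁ (by omega)
    rw [h3] at hwA ⊢
    exact hmax w hw hwx hwy hwA
  · right
    omega

/-- Inside a set with enough connectivity and degrees there are `k` admissible paths between the
roots. -/
theorem rootedBelow (N : ℕ) : RootedBelow V N := by
  induction N with
  | zero => exact fun _ _ _ _ _ _ h => absurd h (Nat.not_lt_zero _)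
  | succ N ih =>
    intro G U x y z k hU h
    have hT : RootedBelow V U.card := fun G U' x y z k hU' h' => ih G U' x y z k (by omega) h'
    let G' := G.deleteEdges {s(x, y)}
    have hadj : ∀ u v, G'.Adj u v ↔ G.Adj u v ∧ s(u, v) ≠ s(x, y) := fun u v => by
      simp [G', SimpleGraph.deleteEdges_adj]
    have hadj' : ∀ u v, u ≠ x → u ≠ y → G.Adj u v → G'.Adj u v := fun u v hux huy huv => by
      rw [hadj]
      refine ⟨huv, fun e => ?_⟩
      rw [Sym2.eq_iff] at e
      tauto
    have h' : RootedHyp G' U x y z k := by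
      refine ⟨h.ne, h.left_mem, h.right_mem, ?_, h.exists_inner, h.pos, ?_, h.exc⟩
      · intro X hX hne hxX hyX q
        obtain ⟨u, hu, v, hv, hvX, hvq, huv⟩ := h.conn X hX hne hxX hyX q
        exact ⟨u, hu, v, hv, hvX, hvq, hadj' u v (fun e => hxX (e ▸ hu)) (fun e => hyX (e ▸ hu))
          huv⟩
      · intro h2 v hv hvx hvy hvz
        refine (h.deg h2 v hv hvx hvy hvz).trans (Finset.card_le_card fun w hw => ?_)
        rw [mem_nbrs] at hw ⊢
        exact ⟨hw.1, hadj' v w hvx hvy hw.2⟩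
    have hna : ¬ G'.Adj x y := fun e => ((hadj x y).1 e).2 rfl
    have key : AdmPaths G' U x y k := by
      have hpos := h.pos
      rcases (by omega : k = 1 ∨ k = 2 ∨ 3 ≤ k) with rfl | rfl | hk
      · exact h'.admPaths_one
      · exact h'.admPaths_two hT hna
      · obtain rfl := h.exc hk
        exact h'.admPaths_ge_three hT hk hna
    exact key.mono le_rfl fun ℓ ⟨h1, h2⟩ =>
      ⟨h1, h2.mono_graph fun a _ b _ e => ((hadj a b).1 e).1⟩

end Rooted

section Cycles

variable {V : Type*} [DecidableEq V] {G : SimpleGraph V} {k : ℕ}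

/-- No two vertices separate a nonempty set from the rest. -/
def ThreeConn (G : SimpleGraph V) : Prop :=
  ∀ X : Finset V, X.Nonempty → ∀ p q, (∃ w, w ∉ X ∧ w ≠ p ∧ w ≠ q) →
    ∃ u ∈ X, ∃ v, v ∉ X ∧ v ≠ p ∧ v ≠ q ∧ G.Adj u v

theorem ConnOn.exists_component {C W : Finset V} {r : V} (hC : ConnOn G C) (hr : r ∈ C)
    (hrW : r ∉ W) (hW : ∃ w ∈ W, w ∈ C) :
    ∃ C' ⊆ C, r ∈ C' ∧ Disjoint W C' ∧ ConnOn G C' ∧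
      (∀ u ∈ C', ∀ v ∈ C, G.Adj u v → v ∈ C' ∨ v ∈ W) ∧
      ∃ u ∈ C', ∃ w ∈ W, w ∈ C ∧ G.Adj u w := by
  obtain ⟨C', hC'C, hrC', hd, hC', hcl⟩ := exists_component_sdiff G hr hrW
  obtain ⟨w, hw, hwC⟩ := hW
  obtain ⟨u, hu, v, hv, hvC', huv⟩ := hC C' hC'C ⟨r, hrC'⟩
    ⟨w, hwC, Finset.disjoint_left.1 hd hw⟩
  exact ⟨C', hC'C, hrC', hd, hC', hcl, u, hu, v, (hcl u hu v hv huv).resolve_left hvC', hv, huv⟩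

variable [Fintype V]

/-- Many cycles through a connected set `C` and paths between `S` and `Y` outside `C`. -/
theorem cycles_of_component {C S Y D H : Finset V} {p c d : ℕ} (h3 : ThreeConn G)
    (hdeg : ∀ v, k ≤ (nbrs G Finset.univ v).card) (hC : ConnOn G C) (hCH : Disjoint H C)
    (hSH : S ⊆ H) (hYH : Y ⊆ H) (hSY : Disjoint S Y) (hD : D.card ≤ 1) (hDS : Disjoint D S)
    (hS : ∃ u ∈ C, ∃ v ∈ S, G.Adj u v) (hY : ∃ u ∈ C, ∃ v ∈ Y, G.Adj u v)
    (hcl : ∀ u ∈ C, ∀ v, G.Adj u v → v ∈ C ∨ v ∈ S ∨ v ∈ Y ∨ v ∈ D) (hp : 1 ≤ p) (hc : 1 ≤ c)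
    (hd : d = 1 ∨ d = 2)
    (hloss : ∀ w ∈ C, (nbrs G D w).card + (nbrs G S w).card + (nbrs G Y w).card + 2 ≤
      p + min 1 (nbrs G S w).card + min 1 (nbrs G Y w).card)
    (hH : ∀ s ∈ S, ∀ t ∈ Y, ∀ j < p, PathIn G (c + j * d) H s t) :
    HoldsOnAP k (HasCycleLen G) := by
  obtain ⟨u₁, hu₁, s, hs, hus⟩ := hS
  obtain ⟨u₂, hu₂, t, ht, hut⟩ := hY
  have hCH' := Finset.disjoint_left.1 hCH
  have hsC := hCH' (hSH hs)
  have hpaths := exists_paths_of_contraction (rootedBelow (C.card + 3)) (G := G)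
    (k := max 1 (k + 1 - p))
    (hCH.symm.mono_right hSH) (hCH.symm.mono_right hYH) hSY ⟨s, hs⟩ ⟨t, ht⟩ (by omega)
    (z := s) ⟨u₁, hu₁, fun e => hsC (e ▸ hu₁)⟩ (by omega) (fun _ => hsC) ?_ ?_ ?_ ?_
  · refine hpaths.sum (c := c) (by omega) hp hd ?_ (by omega : k ≤ max 1 (k + 1 - p) + p - 1)
    rintro ℓ ⟨hℓ, s, hs, t, ht, h⟩ j hj
    have := (hH s hs t ht j hj).hasCycleLen h.symm (fun v hv hv' => by
      simp only [Finset.mem_insert] at hv'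
      have := hCH' hv
      tauto) (by omega) hℓ
    exact (show c + j * d + ℓ = ℓ + c + j * d by omega) ▸ this
  · intro X hX hne
    by_cases hCX : C ⊆ X
    · exact ⟨u₂, hCX hu₂, t, Finset.mem_union_right _ ht, fun e => hCH' (hYH ht) (hX e), hut⟩
    · obtain ⟨z, hz⟩ := Finset.not_subset.1 hCX
      obtain ⟨u, hu, v, hv, hvX, huv⟩ := hC X hX hne ⟨z, hz⟩
      exact ⟨u, hu, v, Finset.mem_union_left _ hv, hvX, huv⟩
  · intro X hX hne
    by_cases hCX : C ⊆ X
    · exact ⟨u₁, hCX hu₁, s, Finset.mem_union_right _ hs, fun e => hsC (hX e), hus⟩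
    · obtain ⟨z, hz⟩ := Finset.not_subset.1 hCX
      obtain ⟨u, hu, v, hv, hvX, huv⟩ := hC X hX hne ⟨z, hz⟩
      exact ⟨u, hu, v, Finset.mem_union_left _ hv, hvX, huv⟩
  · intro X hX hne q hq
    have hsq : s ≠ q := fun e => hsC (e ▸ hq)
    rcases D.eq_empty_or_nonempty with rfl | ⟨e, he⟩
    · obtain ⟨u, hu, v, hvX, hvq, -, huv⟩ := h3 X hne q q ⟨s, fun e => hsC (hX e), hsq, hsq⟩
      have := hcl u (hX hu) v huv
      refine ⟨u, hu, v, ?_, hvX, hvq, huv⟩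
      simp only [Finset.mem_union, Finset.notMem_empty] at this ⊢
      tauto
    · obtain ⟨u, hu, v, hvX, hvq, hve, huv⟩ := h3 X hne q e ⟨s, fun e => hsC (hX e), hsq,
        fun h => Finset.disjoint_left.1 hDS he (h ▸ hs)⟩
      have := hcl u (hX hu) v huv
      have hvD : v ∉ D := fun h => hve (Finset.card_le_one.1 hD v h e he)
      refine ⟨u, hu, v, ?_, hvX, hvq, huv⟩
      simp only [Finset.mem_union]
      tauto
  · intro _ w hw _
    have h1 : nbrs G Finset.univ w ⊆ nbrs G C w ∪ nbrs G S w ∪ nbrs G Y w ∪ nbrs G D w := by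
      intro v hv
      rw [mem_nbrs] at hv
      have := hcl w hw v hv.2
      simp only [Finset.mem_union, mem_nbrs]
      tauto
    have h2 := Finset.card_le_card h1
    have h3 := Finset.card_union_le (nbrs G C w ∪ nbrs G S w ∪ nbrs G Y w) (nbrs G D w)
    have h4 := Finset.card_union_le (nbrs G C w ∪ nbrs G S w) (nbrs G Y w)
    have h5 := Finset.card_union_le (nbrs G C w) (nbrs G S w)
    have h6 := hdeg w
    have h7 := hloss w hw
    omega

/-- A separation by two vertices gives many cycles. -/
theorem threeConn_or_cycles (hk : 3 ≤ k) (hdeg : ∀ v, k ≤ (nbrs G Finset.univ v).card)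
    (h2 : ∀ X : Finset V, X.Nonempty → ∀ q, (∃ w, w ∉ X ∧ w ≠ q) →
      ∃ u ∈ X, ∃ v, v ∉ X ∧ v ≠ q ∧ G.Adj u v) :
    ThreeConn G ∨ HoldsOnAP k (HasCycleLen G) := by
  refine or_iff_not_imp_left.2 fun hcon => ?_
  unfold ThreeConn at hcon
  push Not at hcon
  obtain ⟨X, ⟨u, hu⟩, p, q, ⟨w, hwX, hwp, hwq⟩, hcon⟩ := hcon
  have hpX : p ∉ X := by
    intro hp
    obtain ⟨u, hu, v, hv, hvq, huv⟩ := h2 X ⟨u, hu⟩ q ⟨w, hwX, hwq⟩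
    exact hcon u hu v hv (fun e => hv (e ▸ hp)) hvq huv
  have hqX : q ∉ X := by
    intro hq
    obtain ⟨u, hu, v, hv, hvp, huv⟩ := h2 X ⟨u, hu⟩ p ⟨w, hwX, hwp⟩
    exact hcon u hu v hv hvp (fun e => hv (e ▸ hq)) huv
  have hpq : p ≠ q := by
    rintro rfl
    obtain ⟨u, hu, v, hv, hvp, huv⟩ := h2 X ⟨u, hu⟩ p ⟨w, hwX, hwp⟩
    exact hcon u hu v hv hvp hvp huv
  have key : ∀ Z : Finset V, Z.Nonempty → p ∉ Z → q ∉ Z →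
      (∀ u ∈ Z, ∀ v, v ∉ Z → G.Adj u v → v = p ∨ v = q) →
      AdmPaths G (insert p (insert q Z)) p q (k - 1) := by
    rintro Z ⟨z, hz⟩ hpZ hqZ hcl
    have hmem : ∀ v ∈ insert p (insert q Z), v ≠ p → v ≠ q → v ∈ Z := by
      intro v hv h1 h2
      simp only [Finset.mem_insert] at hv
      tauto
    refine rootedBelow _ G _ p q p (k - 1) (Nat.lt_succ_self _) ⟨hpq, by simp, by simp, ?_,
      ⟨z, by simp [hz], fun e => hpZ (e ▸ hz), fun e => hqZ (e ▸ hz), fun e => hpZ (e ▸ hz)⟩,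
      by omega, ?_, fun _ => rfl⟩
    · intro X' hX' hne hp' hq' r
      have hX'Z : X' ⊆ Z := fun v hv => hmem v (hX' hv) (fun e => hp' (e ▸ hv))
        (fun e => hq' (e ▸ hv))
      have hex : ∃ w, w ∉ X' ∧ w ≠ r := by
        by_cases hpr : p = r
        · exact ⟨q, hq', fun e => hpq (hpr.trans e.symm)⟩
        · exact ⟨p, hp', hpr⟩
      obtain ⟨u, hu, v, hv, hvr, huv⟩ := h2 X' hne r hex
      refine ⟨u, hu, v, ?_, hv, hvr, huv⟩
      have := hcl u (hX'Z hu) v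
      simp only [Finset.mem_insert]
      tauto
    · intro _ v hv hvp hvq _
      have h1 := hdeg v
      have h3 : nbrs G Finset.univ v ⊆ nbrs G (insert p (insert q Z)) v := by
        intro b hb
        rw [mem_nbrs] at hb ⊢
        have := hcl v (hmem v hv hvp hvq) b
        refine ⟨?_, hb.2⟩
        simp only [Finset.mem_insert]
        tauto
      have := Finset.card_le_card h3
      omega
  have hX := key X ⟨u, hu⟩ hpX hqX fun u hu v hv huv => by
    have := hcon u hu v hv
    tauto
  have hY := key (((Xᶜ).erase p).erase q) ⟨w, by simp [hwX, hwp, hwq]⟩ (by simp) (by simp)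
    fun u hu v hv huv => by
      simp only [Finset.mem_erase, Finset.mem_compl] at hu hv
      by_contra! e
      exact hcon v (by tauto) u hu.2.2 hu.2.1 hu.1 huv.symm
  refine hX.combine hY (c := 0) (by omega) (by omega) (fun ℓ ℓ' h h' => ?_) (by omega)
  refine h.2.hasCycleLen h'.2.symm (fun v hv hv' => ?_) (by omega) h'.1
  simp only [Finset.mem_insert, Finset.mem_erase, Finset.mem_compl] at hv hv'
  tauto

end Cycles

section CliqueCycles

variable {V : Type*} [DecidableEq V] {G : SimpleGraph V} {k : ℕ}

theorem cycles_of_clique {K : Finset V} (hK : ∀ a ∈ K, ∀ b ∈ K, a ≠ b → G.Adj a b)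
    (hk : k + 2 ≤ K.card) : HoldsOnAP k (HasCycleLen G) := by
  refine ⟨3, 1, Or.inl rfl, fun i hi => ?_⟩
  obtain ⟨a, ha, b, hb, hab⟩ := Finset.one_lt_card.1 (by omega : 1 < K.card)
  have h := pathIn_clique hK ha hb hab (n := i + 2) (by omega) (by omega)
  exact (show i + 2 + 1 = 3 + i * 1 by omega) ▸ h.hasCycleLen_of_adj (by omega) (hK a ha b hb hab)

variable [Fintype V]

/-- A graph with a triangle, seen from a maximal clique `K`. -/
theorem cycles_of_maximal_clique {K : Finset V} (hk : 3 ≤ k) (h3 : ThreeConn G)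
    (hdeg : ∀ v, k ≤ (nbrs G Finset.univ v).card)
    (hK : ∀ a ∈ K, ∀ b ∈ K, a ≠ b → G.Adj a b) (hK3 : 3 ≤ K.card)
    (hmax : ∀ w, w ∉ K → ∃ a ∈ K, ¬ G.Adj w a) :
    HoldsOnAP k (HasCycleLen G) ∨ (Fintype.card V = k + 1 ∧ ∀ a b, a ≠ b → G.Adj a b) := by
  refine or_iff_not_imp_left.2 fun hcyc => ?_
  have hKk : K.card ≤ k + 1 := by
    by_contra! h
    exact hcyc (cycles_of_clique hK h)
  by_cases hV : ∀ v, v ∈ K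
  · have hKV : K = Finset.univ := by
      ext v
      simp [hV v]
    refine ⟨?_, fun a b => hK a (hV a) b (hV b)⟩
    obtain ⟨v, hv⟩ := Finset.card_pos.1 (by omega : 0 < K.card)
    have h1 := hdeg v
    have h2 := card_nbrs_lt (G := G) (Finset.mem_univ v) (G.irrefl (v := v))
    rw [← hKV] at h1 h2
    have h4 : K.card = Fintype.card V := by rw [hKV, Finset.card_univ]
    omega
  exfalso
  push Not at hV
  obtain ⟨r, hr⟩ := hV
  obtain ⟨C, -, hrC, hKC, hC, hcl⟩ := exists_component_sdiff G (Finset.mem_univ r) hr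
  have hKC' := Finset.disjoint_left.1 hKC
  have hcl' : ∀ u ∈ C, ∀ v, G.Adj u v → v ∈ C ∨ v ∈ K := fun u hu v =>
    hcl u hu v (Finset.mem_univ v)
  have hex : ∀ p q, ∃ w ∈ K, w ≠ p ∧ w ≠ q := fun p q => by
    obtain ⟨w, hw, h1, h2⟩ := exists_mem_ne_ne_of_card p q hK3
    exact ⟨w, hw, h1, h2⟩
  have hout : ∀ q, ∃ u ∈ C, ∃ v ∈ K, v ≠ q ∧ G.Adj u v := by
    intro q
    obtain ⟨w, hw, hwq, -⟩ := hex q q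
    obtain ⟨u, hu, v, hv, hvq, -, huv⟩ := h3 C ⟨r, hrC⟩ q q
      ⟨w, fun e => hKC' hw e, hwq, hwq⟩
    exact ⟨u, hu, v, (hcl' u hu v huv).resolve_left hv, hvq, huv⟩
  have hmax' : ∀ w ∈ C, (nbrs G K w).card < K.card := fun w hw => by
    obtain ⟨a, ha, hwa⟩ := hmax w fun e => hKC' e hw
    exact card_nbrs_lt ha hwa
  obtain ⟨u₀, hu₀, q, hq, -, huq⟩ := hout r
  have hcq := Finset.card_erase_add_one hq
  by_cases ht : ∃ w ∈ C, ∀ a ∈ K, a ≠ q → G.Adj w a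
  · obtain ⟨w, hw, hwK⟩ := ht
    have hwq : ¬ G.Adj w q := fun e => by
      obtain ⟨a, ha, hwa⟩ := hmax w fun e => hKC' e hw
      by_cases haq : a = q
      · exact hwa (haq ▸ e)
      · exact hwa (hwK a ha haq)
    have hwnK : w ∉ K := fun e => hKC' e hw
    have hpath : ∀ a ∈ K, a ≠ q → ∀ j < K.card - 1, PathIn G (j + 2) (insert w K) w a := by
      intro a ha haq j hj
      obtain ⟨b, hb, hba, hbq⟩ := hex a q
      exact (pathIn_clique hK hb ha hba (n := j + 1) (by omega) (by omega)).cons (hwK b hb hbq) hwnK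
    rcases Nat.lt_or_ge k K.card with h1 | h1
    · obtain ⟨a, ha, haq, -⟩ := hex q q
      refine hcyc ⟨3, 1, Or.inl rfl, fun i hi => ?_⟩
      have := (hpath a ha haq i (by omega)).hasCycleLen_of_adj (by omega) (hwK a ha haq)
      exact (show i + 2 + 1 = 3 + i * 1 by omega) ▸ this
    have hrw : ∃ r ∈ C, r ≠ w := by
      by_contra! hcon
      have h2 : nbrs G Finset.univ w ⊆ nbrs G K w := by
        intro v hv
        rw [mem_nbrs] at hv ⊢
        refine ⟨(hcl' w hw v hv.2).resolve_left fun e => ?_, hv.2⟩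
        exact G.irrefl (hcon v e ▸ hv.2)
      have := Finset.card_le_card h2
      have := hdeg w
      have := hmax' w hw
      omega
    obtain ⟨r', hr', hr'w⟩ := hrw
    obtain ⟨C', hC'C, hrC', hwC', hC', hclC', u₁, hu₁, w', hw', -, huw⟩ := hC.exists_component
      (W := {w}) hr' (by simpa using hr'w) ⟨w, by simp, hw⟩
    rw [Finset.mem_singleton] at hw'
    subst hw'
    have hwC'' : w' ∉ C' := by simpa using hwC'
    have hclC'' : ∀ u ∈ C', ∀ v, G.Adj u v → v ∈ C' ∨ v = w' ∨ v ∈ K := by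
      intro u hu v huv
      rcases hcl' u (hC'C hu) v huv with h | h
      · have := hclC' u hu v h huv
        rw [Finset.mem_singleton] at this
        tauto
      · exact Or.inr (Or.inr h)
    refine hcyc (cycles_of_component (C := C') (S := K.erase q) (Y := {w'}) (D := {q})
      (H := insert w' K) (p := K.card) (c := 1) (d := 1) h3 hdeg hC' ?_ ?_ (by simp) ?_ (by simp)
      (by simp) ?_ ⟨u₁, hu₁, w', by simp, huw⟩ ?_ (by omega) le_rfl (Or.inl rfl) ?_ ?_)
    · rw [Finset.disjoint_insert_left]
      exact ⟨hwC'', hKC.mono_right hC'C⟩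
    · exact (Finset.erase_subset _ _).trans (Finset.subset_insert _ _)
    · simp [hwnK]
    · obtain ⟨b, hb, hbq, -⟩ := hex q q
      obtain ⟨u, hu, v, hv, hvw, hvq, huv⟩ := h3 C' ⟨r', hrC'⟩ w' q
        ⟨b, fun e => hKC' hb (hC'C e), fun e => hwnK (e ▸ hb), hbq⟩
      have := hclC'' u hu v huv
      exact ⟨u, hu, v, by rw [Finset.mem_erase]; tauto, huv⟩
    · intro u hu v huv
      have := hclC'' u hu v huv
      simp only [Finset.mem_erase, Finset.mem_singleton]
      tauto
    · intro v hv
      have h2 := hmax' v (hC'C hv)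
      have h4 := card_nbrs_le G {q} v
      have h5 := card_nbrs_erase_add (G := G) (v := v) hq
      have h6 := card_nbrs_le G {w'} v
      rw [Finset.card_singleton] at h4 h6
      omega
    · intro s hs t ht j hj
      rw [Finset.mem_singleton] at ht
      rw [Finset.mem_erase] at hs
      subst ht
      rcases j with _ | j
      · exact pathIn_one (by simp [hs.2]) (by simp) (hwK s hs.2 hs.1).symm
      · exact (show j + 2 = 1 + (j + 1) * 1 by omega) ▸ (hpath s hs.2 hs.1 j (by omega)).symm
  · push Not at ht
    refine hcyc (cycles_of_component (C := C) (S := K.erase q) (Y := {q}) (D := ∅)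
      (H := K) (p := K.card - 1) (c := 1) (d := 1) h3 hdeg hC hKC (Finset.erase_subset _ _)
      (by simpa using hq) (by simp) (by simp) (by simp) ?_ ⟨u₀, hu₀, q, by simp, huq⟩ ?_ (by omega)
      le_rfl (Or.inl rfl) ?_ ?_)
    · obtain ⟨u, hu, v, hv, hvq, huv⟩ := hout q
      exact ⟨u, hu, v, by simp [hv, hvq], huv⟩
    · intro u hu v huv
      have := hcl' u hu v huv
      simp only [Finset.mem_erase, Finset.mem_singleton]
      tauto
    · intro w hw
      obtain ⟨a, ha, haq, hwa⟩ := ht w hw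
      have h1 := card_nbrs_lt (Finset.mem_erase.2 ⟨haq, ha⟩) hwa
      have h2 := card_nbrs_le G {q} w
      have h4 : (nbrs G ∅ w).card = 0 := card_nbrs_eq_zero (by simp)
      rw [Finset.card_singleton] at h2
      omega
    · intro s hs t ht j hj
      rw [Finset.mem_singleton] at ht
      rw [Finset.mem_erase] at hs
      subst ht
      exact pathIn_clique hK hs.2 hq hs.1 (by omega) (by omega)

end CliqueCycles

section BicliquePaths

variable {V : Type*} [DecidableEq V] {G : SimpleGraph V} {A B : Finset V} {k : ℕ}

theorem cycles_of_biclique (hAB : Disjoint A B) (hadj : ∀ a ∈ A, ∀ b ∈ B, G.Adj a b)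
    (hA : k + 1 ≤ A.card) (hB : k + 1 ≤ B.card) : HoldsOnAP k (HasCycleLen G) := by
  refine ⟨4, 2, Or.inr rfl, fun i hi => ?_⟩
  obtain ⟨a, ha⟩ := Finset.card_pos.1 (by omega : 0 < A.card)
  obtain ⟨b, hb⟩ := Finset.card_pos.1 (by omega : 0 < B.card)
  have h := pathIn_biclique_odd hAB hadj ha hb (j := i + 1) (by omega) (by omega)
  exact (show 2 * (i + 1) + 1 + 1 = 4 + i * 2 by omega) ▸
    h.hasCycleLen_of_adj (by omega) (hadj a ha b hb)

theorem pathIn_odd_of_adj {w b b' : V} {j : ℕ} (hAB : Disjoint A B)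
    (hadj : ∀ a ∈ A, ∀ b ∈ B, G.Adj a b) (hw : w ∉ A ∪ B) (hb : b ∈ B) (hb' : b' ∈ B)
    (hbb' : b' ≠ b) (hwb' : G.Adj w b') (h1 : 1 ≤ j) (hA : j ≤ A.card) (hB : j + 1 ≤ B.card) :
    PathIn G (2 * j + 1) (insert w (A ∪ B)) w b :=
  (pathIn_biclique_even hAB hadj hb' hb hbb' h1 hA hB).cons hwb' hw

theorem pathIn_even_of_adj {w a b : V} {j : ℕ} (hAB : Disjoint A B)
    (hadj : ∀ a ∈ A, ∀ b ∈ B, G.Adj a b) (hw : w ∉ A ∪ B) (ha : a ∈ A) (hb : b ∈ B)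
    (hwb : G.Adj w b) (hA : j + 1 ≤ A.card) (hB : j + 1 ≤ B.card) :
    PathIn G (2 * j + 2) (insert w (A ∪ B)) w a :=
  (pathIn_biclique_odd hAB hadj ha hb hA hB).symm.cons hwb hw

/-- The longest path between the two sides of a biclique through a further vertex `w`. -/
theorem pathIn_odd_through {w a b : V} (hAB : Disjoint A B)
    (hadj : ∀ a ∈ A, ∀ b ∈ B, G.Adj a b) (hw : w ∉ A ∪ B) (ha : a ∈ A) (hb : b ∈ B)
    (hwB : 2 ≤ (nbrs G B w).card) (hA : 2 ≤ A.card) (hB : A.card + 1 ≤ B.card) :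
    PathIn G (2 * A.card + 1) (insert w (A ∪ B)) a b := by
  have hd := Finset.disjoint_left.1 hAB
  rw [Finset.mem_union, not_or] at hw
  by_cases hwb : G.Adj w b
  · obtain ⟨b₁, hb₁, hb₁b⟩ := exists_mem_ne_of_card b hwB
    rw [mem_nbrs] at hb₁
    have hcB := Finset.card_erase_add_one hb
    have h1 := pathIn_biclique_odd (A := A) (B := B.erase b) (j := A.card - 1)
      (hAB.mono_right (Finset.erase_subset _ _))
      (fun a ha b hb => hadj a ha b (Finset.mem_of_mem_erase hb)) ha
      (Finset.mem_erase.2 ⟨hb₁b, hb₁.1⟩) (by omega) (by omega)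
    have h2 := (h1.symm.cons hb₁.2 (by simp [hw])).cons' (W₂ := insert w (A ∪ B)) hwb.symm
      (by
        simp only [Finset.mem_insert, Finset.mem_union, Finset.mem_erase]
        have := hwb.ne'
        have := fun e => hd e hb
        tauto) (by simp [hb]) (by
        intro v
        simp only [Finset.mem_insert, Finset.mem_union, Finset.mem_erase]
        tauto)
    exact (show 2 * (A.card - 1) + 1 + 1 + 1 = 2 * A.card + 1 by omega) ▸ h2.symm
  · obtain ⟨b₁, hb₁', b₂, hb₂', hb₁₂⟩ := Finset.one_lt_card.1 hwB
    obtain ⟨hb₁, hwb₁⟩ := mem_nbrs.1 hb₁'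
    obtain ⟨hb₂, hwb₂⟩ := mem_nbrs.1 hb₂'
    have hb₁b : b ≠ b₁ := fun e => hwb (e ▸ hwb₁)
    have hb₂b : b₂ ≠ b := fun e => hwb (e ▸ hwb₂)
    have hcA := Finset.card_erase_add_one ha
    have hcB := Finset.card_erase_add_one hb₁
    have h1 := pathIn_biclique_even (A := A.erase a) (B := B.erase b₁) (j := A.card - 1)
      ((hAB.mono_right (Finset.erase_subset _ _)).mono_left (Finset.erase_subset _ _))
      (fun a ha b hb => hadj a (Finset.mem_of_mem_erase ha) b (Finset.mem_of_mem_erase hb))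
      (Finset.mem_erase.2 ⟨hb₁₂.symm, hb₂⟩) (Finset.mem_erase.2 ⟨hb₁b, hb⟩) hb₂b (by omega)
      (by omega) (by omega)
    have hb₁A : b₁ ∉ A := fun e => hd e hb₁
    have hb₁w := hwb₁.ne'
    have haw : a ≠ w := fun e => hw.1 (e ▸ ha)
    have hab₁ : a ≠ b₁ := fun e => hb₁A (e ▸ ha)
    have haB := hd ha
    have h2 := ((h1.cons hwb₂ (by simp [hw])).cons hwb₁.symm (by simp [hb₁w, hb₁A])).cons'
      (W₂ := insert w (A ∪ B)) (hadj a ha b₁ hb₁) (by simp [haw, hab₁, haB]) (by simp [ha]) (by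
        intro v
        simp only [Finset.mem_insert, Finset.mem_union, Finset.mem_erase]
        rintro (rfl | rfl | h)
        · simp [hb₁]
        · simp
        · tauto)
    exact (show 2 * (A.card - 1) + 1 + 1 + 1 = 2 * A.card + 1 by omega) ▸ h2

/-- The longest path inside one side of a biclique, to a non-neighbour of a further vertex `w`,
through `w`. -/
theorem pathIn_even_through {w b q : V} (hAB : Disjoint A B)
    (hadj : ∀ a ∈ A, ∀ b ∈ B, G.Adj a b) (hw : w ∉ A ∪ B) (hb : b ∈ B) (hq : q ∈ B) (hbq : b ≠ q)
    (hwq : ¬ G.Adj w q) (hwB : 2 ≤ (nbrs G B w).card) (hA : 2 ≤ A.card)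
    (hB : A.card + 2 ≤ B.card) : PathIn G (2 * A.card + 2) (insert w (A ∪ B)) b q := by
  have hd := Finset.disjoint_left.1 hAB
  have hcB := Finset.card_erase_add_one hb
  have hAB' := hAB.mono_right (Finset.erase_subset b B)
  have hadj' : ∀ a ∈ A, ∀ c ∈ B.erase b, G.Adj a c := fun a ha c hc =>
    hadj a ha c (Finset.mem_of_mem_erase hc)
  have hbA : b ∉ A := fun e => hd e hb
  have hwb : b ≠ w := fun e => hw (by simp [← e, hb])
  rw [Finset.mem_union, not_or] at hw
  have hsub : insert w (A ∪ B.erase b) ⊆ insert w (A ∪ B) :=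
    Finset.insert_subset_insert _ (Finset.union_subset_union le_rfl (Finset.erase_subset _ _))
  by_cases hwb' : G.Adj w b
  · obtain ⟨b₁, hb₁, hb₁b⟩ := exists_mem_ne_of_card b hwB
    rw [mem_nbrs] at hb₁
    have h1 := pathIn_odd_of_adj hAB' hadj' (b := q) (b' := b₁) (w := w) (j := A.card)
      (by simp [hw]) (by simp [hbq.symm, hq]) (by simp [hb₁b, hb₁]) (fun e => hwq (e ▸ hb₁.2)) hb₁.2
      (by omega) le_rfl (by omega)
    exact h1.cons' hwb'.symm (by simp [hwb, hbA]) (by simp [hb]) hsub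
  · obtain ⟨a, ha⟩ := Finset.card_pos.1 (by omega : 0 < A.card)
    have h1 := pathIn_odd_through hAB' hadj' (w := w) (a := a) (b := q) (by simp [hw]) ha
      (by simp [hbq.symm, hq]) ?_ hA (by omega)
    · exact h1.cons' (hadj a ha b hb).symm (by simp [hwb, hbA]) (by simp [hb]) hsub
    · refine hwB.trans (Finset.card_le_card fun v hv => ?_)
      rw [mem_nbrs] at hv ⊢
      exact ⟨Finset.mem_erase.2 ⟨fun e => hwb' (e ▸ hv.2), hv.1⟩, hv.2⟩

end BicliquePaths

section BicliqueComponents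

variable {V : Type*} [DecidableEq V] {G : SimpleGraph V} {k : ℕ}

variable [Fintype V] {A B C : Finset V}

/-- A component attached to one side of a biclique only. -/
theorem cycles_of_component_side (h3 : ThreeConn G)
    (hdeg : ∀ v, k ≤ (nbrs G Finset.univ v).card) (hAB : Disjoint A B)
    (hadj : ∀ a ∈ A, ∀ b ∈ B, G.Adj a b) (hA : 2 ≤ A.card) (hB : A.card ≤ B.card)
    (hAk : A.card ≤ k) (hC : ConnOn G C) (hCne : C.Nonempty) (hABC : Disjoint (A ∪ B) C)
    (hcl : ∀ u ∈ C, ∀ v, G.Adj u v → v ∈ C ∨ v ∈ A) (hmax : ∀ w ∈ C, ∃ a ∈ A, ¬ G.Adj w a) :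
    HoldsOnAP k (HasCycleLen G) := by
  have hCH := Finset.disjoint_left.1 hABC
  have hcU := Finset.card_union_of_disjoint hAB
  have hadj' : ∀ b ∈ B, ∀ a ∈ A, G.Adj b a := fun b hb a ha => (hadj a ha b hb).symm
  have hout : ∀ C' ⊆ C, C'.Nonempty → ∀ p q, ∃ u ∈ C', ∃ v, v ∉ C' ∧ v ≠ p ∧ v ≠ q ∧
      G.Adj u v := by
    intro C' hC' hne p q
    obtain ⟨w, hw, hwp, hwq⟩ := exists_mem_ne_ne_of_card (A := A ∪ B) p q (by omega)
    exact h3 C' hne p q ⟨w, fun e => hCH hw (hC' e), hwp, hwq⟩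
  have houtA : ∀ p q, ∃ u ∈ C, ∃ v ∈ A, v ≠ p ∧ v ≠ q ∧ G.Adj u v := by
    intro p q
    obtain ⟨u, hu, v, hv, hvp, hvq, huv⟩ := hout C subset_rfl hCne p q
    exact ⟨u, hu, v, (hcl u hu v huv).resolve_left hv, hvp, hvq, huv⟩
  have hA3 : 3 ≤ A.card := by
    by_contra! hcon
    obtain ⟨a, b, -, hab⟩ := Finset.card_eq_two.1 (show A.card = 2 by omega)
    obtain ⟨-, -, v, hv, hva, hvb, -⟩ := houtA a b
    rw [hab] at hv
    simp [hva, hvb] at hv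
  have hmax' : ∀ w ∈ C, (nbrs G A w).card < A.card := fun w hw => by
    obtain ⟨a, ha, hwa⟩ := hmax w hw
    exact card_nbrs_lt ha hwa
  obtain ⟨r, hr⟩ := hCne
  obtain ⟨u₀, hu₀, q, hq, -, -, huq⟩ := houtA r r
  have hcq := Finset.card_erase_add_one hq
  by_cases ht : ∃ w ∈ C, ∀ a ∈ A, a ≠ q → G.Adj w a
  · obtain ⟨w, hw, hwA⟩ := ht
    have hwAB : w ∉ A ∪ B := fun e => hCH e hw
    have hwnA : w ∉ A := fun e => hwAB (Finset.mem_union_left _ e)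
    have hrw : ∃ r ∈ C, r ≠ w := by
      by_contra! hcon
      have h2 : nbrs G Finset.univ w ⊆ nbrs G A w := by
        intro v hv
        rw [mem_nbrs] at hv ⊢
        refine ⟨(hcl w hw v hv.2).resolve_left fun e => ?_, hv.2⟩
        exact G.irrefl (hcon v e ▸ hv.2)
      have := Finset.card_le_card h2
      have := hdeg w
      have := hmax' w hw
      omega
    obtain ⟨r', hr', hr'w⟩ := hrw
    obtain ⟨C', hC'C, hrC', hwC', hC', hclC', u₁, hu₁, w', hw', -, huw⟩ := hC.exists_component
      (W := {w}) hr' (by simpa using hr'w) ⟨w, by simp, hw⟩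
    rw [Finset.mem_singleton] at hw'
    subst hw'
    have hwC'' : w' ∉ C' := by simpa using hwC'
    have hclC'' : ∀ u ∈ C', ∀ v, G.Adj u v → v ∈ C' ∨ v = w' ∨ v ∈ A := by
      intro u hu v huv
      rcases hcl u (hC'C hu) v huv with h | h
      · have := hclC' u hu v h huv
        rw [Finset.mem_singleton] at this
        tauto
      · exact Or.inr (Or.inr h)
    refine cycles_of_component (C := C') (S := A.erase q) (Y := {w'}) (D := {q})
      (H := insert w' (A ∪ B)) (p := A.card) (c := 1) (d := 2) h3 hdeg hC' ?_ ?_ (by simp) ?_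
      (by simp) (by simp) ?_ ⟨u₁, hu₁, w', by simp, huw⟩ ?_ (by omega) le_rfl (Or.inr rfl) ?_ ?_
    · rw [Finset.disjoint_insert_left]
      exact ⟨hwC'', hABC.mono_right hC'C⟩
    · exact (Finset.erase_subset _ _).trans
        (Finset.subset_union_left.trans (Finset.subset_insert _ _))
    · simp [hwnA]
    · obtain ⟨u, hu, v, hv, hvw, hvq, huv⟩ := hout C' hC'C ⟨r', hrC'⟩ w' q
      have := hclC'' u hu v huv
      exact ⟨u, hu, v, by rw [Finset.mem_erase]; tauto, huv⟩
    · intro u hu v huv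
      have := hclC'' u hu v huv
      simp only [Finset.mem_erase, Finset.mem_singleton]
      tauto
    · intro v hv
      have h2 := hmax' v (hC'C hv)
      have h4 := card_nbrs_le G {q} v
      have h5 := card_nbrs_erase_add (G := G) (v := v) hq
      have h6 := card_nbrs_le G {w'} v
      rw [Finset.card_singleton] at h4 h6
      omega
    · intro s hs t ht j hj
      rw [Finset.mem_singleton] at ht
      rw [Finset.mem_erase] at hs
      subst ht
      rcases j with _ | j
      · exact pathIn_one (by simp [hs.2]) (by simp) (hwA s hs.2 hs.1).symm
      · obtain ⟨a', ha', ha's, ha'q⟩ := exists_mem_ne_ne_of_card s q hA3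
        have := pathIn_odd_of_adj (j := j + 1) hAB.symm hadj' (by rwa [Finset.union_comm])
          hs.2 ha' ha's (hwA a' ha' ha'q)
          (by omega) (by omega) (by omega)
        rw [Finset.union_comm] at this
        exact (show 2 * (j + 1) + 1 = 1 + (j + 1) * 2 by omega) ▸ this.symm
  · push Not at ht
    refine cycles_of_component (C := C) (S := A.erase q) (Y := {q}) (D := ∅)
      (H := A ∪ B) (p := A.card - 1) (c := 2) (d := 2) h3 hdeg hC hABC
      ((Finset.erase_subset _ _).trans Finset.subset_union_left)
      (by simp [hq]) (by simp) (by simp) (by simp) ?_ ⟨u₀, hu₀, q, by simp, huq⟩ ?_ (by omega)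
      (by omega) (Or.inr rfl) ?_ ?_
    · obtain ⟨u, hu, v, hv, hvq, -, huv⟩ := houtA q q
      exact ⟨u, hu, v, by simp [hv, hvq], huv⟩
    · intro u hu v huv
      have := hcl u hu v huv
      simp only [Finset.mem_erase, Finset.mem_singleton]
      tauto
    · intro w hw
      obtain ⟨a, ha, haq, hwa⟩ := ht w hw
      have h1 := card_nbrs_lt (Finset.mem_erase.2 ⟨haq, ha⟩) hwa
      have h4 := card_nbrs_le G {q} w
      have h0 := card_nbrs_le G ∅ w
      rw [Finset.card_singleton] at h4
      rw [Finset.card_empty] at h0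
      omega
    · intro s hs t ht j hj
      rw [Finset.mem_singleton] at ht
      rw [Finset.mem_erase] at hs
      subst ht
      have := pathIn_biclique_even (j := j + 1) hAB.symm hadj' hs.2 hq hs.1 (by omega) (by omega)
        (by omega)
      rw [Finset.union_comm] at this
      exact (show 2 * (j + 1) = 2 + j * 2 by omega) ▸ this

/-- A component attached to both sides of a biclique. -/
theorem cycles_of_component_both (h3 : ThreeConn G)
    (hdeg : ∀ v, k ≤ (nbrs G Finset.univ v).card) (hAB : Disjoint A B)
    (hadj : ∀ a ∈ A, ∀ b ∈ B, G.Adj a b) (hA : 2 ≤ A.card) (hB : A.card ≤ B.card)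
    (hC : ConnOn G C) (hABC : Disjoint (A ∪ B) C)
    (hcl : ∀ u ∈ C, ∀ v, G.Adj u v → v ∈ C ∨ v ∈ A ∪ B)
    (hCA : ∃ u ∈ C, ∃ v ∈ A, G.Adj u v) (hCB : ∃ u ∈ C, ∃ v ∈ B, G.Adj u v)
    (hw : ∀ w ∈ C, (nbrs G A w).card < A.card ∧ (nbrs G B w).card < A.card ∧
      ((nbrs G A w).card = 0 ∨ (nbrs G B w).card = 0)) :
    HoldsOnAP k (HasCycleLen G) := by
  refine cycles_of_component (C := C) (S := A) (Y := B) (D := ∅)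
      (H := A ∪ B) (p := A.card) (c := 1) (d := 2) h3 hdeg hC hABC
      Finset.subset_union_left Finset.subset_union_right hAB (by simp) (by simp) hCA hCB ?_
      (by omega) le_rfl (Or.inr rfl) ?_ ?_
  · intro u hu v huv
    have := hcl u hu v huv
    rw [Finset.mem_union] at this
    tauto
  · intro w hwC
    have h1 := hw w hwC
    have h0 := card_nbrs_le G ∅ w
    rw [Finset.card_empty] at h0
    omega
  · intro a ha b hb j hj
    exact (show 2 * j + 1 = 1 + j * 2 by omega) ▸
      pathIn_biclique_odd hAB hadj ha hb (by omega) (by omega)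

/-- A component attached to the larger side of a biclique only. -/
theorem cycles_of_component_large_side (h3 : ThreeConn G)
    (hdeg : ∀ v, k ≤ (nbrs G Finset.univ v).card) (hAB : Disjoint A B)
    (hadj : ∀ a ∈ A, ∀ b ∈ B, G.Adj a b) (hA : 2 ≤ A.card) (hB : A.card + 1 ≤ B.card)
    (hC : ConnOn G C) (hCne : C.Nonempty) (hABC : Disjoint (A ∪ B) C)
    (hcl : ∀ u ∈ C, ∀ v, G.Adj u v → v ∈ C ∨ v ∈ B)
    (hw : ∀ w ∈ C, (nbrs G B w).card < A.card) :
    HoldsOnAP k (HasCycleLen G) := by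
  have hCH := Finset.disjoint_left.1 hABC
  have houtB : ∀ p, ∃ u ∈ C, ∃ v ∈ B, v ≠ p ∧ G.Adj u v := by
    intro p
    obtain ⟨w, hw, hwp, -⟩ := exists_mem_ne_ne_of_card (A := B) p p (by omega)
    obtain ⟨u, hu, v, hv, hvp, -, huv⟩ := h3 C hCne p p
      ⟨w, fun e => hCH (Finset.mem_union_right _ hw) e, hwp, hwp⟩
    exact ⟨u, hu, v, (hcl u hu v huv).resolve_left hv, hvp, huv⟩
  obtain ⟨r, hr⟩ := hCne
  obtain ⟨u₀, hu₀, q, hq, -, huq⟩ := houtB r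
  refine cycles_of_component (C := C) (S := B.erase q) (Y := {q}) (D := ∅)
    (H := A ∪ B) (p := A.card) (c := 2) (d := 2) h3 hdeg hC hABC
    ((Finset.erase_subset _ _).trans Finset.subset_union_right)
    (by simp [hq]) (by simp) (by simp) (by simp) ?_ ⟨u₀, hu₀, q, by simp, huq⟩ ?_ (by omega)
    (by omega) (Or.inr rfl) ?_ ?_
  · obtain ⟨u, hu, v, hv, hvq, huv⟩ := houtB q
    exact ⟨u, hu, v, by simp [hv, hvq], huv⟩
  · intro u hu v huv
    have := hcl u hu v huv
    simp only [Finset.mem_erase, Finset.mem_singleton]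
    tauto
  · intro w hwC
    have h1 := hw w hwC
    have h5 := card_nbrs_erase_add (G := G) (v := w) hq
    have h4 := card_nbrs_le G {q} w
    have h0 := card_nbrs_le G ∅ w
    rw [Finset.card_singleton] at h4
    rw [Finset.card_empty] at h0
    omega
  · intro s hs t ht j hj
    rw [Finset.mem_singleton] at ht
    rw [Finset.mem_erase] at hs
    subst ht
    exact (show 2 * (j + 1) = 2 + j * 2 by omega) ▸
      pathIn_biclique_even hAB hadj hs.2 hq hs.1 (by omega) (by omega) (by omega)

end BicliqueComponents

section ExtendedBicliques

variable {V : Type*} [DecidableEq V] {G : SimpleGraph V} {k : ℕ} {A B C : Finset V} {w w' : V}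

theorem cycles_of_biclique_insert (hAB : Disjoint A B) (hadj : ∀ a ∈ A, ∀ b ∈ B, G.Adj a b)
    (hw : w ∉ A ∪ B) (hwB : 2 ≤ (nbrs G B w).card) (hAk : k ≤ A.card)
    (hB : A.card + 1 ≤ B.card) : HoldsOnAP k (HasCycleLen G) := by
  obtain ⟨b, hb, b', hb', hbb⟩ := Finset.one_lt_card.1 (by omega : 1 < (nbrs G B w).card)
  rw [mem_nbrs] at hb hb'
  refine ⟨4, 2, Or.inr rfl, fun i hi => ?_⟩
  exact (show 2 * (i + 1) + 1 + 1 = 4 + i * 2 by omega) ▸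
    (pathIn_odd_of_adj hAB hadj hw hb.1 hb'.1 (Ne.symm hbb) hb'.2 (j := i + 1) (by omega) (by omega)
      (by omega)).hasCycleLen_of_adj (by omega) hb.2

/-- Two adjacent vertices attached to the same side of a biclique start paths of all lengths. -/
theorem pathIn_of_adj_pair (hAB : Disjoint A B) (hadj : ∀ a ∈ A, ∀ b ∈ B, G.Adj a b)
    (hw : w ∉ A ∪ B) (hw' : w' ∉ A ∪ B) (hww : G.Adj w w') (hwB : 2 ≤ (nbrs G B w).card)
    (hwB' : 2 ≤ (nbrs G B w').card) (hB : A.card + 1 ≤ B.card) {t : V} (ht : t ∈ A ∪ B) {n : ℕ}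
    (hn : 3 ≤ n) (hn' : n ≤ 2 * A.card + 1) :
    PathIn G n (insert w (insert w' (A ∪ B))) w t := by
  have hnot : w ∉ insert w' (A ∪ B) := by simp only [Finset.mem_insert, not_or]; exact ⟨hww.ne, hw⟩
  have hsub : insert w (A ∪ B) ⊆ insert w (insert w' (A ∪ B)) :=
    Finset.insert_subset_insert _ (Finset.subset_insert _ _)
  rcases Finset.mem_union.1 ht with ha | hb
  · obtain ⟨b, hb⟩ := Finset.card_pos.1 (by omega : 0 < (nbrs G B w).card)
    obtain ⟨b', hb'⟩ := Finset.card_pos.1 (by omega : 0 < (nbrs G B w').card)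
    rw [mem_nbrs] at hb hb'
    obtain ⟨m, rfl | rfl⟩ := Nat.even_or_odd' n
    · exact (show 2 * (m - 1) + 2 = 2 * m by omega) ▸
        (pathIn_even_of_adj hAB hadj hw ha hb.1 hb.2 (j := m - 1) (by omega) (by omega)).mono hsub
    · exact (show 2 * (m - 1) + 2 + 1 = 2 * m + 1 by omega) ▸
        (pathIn_even_of_adj hAB hadj hw' ha hb'.1 hb'.2 (j := m - 1)
          (by omega) (by omega)).cons hww hnot
  · obtain ⟨b, hbw, hbt⟩ := exists_mem_ne_of_card t hwB
    obtain ⟨b', hbw', hbt'⟩ := exists_mem_ne_of_card t hwB'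
    rw [mem_nbrs] at hbw hbw'
    obtain ⟨m, rfl | rfl⟩ := Nat.even_or_odd' n
    · exact (show 2 * (m - 1) + 1 + 1 = 2 * m by omega) ▸
        (pathIn_odd_of_adj hAB hadj hw' hb hbw'.1 hbt' hbw'.2 (j := m - 1) (by omega)
          (by omega) (by omega)).cons hww hnot
    · exact (pathIn_odd_of_adj hAB hadj hw hb hbw.1 hbt hbw.2 (j := m) (by omega)
          (by omega) (by omega)).mono hsub

theorem cycles_of_adj_pair (hAB : Disjoint A B) (hadj : ∀ a ∈ A, ∀ b ∈ B, G.Adj a b)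
    (hw : w ∉ A ∪ B) (hw' : w' ∉ A ∪ B) (hww : G.Adj w w') (hwB : 2 ≤ (nbrs G B w).card)
    (hwB' : 2 ≤ (nbrs G B w').card) (hB : A.card + 1 ≤ B.card) (hk : k + 1 ≤ 2 * A.card) :
    HoldsOnAP k (HasCycleLen G) := by
  obtain ⟨b, hb⟩ := Finset.card_pos.1 (by omega : 0 < (nbrs G B w).card)
  rw [mem_nbrs] at hb
  refine ⟨4, 1, Or.inl rfl, fun i hi => ?_⟩
  exact (show i + 3 + 1 = 4 + i * 1 by omega) ▸
    (pathIn_of_adj_pair hAB hadj hw hw' hww hwB hwB' hB (Finset.mem_union_right _ hb.1) (n := i + 3)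
      (by omega) (by omega)).hasCycleLen_of_adj (by omega) hb.2

variable [Fintype V]

/-- A component containing two adjacent vertices attached to the larger side of a biclique. -/
theorem cycles_of_component_adj_pair (h3 : ThreeConn G)
    (tri : ∀ a b c, G.Adj a b → G.Adj b c → ¬ G.Adj a c)
    (hdeg : ∀ v, k ≤ (nbrs G Finset.univ v).card) (hAB : Disjoint A B)
    (hadj : ∀ a ∈ A, ∀ b ∈ B, G.Adj a b) (hA : 2 ≤ A.card) (hB : A.card + 1 ≤ B.card)
    (hC : ConnOn G C) (hABC : Disjoint (A ∪ B) C)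
    (hcl : ∀ u ∈ C, ∀ v, G.Adj u v → v ∈ C ∨ v ∈ A ∪ B)
    (hsum : ∀ v ∈ C, (nbrs G (A ∪ B) v).card ≤ A.card)
    (hw : w ∈ C) (hw' : w' ∈ C) (hww : G.Adj w w')
    (hwB : 2 ≤ (nbrs G B w).card) (hwB' : 2 ≤ (nbrs G B w').card) :
    HoldsOnAP k (HasCycleLen G) := by
  have hCH := Finset.disjoint_left.1 hABC
  have hwAB : w ∉ A ∪ B := fun e => hCH e hw
  have hwAB' : w' ∉ A ∪ B := fun e => hCH e hw'
  rcases Nat.lt_or_ge k (2 * A.card) with hk | hk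
  · exact cycles_of_adj_pair hAB hadj hwAB hwAB' hww hwB hwB' hB (by omega)
  have hcU := Finset.card_union_of_disjoint hAB
  have hrw : ∃ r ∈ C, r ∉ ({w, w'} : Finset V) := by
    by_contra! hcon
    have h2 : nbrs G Finset.univ w ⊆ insert w' (nbrs G (A ∪ B) w) := by
      intro v hv
      rw [mem_nbrs] at hv
      rw [Finset.mem_insert, mem_nbrs]
      rcases hcl w hw v hv.2 with h | h
      · have := hcon v h
        simp only [Finset.mem_insert, Finset.mem_singleton] at this
        exact Or.inl (this.resolve_left hv.2.ne')
      · exact Or.inr ⟨h, hv.2⟩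
    have h4 := (Finset.card_le_card h2).trans (Finset.card_insert_le _ _)
    have := hdeg w
    have := hsum w hw
    omega
  obtain ⟨r, hr, hrw⟩ := hrw
  obtain ⟨C', hC'C, hrC', hwC', hC', hclC', u₁, hu₁, w₁, hw₁, -, huw⟩ := hC.exists_component
    (W := {w, w'}) hr hrw ⟨w, by simp, hw⟩
  have hclC'' : ∀ u ∈ C', ∀ v, G.Adj u v → v ∈ C' ∨ v ∈ ({w, w'} : Finset V) ∨ v ∈ A ∪ B := by
    intro u hu v huv
    rcases hcl u (hC'C hu) v huv with h | h
    · have := hclC' u hu v h huv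
      tauto
    · exact Or.inr (Or.inr h)
  refine cycles_of_component (C := C') (S := {w, w'}) (Y := A ∪ B) (D := ∅)
    (H := insert w (insert w' (A ∪ B))) (p := A.card + 1) (c := 3) (d := 1) h3 hdeg hC' ?_ ?_
    ?_ ?_ (by simp) (by simp) ⟨u₁, hu₁, w₁, hw₁, huw⟩ ?_ ?_ (by omega) (by omega)
    (Or.inl rfl) ?_ ?_
  · have h := Finset.disjoint_union_left.2 ⟨hwC', hABC.mono_right hC'C⟩
    simpa [Finset.insert_union] using h
  · intro v hv
    simp only [Finset.mem_insert, Finset.mem_singleton] at hv ⊢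
    tauto
  · exact (Finset.subset_insert _ _).trans (Finset.subset_insert _ _)
  · simp only [Finset.disjoint_insert_left, Finset.disjoint_singleton_left]
    exact ⟨hwAB, hwAB'⟩
  · obtain ⟨x, hx, hxw, hxw'⟩ := exists_mem_ne_ne_of_card (A := A ∪ B) w w' (by omega)
    obtain ⟨u, hu, v, hv, hvw, hvw', huv⟩ := h3 C' ⟨r, hrC'⟩ w w'
      ⟨x, fun e => hCH hx (hC'C e), hxw, hxw'⟩
    have := hclC'' u hu v huv
    simp only [Finset.mem_insert, Finset.mem_singleton] at this
    exact ⟨u, hu, v, by tauto, huv⟩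
  · intro u hu v huv
    have := hclC'' u hu v huv
    tauto
  · intro v hv
    have h1 := hsum v (hC'C hv)
    have h2 : (nbrs G {w, w'} v).card ≤ 1 := by
      rw [Finset.card_le_one]
      intro x hx y hy
      simp only [mem_nbrs, Finset.mem_insert, Finset.mem_singleton] at hx hy
      obtain ⟨rfl | rfl, hx⟩ := hx <;> obtain ⟨rfl | rfl, hy⟩ := hy
      · rfl
      · exact absurd hy (tri _ _ _ hx hww)
      · exact absurd hx (tri _ _ _ hy hww)
      · rfl
    have h0 := card_nbrs_le G ∅ v
    rw [Finset.card_empty] at h0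
    omega
  · intro s hs t ht j hj
    rw [Finset.mem_insert, Finset.mem_singleton] at hs
    rcases hs with rfl | rfl
    · exact pathIn_of_adj_pair hAB hadj hwAB hwAB' hww hwB hwB' hB ht (by omega) (by omega)
    · rw [Finset.insert_comm]
      exact pathIn_of_adj_pair hAB hadj hwAB' hwAB hww.symm hwB' hwB hB ht (by omega) (by omega)

end ExtendedBicliques

section SaturatedVertex

variable {V : Type*} [DecidableEq V] [Fintype V] {G : SimpleGraph V} {k : ℕ} {A B C : Finset V}
  {w : V}

/-- A connected set avoiding a biclique and a further vertex `w` that has as many neighbours on the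
larger side as the smaller side has vertices. -/
theorem cycles_of_component_insert (h3 : ThreeConn G)
    (hdeg : ∀ v, k ≤ (nbrs G Finset.univ v).card) (hAB : Disjoint A B)
    (hadj : ∀ a ∈ A, ∀ b ∈ B, G.Adj a b) (hA : 2 ≤ A.card) (hB : A.card + 1 ≤ B.card)
    (hC : ConnOn G C) (hABC : Disjoint (insert w (A ∪ B)) C) (hw : w ∉ A ∪ B)
    (hcl : ∀ u ∈ C, ∀ v, G.Adj u v → v ∈ C ∨ v = w ∨ v ∈ A ∪ B)
    (hlt : ∀ v ∈ C, (nbrs G A v).card < A.card ∧ (nbrs G B v).card ≤ A.card ∧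
      ((nbrs G A v).card = 0 ∨ (nbrs G B v).card = 0) ∧
      ((nbrs G {w} v).card ≠ 0 → (nbrs G B v).card < A.card))
    (hwB : (nbrs G B w).card = A.card) (hCw : ∃ u ∈ C, G.Adj u w) :
    HoldsOnAP k (HasCycleLen G) := by
  have hCH := Finset.disjoint_left.1 hABC
  have hadj' : ∀ b ∈ B, ∀ a ∈ A, G.Adj b a := fun b hb a ha => (hadj a ha b hb).symm
  have hw' := hw
  rw [Finset.mem_union, not_or] at hw'
  have hsub : A ∪ B ⊆ insert w (A ∪ B) := Finset.subset_insert _ _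
  have hAH : A ⊆ insert w (A ∪ B) := Finset.subset_union_left.trans hsub
  have hBH : B ⊆ insert w (A ∪ B) := Finset.subset_union_right.trans hsub
  have hwH : {w} ⊆ insert w (A ∪ B) := by simp
  obtain ⟨u₀, hu₀, huw⟩ := hCw
  have hout : ∀ q, ∃ u ∈ C, ∃ v ∈ A ∪ B, v ≠ q ∧ G.Adj u v := by
    intro q
    obtain ⟨x, hx, hxw, hxq⟩ := exists_mem_ne_ne_of_card (A := B) w q (by omega)
    obtain ⟨u, hu, v, hv, hvw, hvq, huv⟩ := h3 C ⟨u₀, hu₀⟩ w q ⟨x, hCH (hBH hx), hxw, hxq⟩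
    exact ⟨u, hu, v, ((hcl u hu v huv).resolve_left hv).resolve_left hvw, hvq, huv⟩
  have hempty : ∀ v, (nbrs G ∅ v).card = 0 := fun v => card_nbrs_eq_zero (by simp)
  have hone : ∀ v, (nbrs G {w} v).card ≤ 1 := fun v => by simpa using card_nbrs_le G {w} v
  by_cases hCA : ∃ u ∈ C, ∃ v ∈ A, G.Adj u v
  · by_cases hCB : ∃ u ∈ C, ∃ v ∈ B, G.Adj u v
    · refine cycles_of_component (C := C) (S := A) (Y := B) (D := {w})
        (H := insert w (A ∪ B)) (p := A.card + 1) (c := 1) (d := 2) h3 hdeg hC hABC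
        hAH hBH hAB (by simp) (by simpa using hw'.1) hCA hCB ?_ (by omega) le_rfl (Or.inr rfl) ?_ ?_
      · intro u hu v huv
        have := hcl u hu v huv
        rw [Finset.mem_union] at this
        rw [Finset.mem_singleton]
        tauto
      · intro v hv
        have := hlt v hv
        have := hone v
        omega
      · intro a ha b hb j hj
        rcases Nat.lt_or_ge j A.card with h | h
        · exact (show 2 * j + 1 = 1 + j * 2 by omega) ▸
            (pathIn_biclique_odd hAB hadj ha hb (by omega) (by omega)).mono hsub
        · exact (show 2 * A.card + 1 = 1 + j * 2 by omega) ▸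
            pathIn_odd_through hAB hadj hw ha hb (by omega) hA hB
    · refine cycles_of_component (C := C) (S := A) (Y := {w}) (D := ∅)
        (H := insert w (A ∪ B)) (p := A.card) (c := 2) (d := 2) h3 hdeg hC hABC
        hAH hwH (by simpa using hw'.1) (by simp) (by simp) hCA ⟨u₀, hu₀, w, by simp, huw⟩
        ?_ (by omega) (by omega) (Or.inr rfl) ?_ ?_
      · push Not at hCB
        intro u hu v huv
        have := hcl u hu v huv
        rw [Finset.mem_union] at this
        rw [Finset.mem_singleton]
        have h2 := hCB u hu v
        tauto
      · intro v hv
        have := hlt v hv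
        have := hone v
        have := hempty v
        omega
      · intro a ha t ht j hj
        rw [Finset.mem_singleton] at ht
        subst ht
        obtain ⟨b, hb⟩ := Finset.card_pos.1 (by omega : 0 < (nbrs G B t).card)
        rw [mem_nbrs] at hb
        exact (show 2 * j + 2 = 2 + j * 2 by omega) ▸
          (pathIn_even_of_adj hAB hadj hw ha hb.1 hb.2 (by omega) (by omega)).symm
  push Not at hCA
  have hclB : ∀ u ∈ C, ∀ v, G.Adj u v → v ∈ C ∨ v = w ∨ v ∈ B := by
    intro u hu v huv
    have := hcl u hu v huv
    rw [Finset.mem_union] at this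
    have h2 := hCA u hu v
    tauto
  have houtB : ∀ q, ∃ u ∈ C, ∃ v ∈ B, v ≠ q ∧ G.Adj u v := by
    intro q
    obtain ⟨u, hu, v, hv, hvq, huv⟩ := hout q
    exact ⟨u, hu, v, (Finset.mem_union.1 hv).resolve_left fun e => hCA u hu v e huv, hvq, huv⟩
  by_cases hq : A.card + 2 ≤ B.card ∧ ∃ q ∈ B, ¬ G.Adj w q ∧ ∃ u ∈ C, G.Adj u q
  · obtain ⟨hB2, q, hq, hwq, u₁, hu₁, huq⟩ := hq
    refine cycles_of_component (C := C) (S := B.erase q) (Y := {q}) (D := {w})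
      (H := insert w (A ∪ B)) (p := A.card + 1) (c := 2) (d := 2) h3 hdeg hC hABC
      ((Finset.erase_subset _ _).trans hBH) (by simp [hq]) (by simp) (by simp)
      (by simp [hw'.2]) ?_ ⟨u₁, hu₁, q, by simp, huq⟩ ?_ (by omega) (by omega) (Or.inr rfl) ?_ ?_
    · obtain ⟨u, hu, v, hv, hvq, huv⟩ := houtB q
      exact ⟨u, hu, v, by simp [hv, hvq], huv⟩
    · intro u hu v huv
      have := hclB u hu v huv
      simp only [Finset.mem_erase, Finset.mem_singleton]
      tauto
    · intro v hv
      have := hlt v hv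
      have := hone v
      have := card_nbrs_erase_add (G := G) (v := v) hq
      omega
    · intro b hb t ht j hj
      rw [Finset.mem_singleton] at ht
      rw [Finset.mem_erase] at hb
      subst ht
      rcases Nat.lt_or_ge j A.card with h | h
      · exact (show 2 * (j + 1) = 2 + j * 2 by omega) ▸
          (pathIn_biclique_even hAB hadj hb.2 hq hb.1 (by omega) (by omega) (by omega)).mono hsub
      · exact (show 2 * A.card + 2 = 2 + j * 2 by omega) ▸
          pathIn_even_through hAB hadj hw hb.2 hq hb.1 hwq (by omega) hA hB2
  · have hD : ∃ D ⊆ B, D.card ≤ 1 ∧ Disjoint D (nbrs G B w) ∧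
        ∀ u ∈ C, ∀ v ∈ B, G.Adj u v → v ∈ nbrs G B w ∨ v ∈ D := by
      rcases Nat.lt_or_ge B.card (A.card + 2) with h | h
      · refine ⟨B \ nbrs G B w, Finset.sdiff_subset, ?_, Finset.sdiff_disjoint,
          fun u _ v hv _ => ?_⟩
        · rw [Finset.card_sdiff_of_subset nbrs_subset]
          omega
        · rw [Finset.mem_sdiff]
          tauto
      · refine ⟨∅, by simp, by simp, by simp, fun u hu v hv huv => Or.inl (mem_nbrs.2 ⟨hv, ?_⟩)⟩
        by_contra hcon
        exact hq ⟨h, v, hv, hcon, u, hu, huv⟩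
    obtain ⟨D, hDB, hD1, hDd, hDcl⟩ := hD
    obtain ⟨e, he⟩ : ∃ e, ∀ v ∈ D, v = e := by
      rcases D.eq_empty_or_nonempty with rfl | ⟨e, he⟩
      · exact ⟨w, by simp⟩
      · exact ⟨e, fun v hv => Finset.card_le_one.1 hD1 v hv e he⟩
    refine cycles_of_component (C := C) (S := nbrs G B w) (Y := {w}) (D := D)
      (H := insert w (A ∪ B)) (p := A.card + 1) (c := 1) (d := 2) h3 hdeg hC hABC
      (nbrs_subset.trans hBH) hwH (by simp) hD1 hDd ?_ ⟨u₀, hu₀, w, by simp, huw⟩ ?_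
      (by omega) (by omega) (Or.inr rfl) ?_ ?_
    · obtain ⟨u, hu, v, hv, hve, huv⟩ := houtB e
      exact ⟨u, hu, v, (hDcl u hu v hv huv).resolve_right fun h => hve (he v h), huv⟩
    · intro u hu v huv
      have h1 := hclB u hu v huv
      have h2 := hDcl u hu v
      rw [Finset.mem_singleton]
      tauto
    · intro v hv
      have h1 := hlt v hv
      have h2 := hone v
      have h4 : (nbrs G D v).card + (nbrs G (nbrs G B w) v).card ≤ (nbrs G B v).card := by
        rw [← Finset.card_union_of_disjoint
          (hDd.mono nbrs_subset nbrs_subset)]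
        exact Finset.card_le_card (Finset.union_subset (nbrs_mono hDB) (nbrs_mono nbrs_subset))
      have h5 := (card_nbrs_le G D v).trans hD1
      omega
    · intro b hb t ht j hj
      rw [Finset.mem_singleton] at ht
      subst ht
      rcases j with _ | j
      · exact pathIn_one (hBH (nbrs_subset hb)) (by simp) (mem_nbrs.1 hb).2.symm
      · obtain ⟨b', hb', hbb'⟩ := exists_mem_ne_of_card (A := nbrs G B t) b (by omega)
        rw [mem_nbrs] at hb hb'
        exact (show 2 * (j + 1) + 1 = 1 + (j + 1) * 2 by omega) ▸
          (pathIn_odd_of_adj hAB hadj hw hb.1 hb'.1 hbb' hb'.2 (by omega) (by omega)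
            (by omega)).symm

end SaturatedVertex

section MaximalBicliques

variable {V : Type*} [DecidableEq V] [Fintype V] {G : SimpleGraph V} {k : ℕ} {A B : Finset V}

/-- A triangle-free graph, seen from a maximal biclique with sides `A` and `B`. -/
theorem cycles_of_maximal_biclique (h3 : ThreeConn G)
    (tri : ∀ a b c, G.Adj a b → G.Adj b c → ¬ G.Adj a c)
    (hdeg : ∀ v, k ≤ (nbrs G Finset.univ v).card) (hAB : Disjoint A B)
    (hadj : ∀ a ∈ A, ∀ b ∈ B, G.Adj a b) (hA : 2 ≤ A.card) (hB : A.card ≤ B.card)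
    (hmaxA : ∀ w, w ∉ B → ∃ a ∈ A, ¬ G.Adj w a)
    (hmaxB : ∀ w, w ∉ A → (nbrs G B w).card ≤ A.card)
    (hmaxB' : B.card = A.card → ∀ w, w ∉ A → (nbrs G B w).card < A.card) :
    HoldsOnAP k (HasCycleLen G) ∨ (A.card = k ∧ ∀ v, v ∈ A ∪ B) := by
  refine or_iff_not_imp_left.2 fun hcyc => ?_
  have hAk : A.card ≤ k := by
    by_contra! h
    exact hcyc (cycles_of_biclique hAB hadj (by omega) (by omega))
  by_cases hV : ∀ v, v ∈ A ∪ B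
  · refine ⟨le_antisymm hAk ?_, hV⟩
    obtain ⟨b, hb⟩ := Finset.card_pos.1 (by omega : 0 < B.card)
    obtain ⟨a, ha⟩ := Finset.card_pos.1 (by omega : 0 < A.card)
    refine (hdeg b).trans (Finset.card_le_card fun v hv => ?_)
    rw [mem_nbrs] at hv
    exact (Finset.mem_union.1 (hV v)).resolve_right fun h =>
      tri a b v (hadj a ha b hb) hv.2 (hadj a ha v h)
  exfalso
  apply hcyc
  push Not at hV
  obtain ⟨r, hr⟩ := hV
  obtain ⟨C, -, hrC, hABC, hC, hcl⟩ := exists_component_sdiff G (Finset.mem_univ r) hr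
  have hCH := Finset.disjoint_left.1 hABC
  have hcl' : ∀ u ∈ C, ∀ v, G.Adj u v → v ∈ C ∨ v ∈ A ∪ B := fun u hu v =>
    hcl u hu v (Finset.mem_univ v)
  have hCA : ∀ u ∈ C, u ∉ A := fun u hu h => hCH (Finset.mem_union_left _ h) hu
  have hCB : ∀ u ∈ C, u ∉ B := fun u hu h => hCH (Finset.mem_union_right _ h) hu
  have hltA : ∀ v ∈ C, (nbrs G A v).card < A.card := fun v hv => by
    obtain ⟨a, ha, hva⟩ := hmaxA v (hCB v hv)
    exact card_nbrs_lt ha hva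
  have hzero : ∀ v ∈ C, (nbrs G A v).card = 0 ∨ (nbrs G B v).card = 0 := by
    intro v hv
    by_contra! hcon
    obtain ⟨a, ha, hva⟩ := exists_adj_of_card_nbrs_ne_zero hcon.1
    obtain ⟨b, hb, hvb⟩ := exists_adj_of_card_nbrs_ne_zero hcon.2
    exact tri v a b hva (hadj a ha b hb) hvb
  have hsum : ∀ v ∈ C, (nbrs G (A ∪ B) v).card ≤ A.card := by
    intro v hv
    have h1 := hltA v hv
    have h2 := hzero v hv
    have h4 := hmaxB v (hCA v hv)
    have h5 := card_nbrs_union_le (G := G) (U := A) (W := B) (v := v)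
    omega
  by_cases ht : ∃ w ∈ C, (nbrs G B w).card = A.card
  · obtain ⟨w, hw, hwB⟩ := ht
    have hwAB : w ∉ A ∪ B := fun h => hCH h hw
    have hB' : A.card + 1 ≤ B.card := by
      by_contra! h
      exact (hmaxB' (by omega) w (hCA w hw)).ne hwB
    rcases Nat.lt_or_ge A.card k with hk | hk
    swap
    · exact cycles_of_biclique_insert hAB hadj hwAB (by omega) hk hB'
    by_cases hadjt : ∃ w' ∈ C, G.Adj w w' ∧ (nbrs G B w').card = A.card
    · obtain ⟨w', hw', hww, hwB'⟩ := hadjt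
      exact cycles_of_component_adj_pair h3 tri hdeg hAB hadj hA hB' hC hABC hcl' hsum hw hw' hww
        (by omega) (by omega)
    push Not at hadjt
    obtain ⟨r', hr', hr'w⟩ : ∃ r' ∈ C, r' ≠ w := by
      by_contra! hcon
      have h1 : nbrs G Finset.univ w ⊆ nbrs G (A ∪ B) w := by
        intro v hv
        rw [mem_nbrs] at hv ⊢
        exact ⟨(hcl' w hw v hv.2).resolve_left fun h => hv.2.ne' (hcon v h), hv.2⟩
      have := Finset.card_le_card h1
      have := hdeg w
      have := hsum w hw
      omega
    obtain ⟨C', hC'C, hrC', hwC', hC', hclC', u, hu, w', hw', -, huw⟩ := hC.exists_component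
      (W := {w}) hr' (by simpa using hr'w) ⟨w, by simp, hw⟩
    rw [Finset.mem_singleton] at hw'
    subst hw'
    rw [Finset.disjoint_singleton_left] at hwC'
    refine cycles_of_component_insert (w := w') h3 hdeg hAB hadj hA hB' hC'
      (Finset.disjoint_insert_left.2 ⟨hwC', hABC.mono_right hC'C⟩) hwAB ?_ ?_ hwB ⟨u, hu, huw⟩
    · intro u hu v huv
      rcases hcl' u (hC'C hu) v huv with h | h
      · have := hclC' u hu v h huv
        rw [Finset.mem_singleton] at this
        tauto
      · exact Or.inr (Or.inr h)
    · intro v hv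
      have hvC := hC'C hv
      refine ⟨hltA v hvC, hmaxB v (hCA v hvC), hzero v hvC, fun h => ?_⟩
      obtain ⟨x, hx, hvx⟩ := exists_adj_of_card_nbrs_ne_zero h
      rw [Finset.mem_singleton] at hx
      subst hx
      exact lt_of_le_of_ne (hmaxB v (hCA v hvC)) (hadjt v hvC hvx.symm)
  · push Not at ht
    have hltB : ∀ v ∈ C, (nbrs G B v).card < A.card := fun v hv =>
      lt_of_le_of_ne (hmaxB v (hCA v hv)) (ht v hv)
    by_cases hatA : ∃ u ∈ C, ∃ v ∈ A, G.Adj u v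
    · by_cases hatB : ∃ u ∈ C, ∃ v ∈ B, G.Adj u v
      · exact cycles_of_component_both h3 hdeg hAB hadj hA hB hC hABC hcl' hatA hatB
          fun v hv => ⟨hltA v hv, hltB v hv, hzero v hv⟩
      · push Not at hatB
        refine cycles_of_component_side h3 hdeg hAB hadj hA hB hAk hC ⟨r, hrC⟩ hABC
          (fun u hu v huv => (hcl' u hu v huv).imp_right fun h =>
            (Finset.mem_union.1 h).resolve_right fun h => hatB u hu v h huv)
          fun v hv => hmaxA v (hCB v hv)
    · push Not at hatA
      have hclB : ∀ u ∈ C, ∀ v, G.Adj u v → v ∈ C ∨ v ∈ B := fun u hu v huv =>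
        (hcl' u hu v huv).imp_right fun h =>
          (Finset.mem_union.1 h).resolve_left fun h => hatA u hu v h huv
      rcases hB.eq_or_lt with h | h
      · refine cycles_of_component_side h3 hdeg hAB.symm (fun b hb a ha => (hadj a ha b hb).symm)
          (by omega) (by omega) (by omega) hC ⟨r, hrC⟩ (by rwa [Finset.union_comm]) hclB
          fun v hv => ?_
        by_contra! hcon
        have h1 : nbrs G B v = B :=
          Finset.Subset.antisymm nbrs_subset fun b hb => mem_nbrs.2 ⟨hb, hcon b hb⟩
        have h2 := hltB v hv
        rw [h1] at h2
        omega
      · exact cycles_of_component_large_side h3 hdeg hAB hadj hA h hC ⟨r, hrC⟩ hABC hclB hltB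

end MaximalBicliques

section AdmissibleCycles

variable {V : Type*} [DecidableEq V] {G : SimpleGraph V} {k : ℕ}

theorem exists_biclique_of_four_cycle (h : HasCycleLen G 4) :
    ∃ A B : Finset V, A.card = 2 ∧ 2 ≤ B.card ∧ ∀ a ∈ A, ∀ b ∈ B, G.Adj a b := by
  obtain ⟨v, c, hc, hlen⟩ := h
  have hadj : ∀ i < 4, G.Adj (c.getVert i) (c.getVert (i + 1)) := fun i hi =>
    c.adj_getVert_succ (by omega)
  have hne : ∀ i j, i ≤ 3 → j ≤ 3 → i ≠ j → c.getVert i ≠ c.getVert j := fun i j hi hj hij e =>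
    hij (hc.getVert_injOn' (by rw [Set.mem_ofPred_eq]; omega) (by rw [Set.mem_ofPred_eq]; omega) e)
  have h04 : c.getVert 4 = c.getVert 0 := by
    rw [← hlen, c.getVert_length, c.getVert_zero]
  refine ⟨{c.getVert 0, c.getVert 2}, {c.getVert 1, c.getVert 3},
    Finset.card_pair (hne 0 2 (by omega) (by omega) (by omega)),
    (Finset.card_pair (hne 1 3 (by omega) (by omega) (by omega))).ge, ?_⟩
  intro a ha b hb
  simp only [Finset.mem_insert, Finset.mem_singleton] at ha hb
  rcases ha with rfl | rfl <;> rcases hb with rfl | rfl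
  · exact hadj 0 (by omega)
  · exact h04 ▸ (hadj 3 (by omega)).symm
  · exact (hadj 1 (by omega)).symm
  · exact hadj 2 (by omega)

variable [Fintype V]

/-- A maximal biclique containing all common neighbours of its smaller side. -/
theorem exists_extremal_biclique (h : ∃ A B : Finset V, A.card = 2 ∧ 2 ≤ B.card ∧
      ∀ a ∈ A, ∀ b ∈ B, G.Adj a b) :
    ∃ A B : Finset V, Disjoint A B ∧ (∀ a ∈ A, ∀ b ∈ B, G.Adj a b) ∧ 2 ≤ A.card ∧
      A.card ≤ B.card ∧ (∀ w, w ∉ B → ∃ a ∈ A, ¬ G.Adj w a) ∧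
      (∀ w, w ∉ A → (nbrs G B w).card ≤ A.card) ∧
      (B.card = A.card → ∀ w, w ∉ A → (nbrs G B w).card < A.card) := by
  classical
  let P : ℕ → Prop := fun s => ∃ A B : Finset V, A.card = s ∧ s ≤ B.card ∧
    ∀ a ∈ A, ∀ b ∈ B, G.Adj a b
  obtain ⟨s, hs, hmax⟩ : ∃ s, P s ∧ ∀ s', P s' → s' ≤ s := by
    have hbdd : ∀ s, P s → s ≤ Fintype.card V := fun s ⟨A, _, hA, _⟩ =>
      hA ▸ Finset.card_le_univ A
    exact ⟨Nat.findGreatest P (Fintype.card V), Nat.findGreatest_spec (hbdd 2 h) h,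
      fun s' hs' => Nat.le_findGreatest (hbdd s' hs') hs'⟩
  have hs2 : 2 ≤ s := hmax 2 h
  obtain ⟨A, B, hA, hB, hadj, hlarge⟩ : ∃ A B : Finset V, A.card = s ∧ s ≤ B.card ∧
      (∀ a ∈ A, ∀ b ∈ B, G.Adj a b) ∧ (B.card ≤ s → ∀ A' B' : Finset V, A'.card = s →
        s + 1 ≤ B'.card → ¬ ∀ a ∈ A', ∀ b ∈ B', G.Adj a b) := by
    by_cases hl : ∃ A B : Finset V, A.card = s ∧ s + 1 ≤ B.card ∧ ∀ a ∈ A, ∀ b ∈ B, G.Adj a b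
    · obtain ⟨A, B, hA, hB, hadj⟩ := hl
      exact ⟨A, B, hA, by omega, hadj, fun h => by omega⟩
    · obtain ⟨A, B, hA, hB, hadj⟩ := hs
      exact ⟨A, B, hA, hB, hadj, fun _ A' B' h1 h2 h3 => hl ⟨A', B', h1, h2, h3⟩⟩
  let N : Finset V := Finset.univ.filter fun b => ∀ a ∈ A, G.Adj a b
  have hN : ∀ b, b ∈ N ↔ ∀ a ∈ A, G.Adj a b := fun b => by simp [N]
  have hBN : B.card ≤ N.card := Finset.card_le_card fun b hb => (hN b).2 fun a ha => hadj a ha b hb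
  have hext : ∀ w, ∀ a ∈ insert w A, ∀ b ∈ nbrs G N w, G.Adj a b := by
    intro w a ha b hb
    rw [mem_nbrs, hN] at hb
    rcases Finset.mem_insert.1 ha with rfl | ha
    · exact hb.2
    · exact hb.1 a ha
  have hle : ∀ w, w ∉ A → (nbrs G N w).card ≤ A.card := by
    intro w hw
    by_contra! hcon
    have := hmax (s + 1) ⟨insert w A, nbrs G N w, by rw [Finset.card_insert_of_notMem hw, hA],
      by omega, hext w⟩
    omega
  refine ⟨A, N, ?_, fun a ha b hb => (hN b).1 hb a ha, by omega, by omega, fun w hw => ?_, hle,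
    fun hNA w hw => lt_of_le_of_ne (hle w hw) fun heq => ?_⟩
  · rw [Finset.disjoint_left]
    exact fun a ha ha' => G.irrefl ((hN a).1 ha' a ha)
  · rw [hN] at hw
    push Not at hw
    obtain ⟨a, ha, hwa⟩ := hw
    exact ⟨a, ha, fun h => hwa h.symm⟩
  · exact hlarge (by omega) (nbrs G N w) (insert w A) (by omega)
      (by rw [Finset.card_insert_of_notMem hw, hA]) fun a ha b hb => (hext w b hb a ha).symm

theorem exists_maximal_clique {a b c : V} (hab : G.Adj a b) (hbc : G.Adj b c) (hac : G.Adj a c) :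
    ∃ K : Finset V, (∀ a ∈ K, ∀ b ∈ K, a ≠ b → G.Adj a b) ∧ 3 ≤ K.card ∧
      ∀ w, w ∉ K → ∃ a ∈ K, ¬ G.Adj w a := by
  classical
  have hT : ∀ x ∈ ({a, b, c} : Finset V), ∀ y ∈ ({a, b, c} : Finset V), x ≠ y → G.Adj x y := by
    intro x hx y hy hxy
    simp only [Finset.mem_insert, Finset.mem_singleton] at hx hy
    rcases hx with rfl | rfl | rfl <;> rcases hy with rfl | rfl | rfl <;>
      first | exact absurd rfl hxy | assumption | (apply SimpleGraph.Adj.symm; assumption)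
  have hT3 : ({a, b, c} : Finset V).card = 3 :=
    Finset.card_eq_three.2 ⟨a, b, c, hab.ne, hac.ne, hbc.ne, rfl⟩
  obtain ⟨K, hK, hmax⟩ := (Finset.univ.filter fun K : Finset V =>
    ∀ a ∈ K, ∀ b ∈ K, a ≠ b → G.Adj a b).exists_max_image Finset.card ⟨{a, b, c}, by simpa using hT⟩
  simp only [Finset.mem_filter, Finset.mem_univ, true_and] at hK hmax
  refine ⟨K, hK, hT3 ▸ hmax _ hT, fun w hw => ?_⟩
  by_contra! hcon
  have := hmax (insert w K) fun x hx y hy hxy => ?_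
  · rw [Finset.card_insert_of_notMem hw] at this
    omega
  · rcases Finset.mem_insert.1 hx with rfl | hx <;> rcases Finset.mem_insert.1 hy with rfl | hy
    · exact absurd rfl hxy
    · exact hcon y hy
    · exact (hcon x ‹_›).symm
    · exact hK x ‹_› y hy hxy

theorem KConnected.exists_adj (h2 : KConnected G 2) (X : Finset V) (hX : X.Nonempty) (q : V)
    (hq : ∃ w, w ∉ X ∧ w ≠ q) : ∃ u ∈ X, ∃ v, v ∉ X ∧ v ≠ q ∧ G.Adj u v := by
  obtain ⟨u, hu⟩ := hX
  obtain ⟨w, hw, hwq⟩ := hq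
  obtain ⟨S, hS, hSX, hwS, hqS⟩ : ∃ S : Finset V, S.card ≤ 1 ∧ Disjoint S X ∧ w ∉ S ∧
      (q ∈ X ∨ q ∈ S) := by
    by_cases hqX : q ∈ X
    · exact ⟨∅, by simp, by simp, by simp, Or.inl hqX⟩
    · exact ⟨{q}, by simp, by simpa using hqX, by simpa using hwq, Or.inr (by simp)⟩
  have huS : u ∉ S := fun h => Finset.disjoint_left.1 hSX h hu
  obtain ⟨p⟩ := (h2.2 S (by omega)).preconnected ⟨u, by simpa using huS⟩ ⟨w, by simpa using hwS⟩
  obtain ⟨d, -, hd1, hd2⟩ := p.exists_boundary_dart {x | x.1 ∈ X} hu hw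
  have hdS : d.snd.1 ∉ S := fun h => d.snd.2 h
  refine ⟨d.fst.1, hd1, d.snd.1, hd2, fun e => ?_, d.adj⟩
  rcases hqS with h | h
  · exact hd2 (show d.snd.1 ∈ X from e ▸ h)
  · exact hdS (e ▸ h)

theorem nonempty_iso_top_of_adj {V : Type*} [Fintype V] {G : SimpleGraph V}
    (hcard : Fintype.card V = k) (h : ∀ a b, a ≠ b → G.Adj a b) :
    Nonempty (G ≃g (⊤ : SimpleGraph (Fin k))) :=
  ⟨⟨Fintype.equivFinOfCardEq hcard, fun {a b} => by
    rw [top_adj, (Fintype.equivFinOfCardEq hcard).injective.ne_iff]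
    exact ⟨h a b, fun e => e.ne⟩⟩⟩

theorem nonempty_iso_completeBipartiteGraph {A : Finset V} (hA : A.card = k)
    (h : ∀ a b, G.Adj a b ↔ a ∈ A ∧ b ∉ A ∨ a ∉ A ∧ b ∈ A) :
    Nonempty (G ≃g completeBipartiteGraph (Fin k) (Fin (Fintype.card V - k))) := by
  have e₁ : Fin k ≃ {x // x ∈ A} := (Fintype.equivFinOfCardEq (by simpa using hA)).symm
  have e₂ : Fin (Fintype.card V - k) ≃ {x // ¬ x ∈ A} := (Fintype.equivFinOfCardEq (by
    rw [Fintype.card_subtype_compl, Fintype.card_coe, hA])).symm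
  let e := (Equiv.sumCongr e₁ e₂).trans (Equiv.sumCompl (· ∈ A))
  have hl : ∀ i, e (Sum.inl i) ∈ A := fun i => (e₁ i).2
  have hr : ∀ i, e (Sum.inr i) ∉ A := fun i => (e₂ i).2
  refine ⟨RelIso.symm ⟨e, fun {x y} => ?_⟩⟩
  rcases x with i | i <;> rcases y with j | j <;> rw [h] <;>
    simp [hl, hr]

end AdmissibleCycles

/-- Let `k ≥ 3` and let `G` be a 2-connected graph with minimum
degree at least `k` containing a cycle of length 4. Then `G` contains `k` admissible
cycles, unless `G` is `K_{k+1}` or `K_{k,n-k}`. -/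
theorem stmt13 {V : Type*} [Fintype V] [DecidableEq V] (G : SimpleGraph V)
    [DecidableRel G.Adj] (k : ℕ) (hk : 3 ≤ k)
    (h2 : KConnected G 2) (hδ : ∀ v : V, k ≤ G.degree v)
    (hC4 : HasCycleLen G 4) :
    HasAdmissibleCycles G k ∨
      Nonempty (G ≃g (⊤ : SimpleGraph (Fin (k + 1)))) ∨
      Nonempty (G ≃g completeBipartiteGraph (Fin k) (Fin (Fintype.card V - k))) := by
  have hdeg : ∀ v, k ≤ (nbrs G Finset.univ v).card := fun v => by
    have h : nbrs G Finset.univ v = G.neighborFinset v := by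
      ext u
      simp
    rw [h, card_neighborFinset_eq_degree]
    exact hδ v
  rcases threeConn_or_cycles hk hdeg h2.exists_adj with h3 | h
  swap
  · exact Or.inl h
  by_cases tri : ∀ a b c, G.Adj a b → G.Adj b c → ¬ G.Adj a c
  · obtain ⟨A, B, hAB, hadj, hA, hB, h4, h5, h6⟩ :=
      exists_extremal_biclique (exists_biclique_of_four_cycle hC4)
    refine (cycles_of_maximal_biclique h3 tri hdeg hAB hadj hA hB h4 h5 h6).imp_right
      fun ⟨hAk, hV⟩ => Or.inr (nonempty_iso_completeBipartiteGraph hAk fun a b => ?_)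
    have hmem : ∀ v, v ∉ A → v ∈ B := fun v hv => (Finset.mem_union.1 (hV v)).resolve_left hv
    obtain ⟨x, hx⟩ := Finset.card_pos.1 (by omega : 0 < A.card)
    obtain ⟨y, hy⟩ := Finset.card_pos.1 (by omega : 0 < B.card)
    by_cases ha : a ∈ A <;> by_cases hb : b ∈ A
    · simpa [ha, hb] using fun h => tri a b y h (hadj b hb y hy) (hadj a ha y hy)
    · simpa [ha, hb] using hadj a ha b (hmem b hb)
    · simpa [ha, hb] using (hadj b hb a (hmem a ha)).symm
    · simpa [ha, hb] using fun h => tri x a b (hadj x hx a (hmem a ha)) h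
        (hadj x hx b (hmem b hb))
  · push Not at tri
    obtain ⟨a, b, c, hab, hbc, hac⟩ := tri
    obtain ⟨K, hK, hK3, hmax⟩ := exists_maximal_clique hab hbc hac
    exact (cycles_of_maximal_clique hk h3 hdeg hK hK3 hmax).imp_right
      fun h => Or.inl (nonempty_iso_top_of_adj h.1 h.2)
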